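/- (First deformation lemma.) Suppose G is a Finsler-type energy on ℝ^n and Φ defines a regular bounded domain Ω with constant δ₀. Let c > 0 be a V⁻-regular value for J on Mf, i.e. there is no V⁻-critical curve x ∈ Mf with J(x) = c. Then there exist ε > 0 and an admissible homotopy h : [0,1] × J^{c+ε} → J^{c+ε} such that h(1, J^{c+ε}) ⊂ J^{c−ε}. -/

import Mathlib

open MeasureTheory Set Filter RealInnerProductSpace

noncomputable section

/-- Euclidean space `ℝ^n`. -/
abbrev Evec (n : ℕ) := EuclideanSpace ℝ (Fin n)

/-- An `H¹` curve on `[a,b]`: an absolutely continuous curve whose a.e. derivative is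
square-integrable, encoded by a choice of (integrable, square-integrable) derivative
together with the fundamental theorem of calculus identity. -/
structure H1Curve (n : ℕ) (a b : ℝ) where
  toFun : ℝ → Evec n
  deriv : ℝ → Evec n
  deriv_integrable : IntegrableOn deriv (Icc a b)
  deriv_sq_integrable : IntegrableOn (fun s => ‖deriv s‖ ^ 2) (Icc a b)
  eq_add_integral : ∀ t ∈ Icc a b, toFun t = toFun a + ∫ s in a..t, deriv s

/-- The partial differential `d_qG(q,v)` of `G` in the first variable. -/
def dqCLM {n : ℕ} (G : Evec n → Evec n → ℝ) (q v : Evec n) : Evec n →L[ℝ] ℝ :=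
  fderiv ℝ (fun z => G z v) q

/-- The partial differential `d_vG(q,v)` of `G` in the second variable. -/
def dvCLM {n : ℕ} (G : Evec n → Evec n → ℝ) (q v : Evec n) : Evec n →L[ℝ] ℝ :=
  fderiv ℝ (fun w => G q w) v

/-- A Finsler-type energy on `ℝ^n` with constants `ℓ ≥ 1` and `α > 0`. -/
structure IsFinslerEnergy (n : ℕ) (G : Evec n → Evec n → ℝ) (ℓ α : ℝ) : Prop where
  continuous : Continuous fun p : Evec n × Evec n => G p.1 p.2
  smooth : ContDiffOn ℝ 2 (fun p : Evec n × Evec n => G p.1 p.2) {p | p.2 ≠ 0}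
  homog : ∀ (q v : Evec n) (lam : ℝ), 0 < lam → G q (lam • v) = lam ^ 2 * G q v
  one_le_ell : 1 ≤ ℓ
  alpha_pos : 0 < α
  lower : ∀ q v, (1 / ℓ) * ‖v‖ ^ 2 ≤ G q v
  upper : ∀ q v, G q v ≤ ℓ * ‖v‖ ^ 2
  dq_bound : ∀ q v, ‖dqCLM G q v‖ ≤ ℓ * (1 + ‖v‖ ^ 2)
  dv_bound : ∀ q v, ‖dvCLM G q v‖ ≤ ℓ * (1 + ‖v‖)
  vv_convex : ∀ (q v : Evec n), v ≠ 0 → ∀ w : Evec n,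
    α * ‖w‖ ^ 2 ≤ fderiv ℝ (fun u => dvCLM G q u w) v w

/-- `Φ` defines a regular bounded domain `Ω = Φ⁻¹((−∞,0))` with constant `δ₀`. -/
structure IsRegularDomain (n : ℕ) (Φ : Evec n → ℝ) (δ₀ : ℝ) : Prop where
  smooth : ContDiff ℝ 2 Φ
  nonempty : (Φ ⁻¹' Iio 0).Nonempty
  bounded : Bornology.IsBounded (Φ ⁻¹' Iio 0)
  boundary_eq : frontier (Φ ⁻¹' Iio 0) = Φ ⁻¹' {0}
  delta0_pos : 0 < δ₀
  grad_ne_zero : ∀ q : Evec n, |Φ q| ≤ δ₀ → gradient Φ q ≠ 0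
  sublevel_compact : ∀ δ ∈ Icc (0:ℝ) δ₀, IsCompact (Φ ⁻¹' Iic δ)

/-- Membership in `Mf`: curves in `Ω̄` with endpoints on `∂Ω`. -/
def MemMf {n : ℕ} (Φ : Evec n → ℝ) (x : H1Curve n 0 1) : Prop :=
  (∀ s ∈ Icc (0:ℝ) 1, Φ (x.toFun s) ≤ 0) ∧ Φ (x.toFun 0) = 0 ∧ Φ (x.toFun 1) = 0

/-- Membership in `V⁻(x,Mf)`. -/
def MemVminus {n : ℕ} (Φ : Evec n → ℝ) (x ξ : H1Curve n 0 1) : Prop :=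
  ⟪gradient Φ (x.toFun 0), ξ.toFun 0⟫ = 0 ∧
  ⟪gradient Φ (x.toFun 1), ξ.toFun 1⟫ = 0 ∧
  ∀ s ∈ Ioo (0:ℝ) 1, Φ (x.toFun s) = 0 → ⟪gradient Φ (x.toFun s), ξ.toFun s⟫ ≤ 0

/-- Membership in `W⁻(x,Mf)`: as `V⁻` but with strict inequality at interior touching points. -/
def MemWminus {n : ℕ} (Φ : Evec n → ℝ) (x ξ : H1Curve n 0 1) : Prop :=
  MemVminus Φ x ξ ∧
  ∀ s ∈ Ioo (0:ℝ) 1, Φ (x.toFun s) = 0 → ⟪gradient Φ (x.toFun s), ξ.toFun s⟫ < 0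

/-- The energy functional `J(x) = (1/2)∫₀¹ G(x,ẋ)`. -/
def energy {n : ℕ} (G : Evec n → Evec n → ℝ) (x : H1Curve n 0 1) : ℝ :=
  (1 / 2) * ∫ s in (0:ℝ)..1, G (x.toFun s) (x.deriv s)

/-- The differential `dJ(x)[ξ]`. -/
def dJ {n : ℕ} (G : Evec n → Evec n → ℝ) (x ξ : H1Curve n 0 1) : ℝ :=
  (1 / 2) * ∫ s in (0:ℝ)..1,
    (dqCLM G (x.toFun s) (x.deriv s) (ξ.toFun s) + dvCLM G (x.toFun s) (x.deriv s) (ξ.deriv s))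

/-- `x` is a `V⁻`-critical curve for `J` on `Mf`. -/
def IsVCritical {n : ℕ} (G : Evec n → Evec n → ℝ) (Φ : Evec n → ℝ) (x : H1Curve n 0 1) : Prop :=
  MemMf Φ x ∧ ∀ ξ : H1Curve n 0 1, MemVminus Φ x ξ → 0 ≤ dJ G x ξ

/-- The norm `‖ξ‖_*`. -/
def starNorm {n : ℕ} (ξ : H1Curve n 0 1) : ℝ :=
  max ‖ξ.toFun 0‖ ‖ξ.toFun 1‖ + Real.sqrt (∫ s in (0:ℝ)..1, ‖ξ.deriv s‖ ^ 2)

/-- The distance `dist_*`. -/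
def starDist {n : ℕ} (x y : H1Curve n 0 1) : ℝ :=
  max ‖x.toFun 0 - y.toFun 0‖ ‖x.toFun 1 - y.toFun 1‖ +
    Real.sqrt (∫ s in (0:ℝ)..1, ‖x.deriv s - y.deriv s‖ ^ 2)

/-- The penalization function `χ_δ`. -/
def chi (δ t : ℝ) : ℝ := if t ≤ 0 then 0 else t ^ 2 / (δ - t) ^ 2

/-- Membership in `C_δ = C([a,b],p,q,Ω_δ)`. -/
def MemC {n : ℕ} (Φ : Evec n → ℝ) (δ a b : ℝ) (p q : Evec n) (γ : H1Curve n a b) : Prop :=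
  (∀ s ∈ Icc a b, Φ (γ.toFun s) < δ) ∧ γ.toFun a = p ∧ γ.toFun b = q

/-- The penalized functional `J_δ`. -/
def Jpen {n : ℕ} (G : Evec n → Evec n → ℝ) (Φ : Evec n → ℝ) (δ a b : ℝ)
    (γ : H1Curve n a b) : ℝ :=
  (1 / 2) * (∫ s in a..b, G (γ.toFun s) (γ.deriv s)) + ∫ s in a..b, chi δ (Φ (γ.toFun s))

/-- `y` represents the backward parametrization `ℛx` of `x` (on `[0,1]`). -/
def RevRep {n : ℕ} (x y : H1Curve n 0 1) : Prop :=
  (∀ s, y.toFun s = x.toFun (1 - s)) ∧ (∀ s, y.deriv s = -x.deriv (1 - s))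

/-- `x` is a constant curve (an element of `Cf₀` when `x ∈ Mf`). -/
def IsConstCurve {n : ℕ} (x : H1Curve n 0 1) : Prop :=
  ∀ s ∈ Icc (0:ℝ) 1, x.toFun s = x.toFun 0

/-- The sublevel set `J^c` of `J` in `Mf`. -/
def sublevel {n : ℕ} (G : Evec n → Evec n → ℝ) (Φ : Evec n → ℝ) (c : ℝ) :
    Set (H1Curve n 0 1) :=
  {x | MemMf Φ x ∧ energy G x ≤ c}

noncomputable section
open MeasureTheory Set Filter RealInnerProductSpace Topology
namespace FD

/-- Lebesgue measure on the unit interval. -/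
abbrev μ1 : Measure ℝ := volume.restrict (Ioc (0:ℝ) 1)

instance : IsProbabilityMeasure μ1 := ⟨by simp⟩

/-- Square integrable velocities. -/
abbrev L2 (n : ℕ) := Lp (Evec n) 2 μ1

/-- The Hilbert space model of `H¹([0,1])`: initial point and velocity. -/
abbrev EE (n : ℕ) := Evec n × L2 n

variable {n : ℕ}

theorem L2_memLp (u : L2 n) : MemLp (fun s => u s) 2 μ1 := Lp.memLp u

theorem L2_int (u : L2 n) : Integrable (fun s => u s) μ1 :=
  (L2_memLp u).integrable one_le_two

theorem memLp_norm_sq {F : Type*} [NormedAddCommGroup F] {f : ℝ → F} (hf : MemLp f 2 μ1) :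
    Integrable (fun s => ‖f s‖ ^ 2) μ1 := by
  exact (memLp_two_iff_integrable_sq_norm hf.1).1 hf

theorem L2_int_sq (u : L2 n) : Integrable (fun s => ‖u s‖ ^ 2) μ1 :=
  memLp_norm_sq (L2_memLp u)

theorem L2_int_norm (u : L2 n) : Integrable (fun s => ‖u s‖) μ1 := (L2_int u).norm

theorem L2_norm_sq (u : L2 n) : ‖u‖ ^ 2 = ∫ s, ‖u s‖ ^ 2 ∂μ1 := by
  rw [← real_inner_self_eq_norm_sq, L2.inner_def]
  simp

/-- Cauchy-Schwarz. -/
theorem holder {f g : ℝ → ℝ} (hf : MemLp f 2 μ1) (hg : MemLp g 2 μ1) :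
    Integrable (fun s => f s * g s) μ1 ∧
    ∫ s, |f s| * |g s| ∂μ1 ≤ Real.sqrt (∫ s, f s ^ 2 ∂μ1) * Real.sqrt (∫ s, g s ^ 2 ∂μ1) := by
  refine ⟨hf.integrable_mul hg, ?_⟩
  have h := integral_mul_norm_le_Lp_mul_Lq (μ := μ1) (f := f) (g := g) (p := 2) (q := 2)
    Real.HolderConjugate.two_two (by simpa using hf) (by simpa using hg)
  simpa [Real.sqrt_eq_rpow] using h

theorem holder_le {f g : ℝ → ℝ} {a b : ℝ} (hf : MemLp f 2 μ1) (hg : MemLp g 2 μ1)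
    (ha : 0 ≤ a) (hb : 0 ≤ b)
    (hfa : ∫ s, f s ^ 2 ∂μ1 ≤ a ^ 2) (hgb : ∫ s, g s ^ 2 ∂μ1 ≤ b ^ 2) :
    ∫ s, f s * g s ∂μ1 ≤ a * b := by
  obtain ⟨hi, h⟩ := holder hf hg
  calc ∫ s, f s * g s ∂μ1 ≤ ∫ s, |f s| * |g s| ∂μ1 := by
        apply integral_mono hi
        · simpa [abs_mul] using hi.abs
        · intro s; simp only; rw [← abs_mul]; exact le_abs_self _
    _ ≤ _ := h
    _ ≤ a * b := by
        gcongr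
        · exact Real.sqrt_le_iff.2 ⟨ha, hfa⟩
        · exact Real.sqrt_le_iff.2 ⟨hb, hgb⟩

theorem L2_norm_setInt (u : L2 n) (A : Set ℝ) (hA : MeasurableSet A) :
    ‖∫ r in A, u r ∂μ1‖ ≤ Real.sqrt (μ1.real A) * ‖u‖ := by
  have h1 : ‖∫ r in A, u r ∂μ1‖ ≤ ∫ r in A, ‖u r‖ ∂μ1 := norm_integral_le_integral_norm _
  have h2 : ∫ r in A, ‖u r‖ ∂μ1 = ∫ r, (A.indicator (fun _ => (1:ℝ)) r) * ‖u r‖ ∂μ1 := by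
    rw [← integral_indicator hA]
    congr 1
    ext r
    by_cases hr : r ∈ A <;> simp [hr]
  rw [h2] at h1
  refine h1.trans (holder_le ?_ (L2_memLp u).norm (Real.sqrt_nonneg _) (norm_nonneg _) ?_ ?_)
  · exact (memLp_indicator_const 2 hA 1 (Or.inr (measure_ne_top _ _)))
  · rw [Real.sq_sqrt measureReal_nonneg]
    have : (fun s => (A.indicator (fun _ => (1:ℝ)) s) ^ 2) = A.indicator (fun _ => (1:ℝ)) := by
      ext r; by_cases hr : r ∈ A <;> simp [hr]
    rw [this, integral_indicator hA]; simp
  · rw [L2_norm_sq]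

/-- Evaluation of the curve represented by `x`. -/
def ev (x : EE n) (s : ℝ) : Evec n := x.1 + ∫ r in Iic s, x.2 r ∂μ1

theorem ev_add (x y : EE n) (s : ℝ) : ev (x + y) s = ev x s + ev y s := by
  unfold ev
  have : ∫ r in Iic s, (x + y).2 r ∂μ1 = ∫ r in Iic s, (x.2 r + y.2 r) ∂μ1 := by
    apply integral_congr_ae
    exact ae_restrict_of_ae (Lp.coeFn_add x.2 y.2)
  rw [this, integral_add (L2_int _).integrableOn (L2_int _).integrableOn]
  simp only [Prod.fst_add]
  abel

theorem ev_smul (a : ℝ) (x : EE n) (s : ℝ) : ev (a • x) s = a • ev x s := by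
  unfold ev
  have : ∫ r in Iic s, (a • x).2 r ∂μ1 = ∫ r in Iic s, (a • x.2 r) ∂μ1 := by
    apply integral_congr_ae
    exact ae_restrict_of_ae (Lp.coeFn_smul a x.2)
  rw [this, integral_smul]
  simp

theorem ev_neg (x : EE n) (s : ℝ) : ev (-x) s = - ev x s := by
  have := ev_smul (-1) x s
  simpa using this

theorem ev_sub (x y : EE n) (s : ℝ) : ev (x - y) s = ev x s - ev y s := by
  rw [sub_eq_add_neg, ev_add, ev_neg, sub_eq_add_neg]

theorem ev_zero' (s : ℝ) : ev (0 : EE n) s = 0 := by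
  have := ev_smul 0 (0 : EE n) s
  simpa using this

theorem norm_ev_le (x : EE n) (s : ℝ) : ‖ev x s‖ ≤ 2 * ‖x‖ := by
  have h := L2_norm_setInt x.2 (Iic s) measurableSet_Iic
  have h1 : Real.sqrt (μ1.real (Iic s)) ≤ 1 := by
    rw [Real.sqrt_le_iff]; exact ⟨zero_le_one, by rw [one_pow]; exact measureReal_le_one⟩
  have h2 : ‖x.2‖ ≤ ‖x‖ := norm_snd_le x
  have h3 : ‖x.1‖ ≤ ‖x‖ := norm_fst_le x
  have := norm_add_le x.1 (∫ r in Iic s, x.2 r ∂μ1)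
  unfold ev
  nlinarith [norm_nonneg x.2, Real.sqrt_nonneg (μ1.real (Iic s))]

theorem ev_sub_ev (x : EE n) {s t : ℝ} (h : s ≤ t) :
    ev x t - ev x s = ∫ r in Ioc s t, x.2 r ∂μ1 := by
  unfold ev
  have : Iic t = Iic s ∪ Ioc s t := (Iic_union_Ioc_eq_Iic h).symm
  have hd : Disjoint (Iic s) (Ioc s t) := Set.disjoint_left.2 fun r hr hr' => not_lt.2 hr hr'.1
  rw [this, setIntegral_union hd
    measurableSet_Ioc (L2_int _).integrableOn (L2_int _).integrableOn]
  abel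

theorem norm_ev_sub_le (x : EE n) {s t : ℝ} (h : s ≤ t) :
    ‖ev x t - ev x s‖ ≤ Real.sqrt (t - s) * ‖x.2‖ := by
  rw [ev_sub_ev x h]
  refine (L2_norm_setInt x.2 _ measurableSet_Ioc).trans ?_
  gcongr
  have : μ1 (Ioc s t) ≤ volume (Ioc s t) := Measure.restrict_apply_le _ _
  have h2 := ENNReal.toReal_mono (by simp) this
  simpa [Measure.real, h] using h2

theorem norm_ev_sub_le' (x : EE n) (s t : ℝ) :
    ‖ev x t - ev x s‖ ≤ Real.sqrt |t - s| * ‖x.2‖ := by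
  rcases le_total s t with h | h
  · rw [abs_of_nonneg (by linarith)]; exact norm_ev_sub_le x h
  · rw [abs_of_nonpos (by linarith), norm_sub_rev, neg_sub]; exact norm_ev_sub_le x h

theorem ev_continuous (x : EE n) : Continuous (ev x) := by
  rw [continuous_iff_continuousAt]
  intro s
  rw [ContinuousAt, tendsto_iff_norm_sub_tendsto_zero]
  refine squeeze_zero (fun _ => norm_nonneg _) (fun t => norm_ev_sub_le' x s t) ?_
  have : Continuous fun t => Real.sqrt |t - s| * ‖x.2‖ := by fun_prop
  simpa using this.tendsto s

theorem ev_nonpos (x : EE n) {s : ℝ} (h : s ≤ 0) : ev x s = x.1 := by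
  unfold ev
  have : ∫ r in Iic s, x.2 r ∂μ1 = 0 := by
    apply setIntegral_measure_zero
    rw [Measure.restrict_apply measurableSet_Iic]
    convert measure_empty (μ := volume)
    ext r; simp; intro h1 h2; linarith
  rw [this, add_zero]

theorem ev_ge_one (x : EE n) {s : ℝ} (h : 1 ≤ s) : ev x s = ev x 1 := by
  have : ev x s - ev x 1 = 0 := by
    rw [ev_sub_ev x h]
    apply setIntegral_measure_zero
    rw [Measure.restrict_apply measurableSet_Ioc]
    convert measure_empty (μ := volume)
    ext r; simp; intro h1 h2 h3; linarith
  exact sub_eq_zero.1 this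

/-- evaluation is jointly continuous -/
theorem ev_continuous_left (s : ℝ) : Continuous (fun x : EE n => ev x s) := by
  rw [continuous_iff_continuousAt]
  intro x
  rw [ContinuousAt, tendsto_iff_norm_sub_tendsto_zero]
  refine squeeze_zero (g := fun y => 2 * ‖y - x‖) (fun _ => norm_nonneg _) (fun y => ?_) ?_
  · rw [← ev_sub]; exact norm_ev_le _ _
  · have : Continuous fun y : EE n => 2 * ‖y - x‖ := by fun_prop
    simpa using this.tendsto x

theorem ev_eq_interval (x : EE n) {s : ℝ} (h : s ∈ Icc (0:ℝ) 1) :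
    ev x s = x.1 + ∫ r in (0:ℝ)..s, x.2 r := by
  unfold ev
  rw [Measure.restrict_restrict measurableSet_Iic, intervalIntegral.integral_of_le h.1]
  congr 3
  ext r; simp only [mem_inter_iff, mem_Iic, mem_Ioc]
  exact ⟨fun ⟨a, b⟩ => ⟨b.1, a⟩, fun ⟨a, b⟩ => ⟨b, a, b.trans h.2⟩⟩

theorem memLp_deriv (x : H1Curve n 0 1) : MemLp x.deriv 2 μ1 := by
  have h1 : Integrable x.deriv μ1 := x.deriv_integrable.mono_set Ioc_subset_Icc_self
  have h2 : Integrable (fun s => ‖x.deriv s‖ ^ 2) μ1 :=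
    x.deriv_sq_integrable.mono_set Ioc_subset_Icc_self
  exact (memLp_two_iff_integrable_sq_norm h1.1).2 h2

/-- The element of the model space given by an `H¹` curve. -/
def toE (x : H1Curve n 0 1) : EE n := (x.toFun 0, (memLp_deriv x).toLp x.deriv)

theorem toE_ae (x : H1Curve n 0 1) : (fun s => (toE x).2 s) =ᵐ[μ1] x.deriv :=
  (memLp_deriv x).coeFn_toLp

theorem ev_toE (x : H1Curve n 0 1) {s : ℝ} (h : s ∈ Icc (0:ℝ) 1) :
    ev (toE x) s = x.toFun s := by
  rw [x.eq_add_integral s h]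
  unfold ev
  rw [integral_congr_ae (ae_restrict_of_ae (toE_ae x)),
    Measure.restrict_restrict measurableSet_Iic, intervalIntegral.integral_of_le h.1]
  have : Iic s ∩ Ioc 0 1 = Ioc 0 s := by
    ext r; simp only [mem_inter_iff, mem_Iic, mem_Ioc]
    exact ⟨fun ⟨a, b⟩ => ⟨b.1, a⟩, fun ⟨a, b⟩ => ⟨b, a, b.trans h.2⟩⟩
  rw [this]; rfl

/-- A curve realizing an element of the model space. -/
def ofE (x : EE n) : H1Curve n 0 1 where
  toFun := ev x
  deriv := fun s => x.2 s
  deriv_integrable := by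
    rw [integrableOn_Icc_iff_integrableOn_Ioc]; exact L2_int x.2
  deriv_sq_integrable := by
    rw [integrableOn_Icc_iff_integrableOn_Ioc]; exact L2_int_sq x.2
  eq_add_integral := by
    intro t ht
    rw [ev_eq_interval x ht, ev_nonpos x le_rfl]

theorem toE_ofE (x : EE n) : toE (ofE x) = x := by
  refine Prod.ext ?_ ?_
  · exact ev_nonpos x le_rfl
  · apply Lp.ext; exact toE_ae (ofE x)

theorem toE_sub_norm (x y : H1Curve n 0 1) :
    ‖(toE x).2 - (toE y).2‖ = Real.sqrt (∫ s in (0:ℝ)..1, ‖x.deriv s - y.deriv s‖ ^ 2) := by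
  rw [eq_comm, Real.sqrt_eq_iff_eq_sq (by
      rw [intervalIntegral.integral_of_le zero_le_one]
      exact integral_nonneg fun _ => by positivity) (norm_nonneg _), L2_norm_sq,
    intervalIntegral.integral_of_le zero_le_one]
  apply integral_congr_ae
  filter_upwards [toE_ae x, toE_ae y, Lp.coeFn_sub (toE x).2 (toE y).2] with s h1 h2 h3
  rw [h3, Pi.sub_apply, h1, h2]

theorem norm_toE_sub_le (x y : H1Curve n 0 1) : ‖toE x - toE y‖ ≤ starDist x y := by
  unfold starDist
  rw [← toE_sub_norm, Prod.norm_def]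
  have h1 : ‖(toE x - toE y).1‖ = ‖x.toFun 0 - y.toFun 0‖ := rfl
  have h2 : (toE x - toE y).2 = (toE x).2 - (toE y).2 := rfl
  rw [h1, h2]
  have := le_max_left ‖x.toFun 0 - y.toFun 0‖ ‖x.toFun 1 - y.toFun 1‖
  have h3 := norm_nonneg ((toE x).2 - (toE y).2)
  have h4 := norm_nonneg (x.toFun 0 - y.toFun 0)
  apply max_le <;> linarith

theorem starDist_le (x y : H1Curve n 0 1) : starDist x y ≤ 3 * ‖toE x - toE y‖ := by
  unfold starDist
  rw [← toE_sub_norm]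
  have h1 : ‖x.toFun 0 - y.toFun 0‖ ≤ 2 * ‖toE x - toE y‖ := by
    rw [← ev_toE x (by simp), ← ev_toE y (by simp), ← ev_sub]; exact norm_ev_le _ _
  have h2 : ‖x.toFun 1 - y.toFun 1‖ ≤ 2 * ‖toE x - toE y‖ := by
    rw [← ev_toE x (by simp), ← ev_toE y (by simp), ← ev_sub]; exact norm_ev_le _ _
  have h3 : ‖(toE x).2 - (toE y).2‖ ≤ ‖toE x - toE y‖ := norm_snd_le (toE x - toE y)
  have := max_le h1 h2
  linarith

/-- Energy on the model space. -/
def Jf (G : Evec n → Evec n → ℝ) (x : EE n) : ℝ := (1 / 2) * ∫ s, G (ev x s) (x.2 s) ∂μ1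

/-- First variation integrand. -/
def dInt (G : Evec n → Evec n → ℝ) (x ξ : EE n) (s : ℝ) : ℝ :=
  dqCLM G (ev x s) (x.2 s) (ev ξ s) + dvCLM G (ev x s) (x.2 s) (ξ.2 s)

/-- First variation on the model space. -/
def dJf (G : Evec n → Evec n → ℝ) (x ξ : EE n) : ℝ := (1 / 2) * ∫ s, dInt G x ξ s ∂μ1

theorem energy_eq (G : Evec n → Evec n → ℝ) (x : H1Curve n 0 1) :
    energy G x = Jf G (toE x) := by
  unfold energy Jf
  rw [intervalIntegral.integral_of_le zero_le_one]
  congr 1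
  apply integral_congr_ae
  filter_upwards [toE_ae x, ae_restrict_mem measurableSet_Ioc] with s h1 h2
  rw [h1, ev_toE x ⟨h2.1.le, h2.2⟩]

theorem dJ_eq (G : Evec n → Evec n → ℝ) (x ξ : H1Curve n 0 1) :
    dJ G x ξ = dJf G (toE x) (toE ξ) := by
  unfold dJ dJf dInt
  rw [intervalIntegral.integral_of_le zero_le_one]
  congr 1
  apply integral_congr_ae
  filter_upwards [toE_ae x, toE_ae ξ, ae_restrict_mem measurableSet_Ioc] with s h1 h3 h2
  rw [h1, h3, ev_toE x ⟨h2.1.le, h2.2⟩, ev_toE ξ ⟨h2.1.le, h2.2⟩]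

/-- The constrained set in the model space. -/
def XX (Φ : Evec n → ℝ) : Set (EE n) :=
  {x | (∀ s ∈ Icc (0:ℝ) 1, Φ (ev x s) ≤ 0) ∧ Φ (ev x 0) = 0 ∧ Φ (ev x 1) = 0}

theorem memMf_iff (Φ : Evec n → ℝ) (x : H1Curve n 0 1) : MemMf Φ x ↔ toE x ∈ XX Φ := by
  unfold MemMf XX
  simp only [mem_ofPred_eq]
  rw [ev_toE x (s := 0) (by simp), ev_toE x (s := 1) (by simp)]
  refine and_congr_left fun _ => ?_
  exact forall₂_congr fun s hs => by rw [ev_toE x hs]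

theorem XX_closed {Φ : Evec n → ℝ} (hΦ : Continuous Φ) : IsClosed (XX Φ) := by
  have : XX Φ = (⋂ s ∈ Icc (0:ℝ) 1, {x | Φ (ev x s) ≤ 0}) ∩
      ({x | Φ (ev x 0) = 0} ∩ {x | Φ (ev x 1) = 0}) := by
    ext x; simp [XX]
  rw [this]
  refine IsClosed.inter ?_ (IsClosed.inter ?_ ?_)
  · exact isClosed_biInter fun s _ =>
      isClosed_le (hΦ.comp (ev_continuous_left s)) continuous_const
  · exact isClosed_eq (hΦ.comp (ev_continuous_left 0)) continuous_const
  · exact isClosed_eq (hΦ.comp (ev_continuous_left 1)) continuous_const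

end FD
end

noncomputable section
open MeasureTheory Set Filter RealInnerProductSpace Topology
namespace FD

theorem clm_meas {F F' : Type*} [NormedAddCommGroup F] [NormedSpace ℝ F]
    [NormedAddCommGroup F'] [NormedSpace ℝ F'] {A : ℝ → F →L[ℝ] F'} {u : ℝ → F}
    (hA : AEStronglyMeasurable A μ1) (hu : AEStronglyMeasurable u μ1) :
    AEStronglyMeasurable (fun s => A s (u s)) μ1 :=
  (isBoundedBilinearMap_apply (𝕜 := ℝ) (E := F) (F := F')).continuous.comp_aestronglyMeasurable
    (hA.prodMk hu)

/-- Chain rule for continuous velocities. -/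
theorem chain_cont {F F' : Type*} [NormedAddCommGroup F] [NormedSpace ℝ F] [CompleteSpace F]
    [NormedAddCommGroup F'] [NormedSpace ℝ F'] [CompleteSpace F']
    {f : F → F'} (hf : ContDiff ℝ 1 f) {v : ℝ → F} (hv : Continuous v) (x0 : F)
    {s : ℝ} (hs : s ∈ Icc (0:ℝ) 1) :
    f (x0 + ∫ r in (0:ℝ)..s, v r) = f x0 +
      ∫ r in (0:ℝ)..s, fderiv ℝ f (x0 + ∫ r in (0:ℝ)..r, v r) (v r) := by
  have hd : ∀ r, HasDerivAt (fun r => x0 + ∫ t in (0:ℝ)..r, v t) (v r) r := fun r =>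
    (intervalIntegral.integral_hasDerivAt_right (hv.intervalIntegrable _ _)
      (hv.stronglyMeasurableAtFilter _ _) hv.continuousAt).const_add x0
  have hc : Continuous (fun r => x0 + ∫ t in (0:ℝ)..r, v t) :=
    continuous_iff_continuousAt.2 fun r => (hd r).continuousAt
  have hd2 : ∀ r, HasDerivAt (fun r => f (x0 + ∫ t in (0:ℝ)..r, v t))
      (fderiv ℝ f (x0 + ∫ t in (0:ℝ)..r, v t) (v r)) r := fun r =>
    ((hf.differentiable one_ne_zero _).hasFDerivAt).comp_hasDerivAt r (hd r)
  have hc2 : Continuous fun r => fderiv ℝ f (x0 + ∫ t in (0:ℝ)..r, v t) (v r) :=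
    ((hf.continuous_fderiv one_ne_zero).comp hc).clm_apply hv
  rw [intervalIntegral.integral_eq_sub_of_hasDerivAt (fun r _ => hd2 r)
    (hc2.intervalIntegrable _ _)]
  simp

theorem restrict_Iic {s : ℝ} (h : s ∈ Icc (0:ℝ) 1) :
    μ1.restrict (Iic s) = volume.restrict (Ioc 0 s) := by
  rw [Measure.restrict_restrict measurableSet_Iic]
  congr 1
  ext r; simp only [mem_inter_iff, mem_Iic, mem_Ioc]
  exact ⟨fun ⟨a, b⟩ => ⟨b.1, a⟩, fun ⟨a, b⟩ => ⟨b, a, b.trans h.2⟩⟩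

theorem int_Iic {F : Type*} [NormedAddCommGroup F] [NormedSpace ℝ F] (v : ℝ → F)
    {s : ℝ} (h : s ∈ Icc (0:ℝ) 1) :
    ∫ r in Iic s, v r ∂μ1 = ∫ r in (0:ℝ)..s, v r := by
  rw [restrict_Iic h, intervalIntegral.integral_of_le h.1]

/-- Chain rule for integrable velocities. -/
theorem chain_int {F F' : Type*} [NormedAddCommGroup F] [NormedSpace ℝ F] [CompleteSpace F]
    [ProperSpace F]
    [NormedAddCommGroup F'] [NormedSpace ℝ F'] [CompleteSpace F']
    {f : F → F'} (hf : ContDiff ℝ 1 f) {u x : ℝ → F} (hu : Integrable u μ1) (x0 : F)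
    (hx : ∀ s, x s = x0 + ∫ r in Iic s, u r ∂μ1) (hxc : Continuous x)
    {s : ℝ} (hs : s ∈ Icc (0:ℝ) 1) :
    f (x s) = f x0 + ∫ r in Iic s, fderiv ℝ f (x r) (u r) ∂μ1 := by
  have hDf : Continuous (fderiv ℝ f) := hf.continuous_fderiv one_ne_zero
  -- bounds
  set I0 : ℝ := ∫ r, ‖u r‖ ∂μ1 with hI0
  have hI0n : 0 ≤ I0 := integral_nonneg fun _ => norm_nonneg _
  set R : ℝ := ‖x0‖ + I0 + 1 with hR
  have hxR : ∀ r, ‖x r‖ ≤ R - 1 := by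
    intro r
    rw [hx r]
    refine (norm_add_le _ _).trans ?_
    have : ‖∫ r in Iic r, u r ∂μ1‖ ≤ I0 :=
      (norm_integral_le_integral_norm _).trans
        (setIntegral_le_integral hu.norm (ae_of_all _ fun _ => norm_nonneg _))
    linarith
  have hK : IsCompact (Metric.closedBall (0:F) R) := isCompact_closedBall _ _
  obtain ⟨C, hC⟩ := hK.exists_bound_of_continuousOn hDf.continuousOn
  have hC0 : 0 ≤ C := (norm_nonneg _).trans (hC 0 (by simp; positivity))
  have huc := hK.uniformContinuousOn_of_continuous hDf.continuousOn
  rw [Metric.uniformContinuousOn_iff] at huc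
  rw [← sub_eq_zero, ← norm_eq_zero]
  refine le_antisymm (le_of_forall_pos_le_add fun ε hε => ?_) (norm_nonneg _)
  rw [zero_add]
  -- choose the modulus
  set ε1 : ℝ := ε / (2 * (I0 + 2)) with hε1
  have hε1p : 0 < ε1 := by positivity
  obtain ⟨δ, hδ, hδ'⟩ := huc ε1 hε1p
  -- continuity of f at x s
  obtain ⟨δ2, hδ2, hδ2'⟩ := Metric.continuousAt_iff.1 (hf.continuous.continuousAt (x := x s))
    (ε/4) (by positivity)
  set η : ℝ := min (min (δ/2) (δ2/2)) (min 1 (ε / (4 * (C+1)))) with hη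
  have hηp : 0 < η := by positivity
  obtain ⟨v, hvs, hv, hvc, hvi⟩ := hu.exists_hasCompactSupport_integral_sub_le hηp
  have hη1 : η ≤ δ/2 := (min_le_left _ _).trans (min_le_left _ _)
  have hη2 : η ≤ δ2/2 := (min_le_left _ _).trans (min_le_right _ _)
  have hη3 : η ≤ 1 := (min_le_right _ _).trans (min_le_left _ _)
  have hη4 : η ≤ ε / (4 * (C+1)) := (min_le_right _ _).trans (min_le_right _ _)
  set y : ℝ → F := fun r => x0 + ∫ t in Iic r, v t ∂μ1 with hy
  have hyx : ∀ r, ‖x r - y r‖ ≤ η := by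
    intro r
    rw [hx r, hy]
    simp only [add_sub_add_left_eq_sub]
    rw [← integral_sub hu.integrableOn hvi.integrableOn]
    exact ((norm_integral_le_integral_norm _).trans
        (setIntegral_le_integral (hu.sub hvi).norm (ae_of_all _ fun _ => norm_nonneg _))).trans hv
  have hyR : ∀ r, y r ∈ Metric.closedBall (0:F) R := by
    intro r
    rw [mem_closedBall_zero_iff]
    have : ‖y r‖ ≤ ‖x r‖ + ‖x r - y r‖ := by
      have := norm_sub_le (x r) (x r - y r); simpa using this
    linarith [hyx r, hxR r]
  have hxR' : ∀ r, x r ∈ Metric.closedBall (0:F) R := by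
    intro r
    rw [mem_closedBall_zero_iff]; linarith [hxR r]
  have hyeq : ∀ r ∈ Icc (0:ℝ) 1, y r = x0 + ∫ t in (0:ℝ)..r, v t := by
    intro r hr; rw [hy]; simp only; rw [int_Iic v hr]
  have hch := chain_cont hf hvc x0 hs
  have hch2 : f (y s) = f x0 + ∫ r in Iic s, fderiv ℝ f (y r) (v r) ∂μ1 := by
    rw [hyeq s hs, hch, int_Iic _ hs]
    congr 1
    apply intervalIntegral.integral_congr
    intro r hr
    simp only
    rw [uIcc_of_le hs.1] at hr
    rw [hyeq r ⟨hr.1, hr.2.trans hs.2⟩]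
  have hym : Continuous fun r => fderiv ℝ f (x0 + ∫ t in (0:ℝ)..r, v t) (v r) := by
    have : Continuous fun r => x0 + ∫ t in (0:ℝ)..r, v t :=
      continuous_const.add (intervalIntegral.continuous_primitive
        (fun a b => hvc.intervalIntegrable a b) 0)
    exact (hDf.comp this).clm_apply hvc
  have hyint : Integrable (fun r => fderiv ℝ f (y r) (v r)) μ1 := by
    have h1 : Integrable (fun r => fderiv ℝ f (x0 + ∫ t in (0:ℝ)..r, v t) (v r)) μ1 :=
      (hym.integrableOn_Icc (a := 0) (b := 1)).mono_set Ioc_subset_Icc_self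
    refine h1.congr ?_
    filter_upwards [ae_restrict_mem measurableSet_Ioc] with r hr
    rw [hyeq r ⟨hr.1.le, hr.2⟩]
  have hxint : Integrable (fun r => fderiv ℝ f (x r) (u r)) μ1 := by
    refine (hu.norm.const_mul C).mono' ?_ ?_
    · exact clm_meas (hDf.comp hxc).aestronglyMeasurable hu.1
    · refine ae_of_all _ fun r => ?_
      exact ((fderiv ℝ f (x r)).le_opNorm _).trans (by gcongr; exact hC _ (hxR' r))
  have hfd : ‖f (x s) - f (y s)‖ ≤ ε/4 := by
    have := hδ2' (x := y s) (by rw [dist_comm, dist_eq_norm]; linarith [hyx s])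
    rw [dist_comm, dist_eq_norm] at this; exact this.le
  have hpt : ∀ r, ‖fderiv ℝ f (y r) (v r) - fderiv ℝ f (x r) (u r)‖ ≤
      ε1 * ‖u r‖ + (C) * ‖u r - v r‖ := by
    intro r
    have e : fderiv ℝ f (y r) (v r) - fderiv ℝ f (x r) (u r) =
        (fderiv ℝ f (y r) - fderiv ℝ f (x r)) (u r) - fderiv ℝ f (y r) (u r - v r) := by
      simp
    rw [e]
    refine (norm_sub_le _ _).trans (add_le_add ?_ ?_)
    · refine (ContinuousLinearMap.le_opNorm _ _).trans ?_
      gcongr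
      have := hδ' (y r) (hyR r) (x r) (hxR' r) (by
        rw [dist_comm, dist_eq_norm]; linarith [hyx r])
      rw [dist_eq_norm] at this; exact this.le
    · exact (ContinuousLinearMap.le_opNorm _ _).trans (by gcongr; exact hC _ (hyR r))
  have hID : ‖(∫ r in Iic s, fderiv ℝ f (y r) (v r) ∂μ1) -
      ∫ r in Iic s, fderiv ℝ f (x r) (u r) ∂μ1‖ ≤ ε1 * I0 + C * η := by
    rw [← integral_sub hyint.integrableOn hxint.integrableOn]
    refine (norm_integral_le_integral_norm _).trans ?_
    refine (setIntegral_le_integral (hyint.sub hxint).norm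
      (ae_of_all _ fun _ => norm_nonneg _)).trans ?_
    have hb : Integrable (fun r => ε1 * ‖u r‖ + C * ‖u r - v r‖) μ1 :=
      (hu.norm.const_mul _).add ((hu.sub hvi).norm.const_mul _)
    refine (integral_mono (hyint.sub hxint).norm hb hpt).trans ?_
    have hi2 : Integrable (fun r => C * ‖u r - v r‖) μ1 := (hu.sub hvi).norm.const_mul _
    rw [integral_add (hu.norm.const_mul _) hi2,
      integral_const_mul, integral_const_mul]
    gcongr
  have e2 : f (x s) - (f x0 + ∫ r in Iic s, fderiv ℝ f (x r) (u r) ∂μ1) =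
      (f (x s) - f (y s)) + ((∫ r in Iic s, fderiv ℝ f (y r) (v r) ∂μ1) -
        ∫ r in Iic s, fderiv ℝ f (x r) (u r) ∂μ1) := by
    rw [hch2]; abel
  rw [e2]
  refine (norm_add_le _ _).trans ?_
  have h5 : ε1 * I0 ≤ ε/2 := by
    rw [hε1, div_mul_eq_mul_div, div_le_div_iff₀ (by positivity) (by positivity)]
    nlinarith
  have h6 : C * η ≤ ε/4 := by
    have : C * η ≤ (C+1) * (ε / (4 * (C+1))) := by gcongr; linarith
    have h7 : (C+1) * (ε / (4 * (C+1))) = ε/4 := by field_simp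
    linarith
  linarith

variable {n : ℕ}

/-- Composition of two `H¹` curves with a `C¹` map. -/
theorem exists_comp {f : Evec n × Evec n → Evec n} (hf : ContDiff ℝ 1 f) (x y : EE n) :
    ∃ z : EE n, (∀ s ∈ Icc (0:ℝ) 1, ev z s = f (ev x s, ev y s)) ∧ z.1 = f (x.1, y.1) ∧
      (fun s => z.2 s) =ᵐ[μ1] fun s => fderiv ℝ f (ev x s, ev y s) (x.2 s, y.2 s) := by
  have hDf : Continuous (fderiv ℝ f) := hf.continuous_fderiv one_ne_zero
  have hc : Continuous fun s => (ev x s, ev y s) := (ev_continuous x).prodMk (ev_continuous y)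
  have hm : MemLp (fun s => fderiv ℝ f (ev x s, ev y s) (x.2 s, y.2 s)) 2 μ1 := by
    obtain ⟨C, hC⟩ := (isCompact_Icc (a := (0:ℝ)) (b := 1)).exists_bound_of_continuousOn
      (hDf.comp hc).continuousOn
    have hg : MemLp (fun s => C * (‖x.2 s‖ + ‖y.2 s‖)) 2 μ1 :=
      ((L2_memLp x.2).norm.add (L2_memLp y.2).norm).const_mul C
    refine hg.mono' ?_ ?_
    · exact clm_meas (hDf.comp hc).aestronglyMeasurable
        ((L2_memLp x.2).1.prodMk (L2_memLp y.2).1)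
    · filter_upwards [ae_restrict_mem measurableSet_Ioc] with s hs
      have h1 := hC s ⟨hs.1.le, hs.2⟩
      refine (ContinuousLinearMap.le_opNorm _ _).trans ?_
      have h2 : ‖(x.2 s, y.2 s)‖ ≤ ‖x.2 s‖ + ‖y.2 s‖ := by
        rw [Prod.norm_def]
        exact max_le (by linarith [norm_nonneg (y.2 s)]) (by linarith [norm_nonneg (x.2 s)])
      have h3 : 0 ≤ C := (norm_nonneg _).trans h1
      exact mul_le_mul h1 h2 (norm_nonneg _) h3
  refine ⟨(f (x.1, y.1), hm.toLp _), ?_, rfl, hm.coeFn_toLp⟩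
  intro s hs
  have hi : Integrable (fun s => (x.2 s, y.2 s)) μ1 := (L2_int x.2).prodMk (L2_int y.2)
  have := chain_int hf (x := fun s => (ev x s, ev y s)) hi (x.1, y.1) (by
    intro r
    rw [integral_pair (L2_int x.2).integrableOn (L2_int y.2).integrableOn]
    rfl) hc hs
  rw [this]
  unfold ev
  simp only
  congr 1
  exact integral_congr_ae (ae_restrict_of_ae hm.coeFn_toLp)

end FD
end

noncomputable section
open MeasureTheory Set Filter RealInnerProductSpace Topology
namespace FD
variable {n : ℕ} {G : Evec n → Evec n → ℝ} {ℓ α : ℝ}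

/-- The uncurried energy density. -/
def Gh (G : Evec n → Evec n → ℝ) (p : Evec n × Evec n) : ℝ := G p.1 p.2

theorem G_nonneg (hG : IsFinslerEnergy n G ℓ α) (q v : Evec n) : 0 ≤ G q v := by
  have h1 := hG.one_le_ell
  exact le_trans (by positivity) (hG.lower q v)

theorem G_zero (hG : IsFinslerEnergy n G ℓ α) (q : Evec n) : G q 0 = 0 := by
  have h1 := hG.upper q 0
  have h2 := G_nonneg hG q 0
  simp at h1
  linarith

theorem Gh_diff_zero (hG : IsFinslerEnergy n G ℓ α) (q : Evec n) :
    HasFDerivAt (Gh G) (0 : Evec n × Evec n →L[ℝ] ℝ) (q, 0) := by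
  have hl := hG.one_le_ell
  rw [hasFDerivAt_iff_isLittleO]
  rw [Asymptotics.isLittleO_iff]
  intro c hc
  have : Metric.ball (q, (0:Evec n)) (c / ℓ) ∈ 𝓝 (q, (0:Evec n)) :=
    Metric.ball_mem_nhds _ (by positivity)
  filter_upwards [this] with p hp
  rw [mem_ball_iff_norm] at hp
  simp only [Gh, G_zero hG, zero_apply, sub_zero]
  rw [Real.norm_eq_abs, abs_of_nonneg (G_nonneg hG _ _)]
  refine (hG.upper _ _).trans ?_
  have h1 : ‖p.2‖ ≤ ‖p - (q, 0)‖ := by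
    have := norm_snd_le (p - (q, (0:Evec n))); simpa using this
  have h2 : ‖p.2‖ ≤ c / ℓ := h1.trans hp.le
  calc ℓ * ‖p.2‖ ^ 2 = (ℓ * ‖p.2‖) * ‖p.2‖ := by ring
    _ ≤ (ℓ * (c / ℓ)) * ‖p - (q, 0)‖ := by gcongr
    _ = c * ‖p - (q, 0)‖ := by field_simp

theorem isOpen_ne : IsOpen {p : Evec n × Evec n | p.2 ≠ 0} :=
  isOpen_compl_singleton.preimage continuous_snd

theorem Gh_diff (hG : IsFinslerEnergy n G ℓ α) (p : Evec n × Evec n) :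
    DifferentiableAt ℝ (Gh G) p := by
  by_cases h : p.2 = 0
  · have := (Gh_diff_zero hG p.1).differentiableAt
    rwa [show p = (p.1, 0) from Prod.ext rfl h]
  · exact (hG.smooth.contDiffAt (isOpen_ne.mem_nhds h)).differentiableAt two_ne_zero

theorem dq_eq (hG : IsFinslerEnergy n G ℓ α) (q v : Evec n) :
    dqCLM G q v = (fderiv ℝ (Gh G) (q, v)).comp (ContinuousLinearMap.inl ℝ _ _) := by
  have h2 : HasFDerivAt (fun e : Evec n => (e, v)) (ContinuousLinearMap.inl ℝ (Evec n) (Evec n)) q :=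
    hasFDerivAt_prodMk_left q v
  have h := HasFDerivAt.comp (g := Gh G) q (Gh_diff hG (q, v)).hasFDerivAt h2
  exact h.fderiv

theorem dv_eq (hG : IsFinslerEnergy n G ℓ α) (q v : Evec n) :
    dvCLM G q v = (fderiv ℝ (Gh G) (q, v)).comp (ContinuousLinearMap.inr ℝ _ _) := by
  have h := (Gh_diff hG (q, v)).hasFDerivAt.comp v (hasFDerivAt_prodMk_right q v)
  exact h.fderiv

theorem fderiv_Gh (hG : IsFinslerEnergy n G ℓ α) (q v η ζ : Evec n) :
    fderiv ℝ (Gh G) (q, v) (η, ζ) = dqCLM G q v η + dvCLM G q v ζ := by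
  rw [dq_eq hG, dv_eq hG]
  simp [← map_add]

theorem dq_homog (hG : IsFinslerEnergy n G ℓ α) (q v : Evec n) {a : ℝ} (ha : 0 < a) :
    dqCLM G q (a • v) = a ^ 2 • dqCLM G q v := by
  unfold dqCLM
  have : (fun z => G z (a • v)) = a ^ 2 • fun z => G z v := by
    ext z; simp [hG.homog z v a ha]
  rw [this, fderiv_const_smul_field]
  rfl

theorem dv_homog (hG : IsFinslerEnergy n G ℓ α) (q v : Evec n) {a : ℝ} (ha : 0 < a) :
    dvCLM G q (a • v) = a • dvCLM G q v := by
  have h1 : HasFDerivAt (fun w => G q w) (dvCLM G q v) v := by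
    have h := (Gh_diff hG (q, v)).hasFDerivAt.comp v (hasFDerivAt_prodMk_right q v)
    exact h.differentiableAt.hasFDerivAt
  have h3 : HasFDerivAt (fun w => G q w) (dvCLM G q (a • v)) (a • v) := by
    have h := (Gh_diff hG (q, a • v)).hasFDerivAt.comp (a • v) (hasFDerivAt_prodMk_right q (a • v))
    exact h.differentiableAt.hasFDerivAt
  have h2 : HasFDerivAt (fun w : Evec n => a • w) (a • ContinuousLinearMap.id ℝ (Evec n)) v :=
    (hasFDerivAt_id v).const_smul a
  have h4 := h3.comp v h2
  have h5 : ((fun w => G q w) ∘ fun w : Evec n => a • w) = fun w => a ^ 2 * G q w := by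
    ext w; simp [hG.homog q w a ha]
  rw [h5] at h4
  have h6 := h4.unique (h1.const_mul (a ^ 2))
  ext w
  have h7 := congrArg (fun L => L w) h6
  simp at h7
  simp
  have : a * (dvCLM G q (a • v) w) = a * (a * dvCLM G q v w) := by rw [h7]; ring
  exact mul_left_cancel₀ ha.ne' this

theorem dv_zero (hG : IsFinslerEnergy n G ℓ α) (q : Evec n) : dvCLM G q 0 = 0 := by
  rw [dv_eq hG, (Gh_diff_zero hG q).fderiv]; simp

theorem dq_zero (hG : IsFinslerEnergy n G ℓ α) (q : Evec n) : dqCLM G q 0 = 0 := by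
  rw [dq_eq hG, (Gh_diff_zero hG q).fderiv]; simp

theorem dv_le (hG : IsFinslerEnergy n G ℓ α) (q v : Evec n) : ‖dvCLM G q v‖ ≤ ℓ * ‖v‖ := by
  have hl := hG.one_le_ell
  refine le_of_forall_pos_le_add fun ε hε => ?_
  have ha : 0 < ℓ / ε := by positivity
  have := hG.dv_bound q ((ℓ / ε) • v)
  rw [dv_homog hG q v ha, norm_smul, norm_smul, Real.norm_of_nonneg ha.le] at this
  have h2 : ‖dvCLM G q v‖ ≤ (ℓ * (1 + ℓ / ε * ‖v‖)) / (ℓ / ε) := by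
    rw [le_div_iff₀ ha]; linarith
  refine h2.trans (le_of_eq ?_)
  field_simp
  ring

theorem dq_le (hG : IsFinslerEnergy n G ℓ α) (q v : Evec n) : ‖dqCLM G q v‖ ≤ ℓ * ‖v‖ ^ 2 := by
  have hl := hG.one_le_ell
  refine le_of_forall_pos_le_add fun ε hε => ?_
  set a := max 1 (ℓ / ε) with ha'
  have ha : 0 < a := by positivity
  have ha1 : 1 ≤ a := le_max_left _ _
  have ha2 : ℓ / ε ≤ a := le_max_right _ _
  have := hG.dq_bound q (a • v)
  rw [dq_homog hG q v ha, norm_smul, norm_smul, Real.norm_of_nonneg ha.le, norm_pow,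
    Real.norm_of_nonneg ha.le] at this
  have h2 : ‖dqCLM G q v‖ ≤ (ℓ * (1 + (a * ‖v‖) ^ 2)) / a ^ 2 := by
    rw [le_div_iff₀ (by positivity)]; linarith
  refine h2.trans ?_
  rw [div_le_iff₀ (by positivity)]
  rw [div_le_iff₀ hε] at ha2
  have h3 : a * ε ≤ a ^ 2 * ε := by
    rw [pow_two, mul_assoc]; exact le_mul_of_one_le_left (by positivity) ha1
  nlinarith

theorem fderiv_Gh_contAt (hG : IsFinslerEnergy n G ℓ α) {p : Evec n × Evec n} (h : p.2 ≠ 0) :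
    ContinuousAt (fderiv ℝ (Gh G)) p := by
  have h1 : ContDiffOn ℝ 1 (fderiv ℝ (Gh G)) {p | p.2 ≠ 0} :=
    hG.smooth.fderiv_of_isOpen isOpen_ne (by norm_num)
  exact h1.continuousOn.continuousAt (isOpen_ne.mem_nhds h)

theorem dv_cont (hG : IsFinslerEnergy n G ℓ α) :
    Continuous fun p : Evec n × Evec n => dvCLM G p.1 p.2 := by
  rw [continuous_iff_continuousAt]
  intro p
  by_cases h : p.2 = 0
  · rw [ContinuousAt, h, dv_zero hG]
    rw [tendsto_zero_iff_norm_tendsto_zero]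
    refine squeeze_zero (fun _ => norm_nonneg _) (fun y => dv_le hG y.1 y.2) ?_
    have : Continuous fun y : Evec n × Evec n => ℓ * ‖y.2‖ := by fun_prop
    simpa [h] using this.tendsto p
  · have : (fun p : Evec n × Evec n => dvCLM G p.1 p.2) =
        fun p => (fderiv ℝ (Gh G) p).comp (ContinuousLinearMap.inr ℝ _ _) := by
      ext1 p; exact dv_eq hG p.1 p.2
    rw [this]
    exact (fderiv_Gh_contAt hG h).clm_comp continuousAt_const

theorem dq_cont (hG : IsFinslerEnergy n G ℓ α) :
    Continuous fun p : Evec n × Evec n => dqCLM G p.1 p.2 := by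
  rw [continuous_iff_continuousAt]
  intro p
  by_cases h : p.2 = 0
  · rw [ContinuousAt, h, dq_zero hG]
    rw [tendsto_zero_iff_norm_tendsto_zero]
    refine squeeze_zero (fun _ => norm_nonneg _) (fun y => dq_le hG y.1 y.2) ?_
    have : Continuous fun y : Evec n × Evec n => ℓ * ‖y.2‖ ^ 2 := by fun_prop
    simpa [h] using this.tendsto p
  · have : (fun p : Evec n × Evec n => dqCLM G p.1 p.2) =
        fun p => (fderiv ℝ (Gh G) p).comp (ContinuousLinearMap.inl ℝ _ _) := by
      ext1 p; exact dq_eq hG p.1 p.2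
    rw [this]
    exact (fderiv_Gh_contAt hG h).clm_comp continuousAt_const

/-- Uniform continuity modulus on bounded sets. -/
theorem unif_mod {f : Evec n × Evec n → Evec n →L[ℝ] ℝ} (hf : Continuous f) (B : ℝ) {ε : ℝ}
    (hε : 0 < ε) : ∃ δ > 0, ∀ q q' v v' : Evec n, ‖q‖ ≤ B → ‖q'‖ ≤ B → ‖v‖ ≤ 1 → ‖v'‖ ≤ 1 →
      ‖q - q'‖ < δ → ‖v - v'‖ < δ → ‖f (q', v') - f (q, v)‖ ≤ ε := by
  have hK : IsCompact ((Metric.closedBall (0:Evec n) B) ×ˢ (Metric.closedBall (0:Evec n) 1)) :=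
    (isCompact_closedBall _ _).prod (isCompact_closedBall _ _)
  have huc := hK.uniformContinuousOn_of_continuous hf.continuousOn
  rw [Metric.uniformContinuousOn_iff] at huc
  obtain ⟨δ, hδ, h⟩ := huc ε hε
  refine ⟨δ, hδ, fun q q' v v' h1 h2 h3 h4 h5 h6 => ?_⟩
  have := h (q', v') (by simp [h2, h4]) (q, v) (by simp [h1, h3]) (by
    rw [dist_comm, dist_eq_norm, Prod.norm_def]; exact max_lt h5 h6)
  rw [dist_eq_norm] at this
  exact this.le

theorem dv_mod (hG : IsFinslerEnergy n G ℓ α) (B : ℝ) {ε : ℝ} (hε : 0 < ε) :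
    ∃ C ≥ 0, ∀ q q' v v' : Evec n, ‖q‖ ≤ B → ‖q'‖ ≤ B →
      ‖dvCLM G q' v' - dvCLM G q v‖ ≤ ε * (‖v‖ + ‖v'‖) +
        C * (‖q - q'‖ * (‖v‖ + ‖v'‖) + ‖v - v'‖) := by
  have hl := hG.one_le_ell
  obtain ⟨δ, hδ, h⟩ := unif_mod (dv_cont hG) B hε
  refine ⟨ℓ / δ, by positivity, fun q q' v v' h1 h2 => ?_⟩
  set M := ‖v‖ + ‖v'‖ with hM
  have hM0 : 0 ≤ M := by positivity
  rcases hM0.eq_or_lt with h0 | h0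
  · have hv : v = 0 := norm_eq_zero.1 (by linarith [norm_nonneg v, norm_nonneg v'])
    have hv' : v' = 0 := norm_eq_zero.1 (by linarith [norm_nonneg v, norm_nonneg v'])
    rw [hv, hv', dv_zero hG, dv_zero hG, ← h0]; simp
  by_cases hd : ‖q - q'‖ < δ ∧ ‖v - v'‖ < δ * M
  · have e : ∀ w : Evec n, M • (M⁻¹ • w) = w := fun w => by rw [smul_smul, mul_inv_cancel₀ h0.ne', one_smul]
    have hMi : ‖M⁻¹‖ = M⁻¹ := Real.norm_of_nonneg (by positivity)
    have := h q q' (M⁻¹ • v) (M⁻¹ • v') h1 h2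
      (by rw [norm_smul, hMi, inv_mul_le_iff₀ h0]; linarith [norm_nonneg v'])
      (by rw [norm_smul, hMi, inv_mul_le_iff₀ h0]; linarith [norm_nonneg v]) hd.1
      (by rw [← smul_sub, norm_smul, hMi, inv_mul_lt_iff₀ h0]; linarith [hd.2])
    have k1 := dv_homog hG q (M⁻¹ • v) h0
    have k2 := dv_homog hG q' (M⁻¹ • v') h0
    rw [e] at k1 k2
    have k3 : dvCLM G q' v' - dvCLM G q v =
        M • (dvCLM G q' (M⁻¹ • v') - dvCLM G q (M⁻¹ • v)) := by
      rw [k1, k2]; exact (smul_sub M _ _).symm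
    rw [k3, norm_smul, Real.norm_of_nonneg h0.le]
    have h3 : 0 ≤ ℓ / δ * (‖q - q'‖ * M + ‖v - v'‖) := by positivity
    nlinarith
  · have h3 : δ * M ≤ ‖q - q'‖ * M + ‖v - v'‖ := by
      rw [not_and_or, not_lt, not_lt] at hd
      rcases hd with hd | hd
      · nlinarith [norm_nonneg (v - v')]
      · nlinarith [norm_nonneg (q - q')]
    have h4 : ‖dvCLM G q' v' - dvCLM G q v‖ ≤ ℓ * M := by
      refine (norm_sub_le _ _).trans ?_
      rw [hM, mul_add]; linarith [dv_le hG q v, dv_le hG q' v']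
    have h5 : ℓ * M ≤ ℓ / δ * (‖q - q'‖ * M + ‖v - v'‖) := by
      calc ℓ * M = ℓ / δ * (δ * M) := by field_simp
        _ ≤ _ := by gcongr
    have : 0 ≤ ε * M := by positivity
    linarith

theorem dq_mod (hG : IsFinslerEnergy n G ℓ α) (B : ℝ) {ε : ℝ} (hε : 0 < ε) :
    ∃ C ≥ 0, ∀ q q' v v' : Evec n, ‖q‖ ≤ B → ‖q'‖ ≤ B →
      ‖dqCLM G q' v' - dqCLM G q v‖ ≤ ε * (‖v‖ + ‖v'‖) ^ 2 +
        C * (‖q - q'‖ * (‖v‖ + ‖v'‖) ^ 2 + ‖v - v'‖ * (‖v‖ + ‖v'‖)) := by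
  have hl := hG.one_le_ell
  obtain ⟨δ, hδ, h⟩ := unif_mod (dq_cont hG) B hε
  refine ⟨ℓ / δ, by positivity, fun q q' v v' h1 h2 => ?_⟩
  set M := ‖v‖ + ‖v'‖ with hM
  have hM0 : 0 ≤ M := by positivity
  rcases hM0.eq_or_lt with h0 | h0
  · have hv : v = 0 := norm_eq_zero.1 (by linarith [norm_nonneg v, norm_nonneg v'])
    have hv' : v' = 0 := norm_eq_zero.1 (by linarith [norm_nonneg v, norm_nonneg v'])
    rw [hv, hv', dq_zero hG, dq_zero hG, ← h0]; simp
  by_cases hd : ‖q - q'‖ < δ ∧ ‖v - v'‖ < δ * M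
  · have e : ∀ w : Evec n, M • (M⁻¹ • w) = w := fun w => by rw [smul_smul, mul_inv_cancel₀ h0.ne', one_smul]
    have hMi : ‖M⁻¹‖ = M⁻¹ := Real.norm_of_nonneg (by positivity)
    have := h q q' (M⁻¹ • v) (M⁻¹ • v') h1 h2
      (by rw [norm_smul, hMi, inv_mul_le_iff₀ h0]; linarith [norm_nonneg v'])
      (by rw [norm_smul, hMi, inv_mul_le_iff₀ h0]; linarith [norm_nonneg v]) hd.1
      (by rw [← smul_sub, norm_smul, hMi, inv_mul_lt_iff₀ h0]; linarith [hd.2])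
    have k1 := dq_homog hG q (M⁻¹ • v) h0
    have k2 := dq_homog hG q' (M⁻¹ • v') h0
    rw [e] at k1 k2
    have k3 : dqCLM G q' v' - dqCLM G q v =
        M ^ 2 • (dqCLM G q' (M⁻¹ • v') - dqCLM G q (M⁻¹ • v)) := by
      rw [k1, k2]; exact (smul_sub (M ^ 2) _ _).symm
    rw [k3, norm_smul, Real.norm_of_nonneg (pow_nonneg h0.le 2)]
    have h3 : 0 ≤ ℓ / δ * (‖q - q'‖ * M ^ 2 + ‖v - v'‖ * M) := by positivity
    have h4 : 0 ≤ M ^ 2 := by positivity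
    nlinarith
  · have h3 : δ * M ≤ ‖q - q'‖ * M + ‖v - v'‖ := by
      rw [not_and_or, not_lt, not_lt] at hd
      rcases hd with hd | hd
      · nlinarith [norm_nonneg (v - v')]
      · nlinarith [norm_nonneg (q - q')]
    have h4 : ‖dqCLM G q' v' - dqCLM G q v‖ ≤ ℓ * M ^ 2 := by
      refine (norm_sub_le _ _).trans ?_
      have h6 : ‖v‖ ^ 2 + ‖v'‖ ^ 2 ≤ M ^ 2 := by
        rw [hM]; nlinarith [norm_nonneg v, norm_nonneg v', mul_nonneg (norm_nonneg v) (norm_nonneg v')]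
      nlinarith [dq_le hG q v, dq_le hG q' v']
    have h5 : ℓ * M ^ 2 ≤ ℓ / δ * (‖q - q'‖ * M ^ 2 + ‖v - v'‖ * M) := by
      calc ℓ * M ^ 2 = ℓ / δ * ((δ * M) * M) := by field_simp
        _ ≤ ℓ / δ * ((‖q - q'‖ * M + ‖v - v'‖) * M) := by gcongr
        _ = _ := by ring
    have : 0 ≤ ε * M ^ 2 := by positivity
    linarith

theorem dv_line (hG : IsFinslerEnergy n G ℓ α) (q v w : Evec n) {a b : ℝ} (hab : a ≤ b)
    (hne : ∀ t ∈ Ioo a b, v + t • w ≠ 0) :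
    dvCLM G q (v + a • w) w - α * ‖w‖ ^ 2 * a ≤ dvCLM G q (v + b • w) w - α * ‖w‖ ^ 2 * b := by
  have hd : ∀ t ∈ Ioo a b, HasDerivAt (fun t => dvCLM G q (v + t • w) w - α * ‖w‖ ^ 2 * t)
      (fderiv ℝ (fun u => dvCLM G q u w) (v + t • w) w - α * ‖w‖ ^ 2) t := by
    intro t ht
    have h0 := hne t ht
    have h1 : DifferentiableAt ℝ (fun u => dvCLM G q u w) (v + t • w) := by
      have h2 : ContDiffOn ℝ 1 (fderiv ℝ (Gh G)) {p | p.2 ≠ 0} :=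
        hG.smooth.fderiv_of_isOpen isOpen_ne (by norm_num)
      have h3 : DifferentiableAt ℝ (fderiv ℝ (Gh G)) (q, v + t • w) :=
        (h2.contDiffAt (isOpen_ne.mem_nhds h0)).differentiableAt one_ne_zero
      have h4 : DifferentiableAt ℝ (fun u => fderiv ℝ (Gh G) (q, u)) (v + t • w) :=
        h3.comp (v + t • w) (hasFDerivAt_prodMk_right q (v + t • w)).differentiableAt
      have h5 : (fun u => dvCLM G q u w) = fun u => fderiv ℝ (Gh G) (q, u) (0, w) := by
        ext u; rw [fderiv_Gh hG]; simp
      rw [h5]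
      exact h4.clm_apply (differentiableAt_const _)
    have h6 : HasDerivAt (fun t : ℝ => v + t • w) w t := by
      simpa using ((hasDerivAt_id t).smul_const w).const_add v
    have h7 := h1.hasFDerivAt.comp_hasDerivAt t h6
    have h8 : HasDerivAt (fun t : ℝ => α * ‖w‖ ^ 2 * t) (α * ‖w‖ ^ 2) t := by
      simpa using (hasDerivAt_id t).const_mul (α * ‖w‖ ^ 2)
    exact h7.sub h8
  have hmono : MonotoneOn (fun t => dvCLM G q (v + t • w) w - α * ‖w‖ ^ 2 * t) (Icc a b) := by
    apply monotoneOn_of_deriv_nonneg (convex_Icc a b)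
    · have hc : Continuous fun t : ℝ => dvCLM G q (v + t • w) := by
        have := (dv_cont hG).comp (f := fun t : ℝ => (q, v + t • w)) (by fun_prop)
        exact this
      exact ((hc.clm_apply continuous_const).sub (by fun_prop)).continuousOn
    · rw [interior_Icc]
      exact fun t ht => (hd t ht).differentiableAt.differentiableWithinAt
    · rw [interior_Icc]
      intro t ht
      rw [(hd t ht).deriv]
      linarith [hG.vv_convex q _ (hne t ht) w]
  exact hmono (left_mem_Icc.2 hab) (right_mem_Icc.2 hab) hab

theorem dv_mono (hG : IsFinslerEnergy n G ℓ α) (q v v' : Evec n) :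
    α * ‖v' - v‖ ^ 2 ≤ (dvCLM G q v' - dvCLM G q v) (v' - v) := by
  set w := v' - v with hw
  have hv' : v' = v + (1:ℝ) • w := by rw [hw]; simp
  have hv : v = v + (0:ℝ) • w := by simp
  have key : dvCLM G q (v + (0:ℝ) • w) w - α * ‖w‖ ^ 2 * 0 ≤
      dvCLM G q (v + (1:ℝ) • w) w - α * ‖w‖ ^ 2 * 1 := by
    by_cases hex : ∃ t ∈ Ioo (0:ℝ) 1, v + t • w = 0
    · obtain ⟨t, ht, h0⟩ := hex
      by_cases hw0 : w = 0
      · simp [hw0]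
      have huniq : ∀ t' : ℝ, v + t' • w = 0 → t' = t := by
        intro t' h'
        have : (t' - t) • w = 0 := by
          rw [sub_smul, sub_eq_zero]; exact add_left_cancel (h'.trans h0.symm)
        rcases smul_eq_zero.1 this with h | h
        · linarith
        · exact absurd h hw0
      exact (dv_line hG q v w ht.1.le (fun t' ht' h' => ht'.2.ne (huniq t' h'))).trans
        (dv_line hG q v w ht.2.le (fun t' ht' h' => ht'.1.ne' (huniq t' h')))
    · push Not at hex
      exact dv_line hG q v w zero_le_one hex
  rw [← hv', ← hv] at key
  simp only [sub_apply]
  linarith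

end FD
end

noncomputable section
open MeasureTheory Set Filter RealInnerProductSpace Topology
namespace FD
variable {n : ℕ} {G : Evec n → Evec n → ℝ} {ℓ α : ℝ}

theorem pair_meas (x : EE n) : AEStronglyMeasurable (fun s => (ev x s, x.2 s)) μ1 :=
  (ev_continuous x).aestronglyMeasurable.prodMk (Lp.aestronglyMeasurable x.2)

theorem dq_meas (hG : IsFinslerEnergy n G ℓ α) (x : EE n) :
    AEStronglyMeasurable (fun s => dqCLM G (ev x s) (x.2 s)) μ1 :=
  (dq_cont hG).comp_aestronglyMeasurable (pair_meas x)

theorem dv_meas (hG : IsFinslerEnergy n G ℓ α) (x : EE n) :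
    AEStronglyMeasurable (fun s => dvCLM G (ev x s) (x.2 s)) μ1 :=
  (dv_cont hG).comp_aestronglyMeasurable (pair_meas x)

theorem int_G (hG : IsFinslerEnergy n G ℓ α) (x : EE n) :
    Integrable (fun s => G (ev x s) (x.2 s)) μ1 := by
  refine ((L2_int_sq x.2).const_mul ℓ).mono' (hG.continuous.comp_aestronglyMeasurable (pair_meas x)) ?_
  refine ae_of_all _ fun s => ?_
  rw [Real.norm_of_nonneg (G_nonneg hG _ _)]
  exact hG.upper _ _

theorem L2_mul_int (u w : L2 n) : Integrable (fun s => ‖u s‖ * ‖w s‖) μ1 :=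
  (holder (L2_memLp u).norm (L2_memLp w).norm).1

theorem L2_mul_le (u w : L2 n) : ∫ s, ‖u s‖ * ‖w s‖ ∂μ1 ≤ ‖u‖ * ‖w‖ :=
  holder_le (L2_memLp u).norm (L2_memLp w).norm (norm_nonneg _) (norm_nonneg _)
    (L2_norm_sq u).ge (L2_norm_sq w).ge

theorem dInt_meas (hG : IsFinslerEnergy n G ℓ α) (x ξ : EE n) :
    AEStronglyMeasurable (dInt G x ξ) μ1 :=
  (clm_meas (dq_meas hG x) (ev_continuous ξ).aestronglyMeasurable).add
    (clm_meas (dv_meas hG x) (Lp.aestronglyMeasurable ξ.2))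

theorem dInt_le (hG : IsFinslerEnergy n G ℓ α) (x ξ : EE n) (s : ℝ) :
    |dInt G x ξ s| ≤ ℓ * (2 * ‖ξ‖) * ‖x.2 s‖ ^ 2 + ℓ * (‖x.2 s‖ * ‖ξ.2 s‖) := by
  have hl := hG.one_le_ell
  unfold dInt
  refine (abs_add_le _ _).trans ?_
  gcongr
  · rw [← Real.norm_eq_abs]
    refine (ContinuousLinearMap.le_opNorm _ _).trans ?_
    calc _ ≤ (ℓ * ‖x.2 s‖ ^ 2) * (2 * ‖ξ‖) := by
          gcongr
          · exact dq_le hG _ _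
          · exact norm_ev_le _ _
      _ = _ := by ring
  · rw [← Real.norm_eq_abs]
    refine (ContinuousLinearMap.le_opNorm _ _).trans ?_
    calc _ ≤ (ℓ * ‖x.2 s‖) * ‖ξ.2 s‖ := by
          gcongr
          exact dv_le hG _ _
      _ = _ := by ring

theorem int_d (hG : IsFinslerEnergy n G ℓ α) (x ξ : EE n) : Integrable (dInt G x ξ) μ1 := by
  refine (((L2_int_sq x.2).const_mul (ℓ * (2 * ‖ξ‖))).add
    ((L2_mul_int x.2 ξ.2).const_mul ℓ)).mono' (dInt_meas hG x ξ) ?_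
  exact ae_of_all _ fun s => dInt_le hG x ξ s

theorem dJf_le (hG : IsFinslerEnergy n G ℓ α) (x ξ : EE n) :
    |dJf G x ξ| ≤ ℓ * (‖x.2‖ ^ 2 + ‖x.2‖) * ‖ξ‖ := by
  have hl := hG.one_le_ell
  have h1 : |∫ s, dInt G x ξ s ∂μ1| ≤
      ∫ s, (ℓ * (2 * ‖ξ‖) * ‖x.2 s‖ ^ 2 + ℓ * (‖x.2 s‖ * ‖ξ.2 s‖)) ∂μ1 := by
    refine (abs_integral_le_integral_abs).trans ?_
    exact integral_mono (int_d hG x ξ).abs (((L2_int_sq x.2).const_mul (ℓ * (2 * ‖ξ‖))).add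
      ((L2_mul_int x.2 ξ.2).const_mul ℓ)) fun s => dInt_le hG x ξ s
  rw [integral_add ((L2_int_sq x.2).const_mul (ℓ * (2 * ‖ξ‖)))
      ((L2_mul_int x.2 ξ.2).const_mul ℓ), integral_const_mul, integral_const_mul,
      ← L2_norm_sq] at h1
  have h2 := L2_mul_le x.2 ξ.2
  have h3 : ‖ξ.2‖ ≤ ‖ξ‖ := norm_snd_le ξ
  have h4 : ℓ * ∫ s, ‖x.2 s‖ * ‖ξ.2 s‖ ∂μ1 ≤ ℓ * (‖x.2‖ * ‖ξ‖) := by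
    gcongr
    exact h2.trans (by gcongr)
  unfold dJf
  rw [abs_mul, abs_of_pos (by norm_num : (0:ℝ) < 1 / 2)]
  have h5 : 0 ≤ ℓ * (‖x.2‖ * ‖ξ‖) := by positivity
  nlinarith

theorem snd_add (x y : EE n) : (fun s => (x + y).2 s) =ᵐ[μ1] fun s => x.2 s + y.2 s :=
  Lp.coeFn_add x.2 y.2

theorem snd_sub (x y : EE n) : (fun s => (x - y).2 s) =ᵐ[μ1] fun s => x.2 s - y.2 s :=
  Lp.coeFn_sub x.2 y.2

theorem snd_smul (a : ℝ) (y : EE n) : (fun s => (a • y).2 s) =ᵐ[μ1] fun s => a • y.2 s :=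
  Lp.coeFn_smul a y.2

theorem dJf_add (hG : IsFinslerEnergy n G ℓ α) (x ξ ζ : EE n) :
    dJf G x (ξ + ζ) = dJf G x ξ + dJf G x ζ := by
  unfold dJf
  rw [← mul_add, ← integral_add (int_d hG x ξ) (int_d hG x ζ)]
  congr 1
  apply integral_congr_ae
  filter_upwards [snd_add ξ ζ] with s hs
  simp only [dInt] at hs ⊢
  rw [hs, ev_add, map_add, map_add]; ring

theorem dJf_smul (x ξ : EE n) (a : ℝ) : dJf G x (a • ξ) = a * dJf G x ξ := by
  unfold dJf
  rw [mul_left_comm, ← integral_const_mul a]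
  congr 1
  apply integral_congr_ae
  filter_upwards [snd_smul a ξ] with s hs
  simp only [dInt] at hs ⊢
  rw [hs, ev_smul, map_smul, map_smul]; simp; ring

theorem dJf_neg (x ξ : EE n) : dJf G x (-ξ) = - dJf G x ξ := by
  have := dJf_smul (G := G) x ξ (-1)
  simpa using this

theorem dJf_sub (hG : IsFinslerEnergy n G ℓ α) (x ξ ζ : EE n) :
    dJf G x (ξ - ζ) = dJf G x ξ - dJf G x ζ := by
  rw [sub_eq_add_neg, dJf_add hG, dJf_neg, sub_eq_add_neg]

theorem Jf_nonneg (hG : IsFinslerEnergy n G ℓ α) (x : EE n) : 0 ≤ Jf G x :=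
  mul_nonneg (by norm_num) (integral_nonneg fun _ => G_nonneg hG _ _)

theorem Jf_lower (hG : IsFinslerEnergy n G ℓ α) (x : EE n) : ‖x.2‖ ^ 2 ≤ 2 * ℓ * Jf G x := by
  have hl := hG.one_le_ell
  rw [L2_norm_sq, Jf]
  have : ∫ s, ‖x.2 s‖ ^ 2 ∂μ1 ≤ ∫ s, ℓ * G (ev x s) (x.2 s) ∂μ1 := by
    refine integral_mono (L2_int_sq _) ((int_G hG x).const_mul ℓ) fun s => ?_
    have := hG.lower (ev x s) (x.2 s)
    rw [one_div, inv_mul_le_iff₀ (by linarith)] at this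
    exact this
  rw [integral_const_mul] at this
  linarith

theorem M_memLp (u w : L2 n) : MemLp (fun s => ‖u s‖ + ‖w s‖) 2 μ1 :=
  (L2_memLp u).norm.add (L2_memLp w).norm

theorem M_le {u w : L2 n} {S : ℝ} (hu : ‖u‖ ≤ S) (hw : ‖w‖ ≤ S) :
    ∫ s, (‖u s‖ + ‖w s‖) ^ 2 ∂μ1 ≤ (2 * S) ^ 2 := by
  have h : ∫ s, (‖u s‖ + ‖w s‖) ^ 2 ∂μ1 ≤ ∫ s, (2 * ‖u s‖ ^ 2 + 2 * ‖w s‖ ^ 2) ∂μ1 := by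
    refine integral_mono (M_memLp u w).integrable_sq
      (((L2_int_sq _).const_mul _).add ((L2_int_sq _).const_mul _)) fun s => ?_
    simp only
    nlinarith [sq_nonneg (‖u s‖ - ‖w s‖)]
  rw [integral_add ((L2_int_sq _).const_mul _) ((L2_int_sq _).const_mul _), integral_const_mul,
    integral_const_mul, ← L2_norm_sq, ← L2_norm_sq] at h
  nlinarith [norm_nonneg u, norm_nonneg w]

theorem dJf_unif0 (hG : IsFinslerEnergy n G ℓ α) {S : ℝ} (hS : 0 ≤ S) {ε : ℝ} (hε : 0 < ε) :
    ∃ C ≥ 0, ∀ x x' ξ : EE n, ‖x‖ ≤ S → ‖x'‖ ≤ S → |dJf G x' ξ - dJf G x ξ| ≤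
      (ε * (4 * S ^ 2 + S) + C * ‖x - x'‖) * ‖ξ‖ := by
  obtain ⟨C1, hC1, h1⟩ := dq_mod hG (2 * S) hε
  obtain ⟨C2, hC2, h2⟩ := dv_mod hG (2 * S) hε
  refine ⟨C1 * (8 * S ^ 2 + 2 * S) + C2 * (2 * S + 1), by positivity,
    fun x x' ξ hx hx' => ?_⟩
  set d := ‖x - x'‖ with hd
  have hd0 : 0 ≤ d := norm_nonneg _
  have hev : ∀ s, ‖ev x s‖ ≤ 2 * S := fun s => (norm_ev_le x s).trans (by linarith)
  have hev' : ∀ s, ‖ev x' s‖ ≤ 2 * S := fun s => (norm_ev_le x' s).trans (by linarith)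
  have hevd : ∀ s, ‖ev x s - ev x' s‖ ≤ 2 * d := fun s => by
    rw [← ev_sub]; exact norm_ev_le _ _
  set M : ℝ → ℝ := fun s => ‖x.2 s‖ + ‖x'.2 s‖ with hM
  set D : ℝ → ℝ := fun s => ‖(x - x').2 s‖ with hD
  have hMm : MemLp M 2 μ1 := M_memLp _ _
  have hDm : MemLp D 2 μ1 := (L2_memLp _).norm
  have hξm : MemLp (fun s => ‖ξ.2 s‖) 2 μ1 := (L2_memLp _).norm
  have hMi : ∫ s, M s ^ 2 ∂μ1 ≤ (2 * S) ^ 2 :=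
    M_le ((norm_snd_le x).trans hx) ((norm_snd_le x').trans hx')
  have hDi : ∫ s, D s ^ 2 ∂μ1 ≤ d ^ 2 := by
    rw [hD, ← L2_norm_sq]; gcongr; exact norm_snd_le (x - x')
  have hξi : ∫ s, ‖ξ.2 s‖ ^ 2 ∂μ1 ≤ ‖ξ‖ ^ 2 := by
    rw [← L2_norm_sq]; gcongr; exact norm_snd_le ξ
  have iM := hMm.integrable_sq
  have iDM := (holder hDm hMm).1
  have iMξ := (holder hMm hξm).1
  have iDξ := (holder hDm hξm).1
  have eDM : ∫ s, D s * M s ∂μ1 ≤ d * (2 * S) :=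
    holder_le hDm hMm hd0 (by positivity) hDi hMi
  have eMξ : ∫ s, M s * ‖ξ.2 s‖ ∂μ1 ≤ (2 * S) * ‖ξ‖ :=
    holder_le hMm hξm (by positivity) (norm_nonneg _) hMi hξi
  have eDξ : ∫ s, D s * ‖ξ.2 s‖ ∂μ1 ≤ d * ‖ξ‖ :=
    holder_le hDm hξm hd0 (norm_nonneg _) hDi hξi
  have hpt : ∀ᵐ s ∂μ1, |dInt G x' ξ s - dInt G x ξ s| ≤
      2 * ‖ξ‖ * (ε + 2 * C1 * d) * M s ^ 2 + 2 * ‖ξ‖ * C1 * (D s * M s) +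
      (ε + 2 * C2 * d) * (M s * ‖ξ.2 s‖) + C2 * (D s * ‖ξ.2 s‖) := by
    filter_upwards [snd_sub x x'] with s hs
    have e1 := h1 (ev x s) (ev x' s) (x.2 s) (x'.2 s) (hev s) (hev' s)
    have e2 := h2 (ev x s) (ev x' s) (x.2 s) (x'.2 s) (hev s) (hev' s)
    rw [← hs] at e1 e2
    change _ ≤ ε * M s ^ 2 + C1 * (_ * M s ^ 2 + D s * M s) at e1
    change _ ≤ ε * M s + C2 * (_ * M s + D s) at e2
    have hM0 : 0 ≤ M s := by positivity
    have hD0 : 0 ≤ D s := by positivity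
    have e1' : ‖dqCLM G (ev x' s) (x'.2 s) - dqCLM G (ev x s) (x.2 s)‖ ≤
        ε * M s ^ 2 + C1 * (2 * d * M s ^ 2 + D s * M s) := by
      refine e1.trans ?_; gcongr; exact hevd s
    have e2' : ‖dvCLM G (ev x' s) (x'.2 s) - dvCLM G (ev x s) (x.2 s)‖ ≤
        ε * M s + C2 * (2 * d * M s + D s) := by
      refine e2.trans ?_; gcongr; exact hevd s
    have e3 : dInt G x' ξ s - dInt G x ξ s =
        (dqCLM G (ev x' s) (x'.2 s) - dqCLM G (ev x s) (x.2 s)) (ev ξ s) +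
        (dvCLM G (ev x' s) (x'.2 s) - dvCLM G (ev x s) (x.2 s)) (ξ.2 s) := by
      simp only [dInt, sub_apply]; ring
    rw [e3]
    refine (abs_add_le _ _).trans ?_
    rw [← Real.norm_eq_abs, ← Real.norm_eq_abs]
    have e4 := (ContinuousLinearMap.le_opNorm
      (dqCLM G (ev x' s) (x'.2 s) - dqCLM G (ev x s) (x.2 s)) (ev ξ s)).trans
        (mul_le_mul e1' (norm_ev_le ξ s) (norm_nonneg _) (by positivity))
    have e5 := (ContinuousLinearMap.le_opNorm
      (dvCLM G (ev x' s) (x'.2 s) - dvCLM G (ev x s) (x.2 s)) (ξ.2 s)).trans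
        (mul_le_mul_of_nonneg_right e2' (norm_nonneg _))
    refine (add_le_add e4 e5).trans (le_of_eq ?_)
    ring
  have hbint : |∫ s, (dInt G x' ξ s - dInt G x ξ s) ∂μ1| ≤
      2 * ‖ξ‖ * (ε + 2 * C1 * d) * (∫ s, M s ^ 2 ∂μ1) + 2 * ‖ξ‖ * C1 * (∫ s, D s * M s ∂μ1) +
      (ε + 2 * C2 * d) * (∫ s, M s * ‖ξ.2 s‖ ∂μ1) + C2 * (∫ s, D s * ‖ξ.2 s‖ ∂μ1) := by
    refine abs_integral_le_integral_abs.trans ?_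
    refine (integral_mono_ae ((int_d hG x' ξ).sub (int_d hG x ξ)).abs
      ((((iM.const_mul _).add (iDM.const_mul _)).add (iMξ.const_mul _)).add (iDξ.const_mul _))
      hpt).trans (le_of_eq ?_)
    rw [integral_add' (((iM.const_mul _).add (iDM.const_mul _)).add (iMξ.const_mul _))
      (iDξ.const_mul _), integral_add' ((iM.const_mul _).add (iDM.const_mul _)) (iMξ.const_mul _),
      integral_add' (iM.const_mul _) (iDM.const_mul _), integral_const_mul, integral_const_mul,
      integral_const_mul, integral_const_mul]
  have hfin : |∫ s, (dInt G x' ξ s - dInt G x ξ s) ∂μ1| ≤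
      2 * ‖ξ‖ * (ε + 2 * C1 * d) * ((2 * S) ^ 2) + 2 * ‖ξ‖ * C1 * (d * (2 * S)) +
      (ε + 2 * C2 * d) * ((2 * S) * ‖ξ‖) + C2 * (d * ‖ξ‖) := by
    refine hbint.trans ?_
    gcongr
  rw [integral_sub (int_d hG x' ξ) (int_d hG x ξ)] at hfin
  unfold dJf
  rw [← mul_sub, abs_mul, abs_of_pos (by norm_num : (0:ℝ) < 1 / 2)]
  have h0 : 0 ≤ C2 * (d * ‖ξ‖) := by positivity
  nlinarith

theorem dJf_unif (hG : IsFinslerEnergy n G ℓ α) {S : ℝ} (hS : 0 ≤ S) {ε : ℝ} (hε : 0 < ε) :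
    ∃ δ > 0, ∀ x x' ξ : EE n, ‖x‖ ≤ S → ‖x'‖ ≤ S → ‖x - x'‖ ≤ δ →
      |dJf G x' ξ - dJf G x ξ| ≤ ε * ‖ξ‖ := by
  obtain ⟨C, hC, h⟩ := dJf_unif0 hG hS (ε := ε / (2 * (4 * S ^ 2 + S + 1))) (by positivity)
  refine ⟨ε / (2 * (C + 1)), by positivity, fun x x' ξ hx hx' hd => ?_⟩
  refine (h x x' ξ hx hx').trans ?_
  gcongr
  have h1 : ε / (2 * (4 * S ^ 2 + S + 1)) * (4 * S ^ 2 + S) ≤ ε / 2 := by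
    rw [div_mul_eq_mul_div, div_le_div_iff₀ (by positivity) (by positivity)]; nlinarith
  have h2 : C * ‖x - x'‖ ≤ ε / 2 := by
    calc C * ‖x - x'‖ ≤ (C + 1) * (ε / (2 * (C + 1))) := by gcongr; linarith
      _ = ε / 2 := by field_simp
  linarith

end FD
end

noncomputable section
open MeasureTheory Set Filter RealInnerProductSpace Topology
namespace FD
variable {n : ℕ} {G : Evec n → Evec n → ℝ} {ℓ α : ℝ}

theorem snd_line (x ξ : EE n) (r : ℝ) :
    (fun s => (x + r • ξ).2 s) =ᵐ[μ1] fun s => x.2 s + r • ξ.2 s := by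
  filter_upwards [snd_add x (r • ξ), snd_smul r ξ] with s h1 h2
  rw [h1, h2]

theorem Jf_hasDerivAt (hG : IsFinslerEnergy n G ℓ α) (x ξ : EE n) (r : ℝ) :
    HasDerivAt (fun r => Jf G (x + r • ξ)) (dJf G (x + r • ξ) ξ) r := by
  have hl := hG.one_le_ell
  have e1 : ∀ r : ℝ, Jf G (x + r • ξ) =
      (1 / 2) * ∫ s, G (ev x s + r • ev ξ s) (x.2 s + r • ξ.2 s) ∂μ1 := by
    intro r
    unfold Jf
    congr 1
    apply integral_congr_ae
    filter_upwards [snd_line x ξ r] with s hs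
    rw [hs, ev_add, ev_smul]
  have e2 : ∀ r : ℝ, dJf G (x + r • ξ) ξ = (1 / 2) *
      ∫ s, (dqCLM G (ev x s + r • ev ξ s) (x.2 s + r • ξ.2 s) (ev ξ s) +
        dvCLM G (ev x s + r • ev ξ s) (x.2 s + r • ξ.2 s) (ξ.2 s)) ∂μ1 := by
    intro r
    unfold dJf dInt
    congr 1
    apply integral_congr_ae
    filter_upwards [snd_line x ξ r] with s hs
    rw [hs, ev_add, ev_smul]
  simp_rw [e1, e2]
  apply HasDerivAt.const_mul
  have hm : ∀ r : ℝ, AEStronglyMeasurable (fun s => (ev x s + r • ev ξ s, x.2 s + r • ξ.2 s)) μ1 := by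
    intro r
    refine (pair_meas (x + r • ξ)).congr ?_
    filter_upwards [snd_line x ξ r] with s hs
    rw [hs, ev_add, ev_smul]
  set R := |r| + 1 with hR
  have hR0 : 0 ≤ R := by positivity
  have hMm : MemLp (fun s => ‖x.2 s‖ + R * ‖ξ.2 s‖) 2 μ1 :=
    (L2_memLp x.2).norm.add ((L2_memLp ξ.2).norm.const_mul R)
  refine (hasDerivAt_integral_of_dominated_loc_of_deriv_le
    (F := fun (r : ℝ) (s : ℝ) => G (ev x s + r • ev ξ s) (x.2 s + r • ξ.2 s))
    (F' := fun (r : ℝ) (s : ℝ) => dqCLM G (ev x s + r • ev ξ s) (x.2 s + r • ξ.2 s) (ev ξ s) +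
        dvCLM G (ev x s + r • ev ξ s) (x.2 s + r • ξ.2 s) (ξ.2 s))
    (bound := fun s => ℓ * (2 * ‖ξ‖) * (‖x.2 s‖ + R * ‖ξ.2 s‖) ^ 2 +
      ℓ * ((‖x.2 s‖ + R * ‖ξ.2 s‖) * ‖ξ.2 s‖))
    (s := Metric.ball r 1) (Metric.ball_mem_nhds r one_pos) ?_ ?_ ?_ ?_ ?_ ?_).2
  · exact Eventually.of_forall fun r => hG.continuous.comp_aestronglyMeasurable (hm r)
  · refine (int_G hG (x + r • ξ)).congr ?_
    filter_upwards [snd_line x ξ r] with s hs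
    rw [hs, ev_add, ev_smul]
  · exact (clm_meas ((dq_cont hG).comp_aestronglyMeasurable (hm r))
      (ev_continuous ξ).aestronglyMeasurable).add
      (clm_meas ((dv_cont hG).comp_aestronglyMeasurable (hm r)) (Lp.aestronglyMeasurable ξ.2))
  · refine ae_of_all _ fun s r' hr' => ?_
    have h1 : |r'| ≤ R := by
      rw [mem_ball_iff_norm, Real.norm_eq_abs] at hr'
      have := abs_sub_abs_le_abs_sub r' r
      linarith
    have h2 : ‖x.2 s + r' • ξ.2 s‖ ≤ ‖x.2 s‖ + R * ‖ξ.2 s‖ := by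
      refine (norm_add_le _ _).trans ?_
      rw [norm_smul, Real.norm_eq_abs]; gcongr
    refine (norm_add_le _ _).trans ?_
    gcongr
    · refine (ContinuousLinearMap.le_opNorm _ _).trans ?_
      calc _ ≤ (ℓ * ‖x.2 s + r' • ξ.2 s‖ ^ 2) * (2 * ‖ξ‖) := by
            gcongr
            · exact dq_le hG _ _
            · exact norm_ev_le _ _
        _ = ℓ * (2 * ‖ξ‖) * ‖x.2 s + r' • ξ.2 s‖ ^ 2 := by ring
        _ ≤ _ := by gcongr
    · refine (ContinuousLinearMap.le_opNorm _ _).trans ?_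
      calc _ ≤ (ℓ * ‖x.2 s + r' • ξ.2 s‖) * ‖ξ.2 s‖ := by
            gcongr
            exact dv_le hG _ _
        _ = ℓ * (‖x.2 s + r' • ξ.2 s‖ * ‖ξ.2 s‖) := by ring
        _ ≤ _ := by gcongr
  · exact (hMm.integrable_sq.const_mul _).add ((holder hMm (L2_memLp ξ.2).norm).1.const_mul _)
  · refine ae_of_all _ fun s r' _ => ?_
    have h1 : HasDerivAt (fun r : ℝ => (ev x s + r • ev ξ s, x.2 s + r • ξ.2 s))
        (ev ξ s, ξ.2 s) r' := by
      have a1 : HasDerivAt (fun r : ℝ => ev x s + r • ev ξ s) (ev ξ s) r' := by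
        simpa using ((hasDerivAt_id r').smul_const (ev ξ s)).const_add (ev x s)
      have a2 : HasDerivAt (fun r : ℝ => x.2 s + r • ξ.2 s) (ξ.2 s) r' := by
        simpa using ((hasDerivAt_id r').smul_const (ξ.2 s)).const_add (x.2 s)
      exact a1.prodMk a2
    have h2 := (Gh_diff hG (ev x s + r' • ev ξ s, x.2 s + r' • ξ.2 s)).hasFDerivAt.comp_hasDerivAt r' h1
    rw [fderiv_Gh hG] at h2
    exact h2

/-- Mean value theorem along segments. -/
theorem Jf_mvt (hG : IsFinslerEnergy n G ℓ α) (x ξ : EE n) {t : ℝ} (ht : 0 < t) :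
    ∃ r ∈ Ioo 0 t, Jf G (x + t • ξ) - Jf G x = t * dJf G (x + r • ξ) ξ := by
  have hd := Jf_hasDerivAt hG x ξ
  obtain ⟨r, hr, h⟩ := exists_hasDerivAt_eq_slope (fun r => Jf G (x + r • ξ))
    (fun r => dJf G (x + r • ξ) ξ) ht
    (fun r _ => (hd r).continuousAt.continuousWithinAt) (fun r _ => hd r)
  refine ⟨r, hr, ?_⟩
  rw [h]
  simp only [zero_smul, add_zero, sub_zero]
  field_simp

theorem Jf_lip (hG : IsFinslerEnergy n G ℓ α) {S : ℝ} (x x' : EE n) (hx : ‖x‖ ≤ S)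
    (hx' : ‖x'‖ ≤ S) : |Jf G x' - Jf G x| ≤ ℓ * (S ^ 2 + S) * ‖x' - x‖ := by
  have hl := hG.one_le_ell
  obtain ⟨r, hr, h⟩ := Jf_mvt hG x (x' - x) one_pos
  rw [one_smul, add_sub_cancel, one_mul] at h
  rw [h]
  refine (dJf_le hG _ _).trans ?_
  have h1 : ‖x + r • (x' - x)‖ ≤ S := by
    have : x + r • (x' - x) = (1 - r) • x + r • x' := by module
    rw [this]
    refine (norm_add_le _ _).trans ?_
    rw [norm_smul, norm_smul, Real.norm_of_nonneg hr.1.le, Real.norm_of_nonneg (by linarith [hr.2])]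
    nlinarith [hr.1, hr.2]
  have h2 : ‖(x + r • (x' - x)).2‖ ≤ S := (norm_snd_le _).trans h1
  gcongr

theorem Jf_cont (hG : IsFinslerEnergy n G ℓ α) : Continuous (Jf G : EE n → ℝ) := by
  rw [continuous_iff_continuousAt]
  intro x
  have h1 : ∀ᶠ y in 𝓝 x, ‖Jf G y - Jf G x‖ ≤ ℓ * ((‖x‖ + 1) ^ 2 + (‖x‖ + 1)) * ‖y - x‖ := by
    filter_upwards [Metric.ball_mem_nhds x one_pos] with y hy
    rw [mem_ball_iff_norm] at hy
    refine Jf_lip hG x y (by linarith) ?_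
    have := norm_le_norm_add_norm_sub' y x
    linarith
  rw [ContinuousAt, tendsto_iff_norm_sub_tendsto_zero]
  refine squeeze_zero' (Eventually.of_forall fun _ => norm_nonneg _) h1 ?_
  have : Continuous fun y : EE n => ℓ * ((‖x‖ + 1) ^ 2 + (‖x‖ + 1)) * ‖y - x‖ := by fun_prop
  simpa using this.tendsto x

/-- Uniform descent estimate. -/
theorem Jf_descent (hG : IsFinslerEnergy n G ℓ α) {S : ℝ} (hS : 0 ≤ S) {L : ℝ} (hL : 0 < L) {ε : ℝ}
    (hε : 0 < ε) : ∃ σ > 0, ∀ (x ξ : EE n) (t : ℝ), ‖x‖ ≤ S → ‖ξ‖ ≤ L → 0 ≤ t → t ≤ σ →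
      Jf G (x + t • ξ) ≤ Jf G x + t * dJf G x ξ + t * ε := by
  obtain ⟨δ, hδ, h⟩ := dJf_unif hG (S := S + 1) (by positivity) (ε := ε / L) (by positivity)
  refine ⟨min 1 δ / L, by positivity, fun x ξ t hx hξ ht0 ht => ?_⟩
  rcases ht0.eq_or_lt with h0 | h0
  · rw [← h0]; simp
  obtain ⟨r, hr, h1⟩ := Jf_mvt hG x ξ h0
  have hrξ : ‖r • ξ‖ ≤ min 1 δ := by
    rw [norm_smul, Real.norm_of_nonneg hr.1.le]
    calc r * ‖ξ‖ ≤ (min 1 δ / L) * L := by gcongr; exact hr.2.le.trans ht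
      _ = _ := by field_simp
  have h2 := h x (x + r • ξ) ξ (by linarith) ((norm_add_le _ _).trans
    (by have := hrξ.trans (min_le_left _ _); linarith)) (by
      rw [sub_add_cancel_left, norm_neg]; exact hrξ.trans (min_le_right _ _))
  have h3 : ε / L * ‖ξ‖ ≤ ε := by
    calc ε / L * ‖ξ‖ ≤ ε / L * L := by gcongr
      _ = ε := by field_simp
  have h4 := (abs_le.1 h2).2
  nlinarith

/-- Strong monotonicity of the first variation, up to errors controlled by the uniform distance. -/
theorem dJf_mono (hG : IsFinslerEnergy n G ℓ α) {S : ℝ} (hS : 0 ≤ S) {η : ℝ} (hη : 0 < η) :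
    ∃ ρ > 0, ∀ x x' : EE n, ‖x‖ ≤ S → ‖x'‖ ≤ S →
      (∀ s ∈ Icc (0:ℝ) 1, ‖ev x' s - ev x s‖ ≤ ρ) →
      α * ‖x'.2 - x.2‖ ^ 2 ≤ 2 * (dJf G x' (x' - x) - dJf G x (x' - x)) + η := by
  have hl := hG.one_le_ell
  set ε := η / (16 * (S ^ 2 + 1)) with hεd
  have hε : 0 < ε := by positivity
  obtain ⟨C, hC, h2⟩ := dv_mod hG (2 * S) hε
  set ρ := η / (8 * (S ^ 2 + 1) * (ℓ + 2 * C)) with hρ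
  have hρ0 : 0 < ρ := by positivity
  refine ⟨ρ, hρ0, fun x x' hx hx' hd => ?_⟩
  have hev : ∀ s, ‖ev x s‖ ≤ 2 * S := fun s => (norm_ev_le x s).trans (by linarith)
  have hev' : ∀ s, ‖ev x' s‖ ≤ 2 * S := fun s => (norm_ev_le x' s).trans (by linarith)
  have hpt : ∀ᵐ s ∂μ1, α * ‖(x' - x).2 s‖ ^ 2 ≤ dInt G x' (x' - x) s - dInt G x (x' - x) s +
      (ℓ * ρ + 2 * ε + 2 * C * ρ) * (‖x.2 s‖ + ‖x'.2 s‖) ^ 2 := by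
    filter_upwards [snd_sub x' x, ae_restrict_mem measurableSet_Ioc] with s hs hsI
    have hds := hd s ⟨hsI.1.le, hsI.2⟩
    simp only [dInt]
    rw [hs, ev_sub]
    set q := ev x s
    set q' := ev x' s
    set v := x.2 s
    set v' := x'.2 s
    have m1 := dv_mono hG q' v v'
    have m2 := h2 q q' v v (hev s) (hev' s)
    have m3 : |(dvCLM G q' v - dvCLM G q v) (v' - v)| ≤
        (ε * (‖v‖ + ‖v‖) + C * (ρ * (‖v‖ + ‖v‖))) * (‖v‖ + ‖v'‖) := by
      rw [← Real.norm_eq_abs]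
      refine (ContinuousLinearMap.le_opNorm _ _).trans ?_
      gcongr
      · refine m2.trans ?_
        rw [sub_self, norm_zero, add_zero, norm_sub_rev]
        gcongr
      · rw [add_comm]; exact norm_sub_le _ _
    have m4 : |(dqCLM G q' v' - dqCLM G q v) (q' - q)| ≤ (ℓ * (‖v‖ + ‖v'‖) ^ 2) * ρ := by
      rw [← Real.norm_eq_abs]
      refine (ContinuousLinearMap.le_opNorm _ _).trans ?_
      gcongr
      refine (norm_sub_le _ _).trans ?_
      nlinarith [dq_le hG q v, dq_le hG q' v', mul_nonneg (norm_nonneg v) (norm_nonneg v')]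
    have m5 : (ε * (‖v‖ + ‖v‖) + C * (ρ * (‖v‖ + ‖v‖))) * (‖v‖ + ‖v'‖) ≤
        (2 * ε + 2 * C * ρ) * (‖v‖ + ‖v'‖) ^ 2 := by
      calc _ = (2 * ε + 2 * C * ρ) * (‖v‖ * (‖v‖ + ‖v'‖)) := by ring
        _ ≤ (2 * ε + 2 * C * ρ) * ((‖v‖ + ‖v'‖) * (‖v‖ + ‖v'‖)) := by
          gcongr; linarith [norm_nonneg v']
        _ = _ := by ring
    simp only [sub_apply] at m1 m3 m4
    have := (abs_le.1 m3).1
    have := (abs_le.1 m4).1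
    linarith
  have iM := (M_memLp x.2 x'.2).integrable_sq
  have hbint := integral_mono_ae ((L2_int_sq (x' - x).2).const_mul α)
    (((int_d hG x' (x' - x)).sub (int_d hG x (x' - x))).add (iM.const_mul _)) hpt
  rw [integral_add' ((int_d hG x' (x' - x)).sub (int_d hG x (x' - x))) (iM.const_mul _),
    integral_sub' (int_d hG x' (x' - x)) (int_d hG x (x' - x)), integral_const_mul,
    integral_const_mul, ← L2_norm_sq] at hbint
  have hM := M_le ((norm_snd_le x).trans hx) ((norm_snd_le x').trans hx')
  have e1 : (ℓ * ρ + 2 * ε + 2 * C * ρ) * (∫ s, (‖x.2 s‖ + ‖x'.2 s‖) ^ 2 ∂μ1) ≤ η := by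
    calc _ ≤ (ℓ * ρ + 2 * ε + 2 * C * ρ) * (4 * (S ^ 2 + 1)) := by
          gcongr; refine hM.trans ?_; nlinarith
      _ = η := by
          rw [hεd, hρ]; field_simp; ring
  have e2 : ∀ y, (1/2) * ∫ s, dInt G y (x' - x) s ∂μ1 = dJf G y (x' - x) := fun _ => rfl
  have e3 := e2 x
  have e4 := e2 x'
  have e5 : (x' - x).2 = x'.2 - x.2 := rfl
  rw [← e5]
  linarith

end FD
end

noncomputable section
open MeasureTheory Set Filter RealInnerProductSpace Topology
namespace FD
variable {n : ℕ} {Φ : Evec n → ℝ} {δ₀ : ℝ}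

theorem inner_grad (q w : Evec n) : ⟪gradient Φ q, w⟫ = fderiv ℝ Φ q w := by
  unfold gradient
  exact InnerProductSpace.toDual_symm_apply

theorem grad_contDiff (hΦ : IsRegularDomain n Φ δ₀) : ContDiff ℝ 1 (gradient Φ) := by
  have h1 : ContDiff ℝ 1 (fderiv ℝ Φ) := hΦ.smooth.fderiv_right (by norm_num)
  exact (InnerProductSpace.toDual ℝ (Evec n)).symm.contDiff.comp h1

theorem grad_cont (hΦ : IsRegularDomain n Φ δ₀) : Continuous (gradient Φ) :=
  (grad_contDiff hΦ).continuous

theorem Phi_diff (hΦ : IsRegularDomain n Φ δ₀) : Differentiable ℝ Φ :=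
  hΦ.smooth.differentiable two_ne_zero

theorem Phi_cont (hΦ : IsRegularDomain n Φ δ₀) : Continuous Φ := hΦ.smooth.continuous

theorem K_compact (hΦ : IsRegularDomain n Φ δ₀) : IsCompact {q | Φ q ≤ 0} :=
  hΦ.sublevel_compact 0 ⟨le_rfl, hΦ.delta0_pos.le⟩

theorem K_bdd (hΦ : IsRegularDomain n Φ δ₀) : ∃ B > 0, ∀ q, Φ q ≤ 0 → ‖q‖ ≤ B := by
  obtain ⟨B, h⟩ := (K_compact hΦ).isBounded.exists_norm_le
  exact ⟨max B 1, by positivity, fun q hq => (h q hq).trans (le_max_left _ _)⟩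

theorem grad_bdd (hΦ : IsRegularDomain n Φ δ₀) : ∃ B > 0, ∀ q, Φ q ≤ 0 → ‖gradient Φ q‖ ≤ B := by
  obtain ⟨B, h⟩ := (K_compact hΦ).exists_bound_of_continuousOn (grad_cont hΦ).continuousOn
  exact ⟨max B 1, by positivity, fun q hq => (h q hq).trans (le_max_left _ _)⟩

theorem grad_lower (hΦ : IsRegularDomain n Φ δ₀) :
    ∃ g > 0, ∀ q, Φ q ≤ 0 → -δ₀ ≤ Φ q → g ≤ ‖gradient Φ q‖ := by
  have hc : IsCompact ({q | Φ q ≤ 0} ∩ {q | -δ₀ ≤ Φ q}) :=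
    (K_compact hΦ).inter_right (isClosed_le continuous_const (Phi_cont hΦ))
  obtain ⟨g, hg, h⟩ := hc.exists_forall_le' (f := fun q => ‖gradient Φ q‖) (a := 0)
    (grad_cont hΦ).norm.continuousOn (fun q hq => norm_pos_iff.2 (hΦ.grad_ne_zero q (by
      rw [abs_le]; exact ⟨hq.2, le_trans hq.1 hΦ.delta0_pos.le⟩)))
  exact ⟨g, hg, fun q h1 h2 => h q ⟨h1, h2⟩⟩

theorem grad_unif (hΦ : IsRegularDomain n Φ δ₀) {η : ℝ} (hη : 0 < η) :
    ∃ δ > 0, ∀ p w, Φ p ≤ 0 → ‖w‖ ≤ δ → ‖gradient Φ (p + w) - gradient Φ p‖ ≤ η := by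
  obtain ⟨B, hB, hb⟩ := K_bdd hΦ
  have huc := (isCompact_closedBall (0 : Evec n) (B + 1)).uniformContinuousOn_of_continuous
    (grad_cont hΦ).continuousOn
  rw [Metric.uniformContinuousOn_iff] at huc
  obtain ⟨δ, hδ, h⟩ := huc η hη
  refine ⟨min (δ / 2) 1, by positivity, fun p w hp hw => ?_⟩
  have hp' := hb p hp
  have hw1 : ‖w‖ ≤ 1 := hw.trans (min_le_right _ _)
  have hw2 : ‖w‖ < δ := lt_of_le_of_lt (hw.trans (min_le_left _ _)) (by linarith)
  have := h (p + w) (by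
    rw [mem_closedBall_zero_iff]; exact (norm_add_le _ _).trans (by linarith)) p (by
    rw [mem_closedBall_zero_iff]; linarith) (by rw [dist_eq_norm]; simpa using hw2)
  rw [dist_eq_norm] at this
  exact this.le

theorem taylor (hΦ : IsRegularDomain n Φ δ₀) {η : ℝ} (hη : 0 < η) :
    ∃ δ > 0, ∀ p w, Φ p ≤ 0 → ‖w‖ ≤ δ →
      |Φ (p + w) - Φ p - ⟪gradient Φ p, w⟫| ≤ η * ‖w‖ := by
  obtain ⟨δ, hδ, h⟩ := grad_unif hΦ hη
  refine ⟨δ, hδ, fun p w hp hw => ?_⟩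
  have key := (convex_closedBall p δ).norm_image_sub_le_of_norm_fderiv_le' (f := Φ) (C := η)
    (φ := fderiv ℝ Φ p) (x := p) (y := p + w) (fun y _ => (Phi_diff hΦ) y) (fun y hy => ?_)
    (Metric.mem_closedBall_self hδ.le) (by simpa [dist_eq_norm] using hw)
  · rw [inner_grad, ← Real.norm_eq_abs]
    simpa using key
  · have h1 := h p (y - p) hp (by simpa [dist_eq_norm] using hy)
    rw [add_sub_cancel] at h1
    refine le_trans (le_of_eq ?_) h1
    unfold gradient
    rw [← map_sub, LinearIsometryEquiv.norm_map]

/-- The transversal field. -/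
def Nf (Φ : Evec n → ℝ) (q : Evec n) : Evec n :=
  (‖gradient Φ q‖ ^ 2 + Φ q ^ 2)⁻¹ • gradient Φ q

theorem den_pos (hΦ : IsRegularDomain n Φ δ₀) (q : Evec n) :
    0 < ‖gradient Φ q‖ ^ 2 + Φ q ^ 2 := by
  by_cases h : |Φ q| ≤ δ₀
  · have := norm_pos_iff.2 (hΦ.grad_ne_zero q h)
    positivity
  · have : Φ q ≠ 0 := fun h0 => h (by rw [h0]; simpa using hΦ.delta0_pos.le)
    positivity

theorem Nf_contDiff (hΦ : IsRegularDomain n Φ δ₀) : ContDiff ℝ 1 (Nf Φ) := by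
  have h1 := grad_contDiff hΦ
  have h2 : ContDiff ℝ 1 Φ := hΦ.smooth.of_le (by norm_num)
  exact ((h1.norm_sq ℝ).add (h2.pow 2)).inv (fun q => (den_pos hΦ q).ne') |>.smul h1

theorem inner_Nf_bdry (hΦ : IsRegularDomain n Φ δ₀) {q : Evec n} (h : Φ q = 0) :
    ⟪gradient Φ q, Nf Φ q⟫ = 1 := by
  have := den_pos hΦ q
  unfold Nf
  rw [inner_smul_right, real_inner_self_eq_norm_sq]
  rw [h] at this ⊢
  simp at this
  field_simp
  simp [h]

theorem inner_Nf_near (hΦ : IsRegularDomain n Φ δ₀) {η : ℝ} (hη : 0 < η) :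
    ∃ m > 0, ∀ q, Φ q ≤ 0 → -m ≤ Φ q → |⟪gradient Φ q, Nf Φ q⟫ - 1| ≤ η := by
  have hcont : Continuous fun q => ‖gradient Φ q‖ ^ 2 + Φ q ^ 2 :=
    ((grad_cont hΦ).norm.pow 2).add ((Phi_cont hΦ).pow 2)
  obtain ⟨g, hg, h⟩ := (K_compact hΦ).exists_forall_le' (a := 0) hcont.continuousOn
    (fun q _ => den_pos hΦ q)
  refine ⟨min 1 (η * g), by positivity, fun q h1 h2 => ?_⟩
  have hd := den_pos hΦ q
  have e : ⟪gradient Φ q, Nf Φ q⟫ - 1 = - (Φ q ^ 2 / (‖gradient Φ q‖ ^ 2 + Φ q ^ 2)) := by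
    unfold Nf
    rw [inner_smul_right, real_inner_self_eq_norm_sq]
    field_simp
    ring
  rw [e, abs_neg, abs_of_nonneg (by positivity), div_le_iff₀ hd]
  have h3 : -1 ≤ Φ q := by linarith [min_le_left 1 (η * g)]
  have h4 : -(η * g) ≤ Φ q := by linarith [min_le_right 1 (η * g)]
  have h5 : η * g ≤ η * (‖gradient Φ q‖ ^ 2 + Φ q ^ 2) := by gcongr; exact h q h1
  nlinarith

/-- Projection to the boundary along the gradient. -/
theorem bdry_proj (hΦ : IsRegularDomain n Φ δ₀) :
    ∃ κ > 0, ∃ C > 0, ∃ e : Evec n → Evec n, ContinuousOn e {p | Φ p ≤ 0 ∧ -κ ≤ Φ p} ∧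
      ∀ p, Φ p ≤ 0 → -κ ≤ Φ p → Φ (p + e p) = 0 ∧ ‖e p‖ ≤ C * |Φ p| ∧
        ∀ r ∈ Icc (0:ℝ) 1, Φ (p + r • e p) ≤ 0 := by
  obtain ⟨g, hg, hgl⟩ := grad_lower hΦ
  obtain ⟨B, hB, hb⟩ := grad_bdd hΦ
  obtain ⟨δ, hδ, hu⟩ := grad_unif hΦ (η := g / 2) (by positivity)
  set Λ := δ / B with hΛ
  have hΛ0 : 0 < Λ := by positivity
  set b := g ^ 2 / 2 with hbdef
  have hb0 : 0 < b := by positivity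
  set κ := min δ₀ (Λ * b) with hκ
  have hδ0 := hΦ.delta0_pos
  have hκ0 : 0 < κ := by positivity
  have hmono : ∀ p, Φ p ≤ 0 → -κ ≤ Φ p → ∀ a ∈ Icc 0 Λ, ∀ a' ∈ Icc 0 Λ, a ≤ a' →
      b * (a' - a) ≤ Φ (p + a' • gradient Φ p) - Φ (p + a • gradient Φ p) := by
    intro p hp hp' a ha a' ha' haa
    have hder : ∀ r : ℝ, HasDerivAt (fun r : ℝ => Φ (p + r • gradient Φ p))
        (⟪gradient Φ (p + r • gradient Φ p), gradient Φ p⟫) r := by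
      intro r
      have h6 : HasDerivAt (fun t : ℝ => p + t • gradient Φ p) (gradient Φ p) r := by
        simpa using ((hasDerivAt_id r).smul_const (gradient Φ p)).const_add p
      rw [inner_grad]
      exact (Phi_diff hΦ _).hasFDerivAt.comp_hasDerivAt r h6
    refine (convex_Icc 0 Λ).mul_sub_le_image_sub_of_le_deriv
      (f := fun r : ℝ => Φ (p + r • gradient Φ p))
      (fun r _ => (hder r).continuousAt.continuousWithinAt)
      (fun r _ => (hder r).differentiableAt.differentiableWithinAt) ?_ a ha a' ha' haa
    rw [interior_Icc]
    intro r hr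
    rw [(hder r).deriv]
    have hgp := hgl p hp (by linarith [min_le_left δ₀ (Λ * b)])
    have h1 : ‖r • gradient Φ p‖ ≤ δ := by
      rw [norm_smul, Real.norm_of_nonneg hr.1.le]
      calc r * ‖gradient Φ p‖ ≤ Λ * B := by
            gcongr
            · exact hr.2.le
            · exact hb p hp
        _ = δ := by rw [hΛ]; field_simp
    have h2 := hu p _ hp h1
    have h3 : ⟪gradient Φ (p + r • gradient Φ p), gradient Φ p⟫ =
        ‖gradient Φ p‖ ^ 2 + ⟪gradient Φ (p + r • gradient Φ p) - gradient Φ p, gradient Φ p⟫ := by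
      rw [inner_sub_left, real_inner_self_eq_norm_sq]; ring
    have h4 := (abs_le.1 (abs_real_inner_le_norm
      (gradient Φ (p + r • gradient Φ p) - gradient Φ p) (gradient Φ p))).1
    rw [h3]
    have h5 : ‖gradient Φ (p + r • gradient Φ p) - gradient Φ p‖ * ‖gradient Φ p‖ ≤
      g / 2 * ‖gradient Φ p‖ := by gcongr
    nlinarith
  have hex : ∀ p, ∃ a : ℝ, Φ p ≤ 0 → -κ ≤ Φ p → a ∈ Icc 0 Λ ∧ Φ (p + a • gradient Φ p) = 0 := by
    intro p
    by_cases hp : Φ p ≤ 0 ∧ -κ ≤ Φ p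
    · have hc : ContinuousOn (fun a : ℝ => Φ (p + a • gradient Φ p)) (Icc 0 Λ) := by
        have := Phi_cont hΦ
        exact (this.comp (by fun_prop)).continuousOn
      have h1 := hmono p hp.1 hp.2 0 (by simp [hΛ0.le]) Λ (by simp [hΛ0.le]) hΛ0.le
      simp only [zero_smul, add_zero, sub_zero] at h1
      have h0 : (0:ℝ) ∈ Icc (Φ (p + (0:ℝ) • gradient Φ p)) (Φ (p + Λ • gradient Φ p)) := by
        refine ⟨by simpa using hp.1, ?_⟩
        have := min_le_right δ₀ (Λ * b)
        linarith [hp.2]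
      obtain ⟨a, ha, h⟩ := intermediate_value_Icc hΛ0.le hc h0
      exact ⟨a, fun _ _ => ⟨ha, h⟩⟩
    · exact ⟨0, fun h1 h2 => absurd ⟨h1, h2⟩ hp⟩
  choose lam hlam using hex
  have hlip : ∀ p, Φ p ≤ 0 → -κ ≤ Φ p → ∀ a ∈ Icc 0 Λ, ∀ a' ∈ Icc 0 Λ,
      b * |a' - a| ≤ |Φ (p + a' • gradient Φ p) - Φ (p + a • gradient Φ p)| := by
    intro p hp hp' a ha a' ha'
    rcases le_total a a' with h | h
    · rw [abs_of_nonneg (by linarith)]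
      exact (hmono p hp hp' a ha a' ha' h).trans (le_abs_self _)
    · rw [abs_sub_comm, abs_of_nonneg (by linarith), abs_sub_comm]
      exact (hmono p hp hp' a' ha' a ha h).trans (le_abs_self _)
  have hlc : ContinuousOn lam {p | Φ p ≤ 0 ∧ -κ ≤ Φ p} := by
    intro p hp
    rw [ContinuousWithinAt, tendsto_iff_norm_sub_tendsto_zero]
    refine squeeze_zero' (g := fun p' => |Φ (p' + lam p • gradient Φ p')| / b)
      (Eventually.of_forall fun _ => norm_nonneg _) ?_ ?_
    · filter_upwards [self_mem_nhdsWithin] with p' hp'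
      have h1 := hlam p hp.1 hp.2
      have h2 := hlam p' hp'.1 hp'.2
      have h3 := hlip p' hp'.1 hp'.2 _ h1.1 _ h2.1
      rw [h2.2, zero_sub, abs_neg] at h3
      rw [le_div_iff₀ hb0, Real.norm_eq_abs]; linarith
    · have hc : Continuous fun p' => |Φ (p' + lam p • gradient Φ p')| / b := by
        have h1 := Phi_cont hΦ
        have h2 := grad_cont hΦ
        exact ((h1.comp (by fun_prop)).abs).div_const b
      have := hc.tendsto p
      rw [(hlam p hp.1 hp.2).2] at this
      simpa using this.mono_left nhdsWithin_le_nhds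
  refine ⟨κ, hκ0, B / b, by positivity, fun p => lam p • gradient Φ p,
    hlc.smul (grad_cont hΦ).continuousOn, fun p hp hp' => ?_⟩
  obtain ⟨h1, h2⟩ := hlam p hp hp'
  refine ⟨h2, ?_, fun r hr => ?_⟩
  · have h3 := hlip p hp hp' 0 (by simp [hΛ0.le]) _ h1
    rw [h2] at h3
    simp only [zero_smul, add_zero, sub_zero, zero_sub, abs_neg] at h3
    rw [norm_smul, Real.norm_eq_abs]
    calc |lam p| * ‖gradient Φ p‖ ≤ (|Φ p| / b) * B := by
          gcongr
          · rw [le_div_iff₀ hb0]; linarith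
          · exact hb p hp
      _ = _ := by ring
  · have h4 : r * lam p ∈ Icc 0 Λ :=
      ⟨mul_nonneg hr.1 h1.1, (mul_le_of_le_one_left h1.1 hr.2).trans h1.2⟩
    have h5 := hmono p hp hp' (r * lam p) h4 (lam p) h1 (mul_le_of_le_one_left h1.1 hr.2)
    rw [h2] at h5
    rw [smul_smul]
    have : 0 ≤ b * (lam p - r * lam p) :=
      mul_nonneg hb0.le (by linarith [mul_le_of_le_one_left h1.1 hr.2])
    linarith

end FD
end

noncomputable section
open MeasureTheory Set Filter RealInnerProductSpace Topology
namespace FD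
variable {n : ℕ} {G : Evec n → Evec n → ℝ} {ℓ α : ℝ} {Φ : Evec n → ℝ} {δ₀ : ℝ}

theorem diag_small {F : Type*} [NormedAddCommGroup F] (hΦ : IsRegularDomain n Φ δ₀)
    {f : Evec n × Evec n → F} (hf : Continuous f) (h0 : ∀ p, f (p, p) = 0) {η : ℝ} (hη : 0 < η) :
    ∃ ρ > 0, ∀ p q, Φ p ≤ 0 → Φ q ≤ 0 → ‖q - p‖ ≤ ρ → ‖f (p, q)‖ ≤ η := by
  have huc := ((K_compact hΦ).prod (K_compact hΦ)).uniformContinuousOn_of_continuous hf.continuousOn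
  rw [Metric.uniformContinuousOn_iff] at huc
  obtain ⟨ρ, hρ, h⟩ := huc η hη
  refine ⟨ρ / 2, by positivity, fun p q hp hq hpq => ?_⟩
  have := h (p, q) ⟨hp, hq⟩ (p, p) ⟨hp, hp⟩ (by
    rw [dist_eq_norm, Prod.norm_def]; simp; linarith)
  rw [h0, dist_zero_right] at this
  exact this.le

theorem comp_small {f : Evec n × Evec n → Evec n} {x y z : EE n} {η S : ℝ}
    (hx : ‖x‖ ≤ S) (hy : ‖y‖ ≤ S) (hη : 0 ≤ η)
    (hz1 : z.1 = f (x.1, y.1))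
    (hz2 : z.2 =ᵐ[μ1] fun s => fderiv ℝ f (ev x s, ev y s) (x.2 s, y.2 s))
    (hf : ∀ s ∈ Icc (0:ℝ) 1, ‖f (ev x s, ev y s)‖ ≤ η)
    (hf' : ∀ s ∈ Icc (0:ℝ) 1, ‖fderiv ℝ f (ev x s, ev y s)‖ ≤ η) :
    ‖z‖ ≤ η * (2 * S + 1) := by
  have hS : 0 ≤ S := (norm_nonneg x).trans hx
  rw [Prod.norm_def]
  refine max_le ?_ ?_
  · rw [hz1]
    have := hf 0 (by simp)
    rw [ev_nonpos x le_rfl, ev_nonpos y le_rfl] at this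
    nlinarith
  · have h1 : ‖z.2‖ ^ 2 ≤ (η * (2 * S)) ^ 2 := by
      rw [L2_norm_sq]
      calc ∫ s, ‖z.2 s‖ ^ 2 ∂μ1 ≤ ∫ s, η ^ 2 * (‖x.2 s‖ + ‖y.2 s‖) ^ 2 ∂μ1 := by
            refine integral_mono_ae (L2_int_sq _)
              ((M_memLp x.2 y.2).integrable_sq.const_mul _) ?_
            filter_upwards [hz2, ae_restrict_mem measurableSet_Ioc] with s hs hsI
            rw [hs, ← mul_pow]
            gcongr
            refine (ContinuousLinearMap.le_opNorm _ _).trans ?_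
            gcongr
            · exact hf' s ⟨hsI.1.le, hsI.2⟩
            · rw [Prod.norm_def]
              exact max_le (by simp) (by simp)
        _ = η ^ 2 * ∫ s, (‖x.2 s‖ + ‖y.2 s‖) ^ 2 ∂μ1 := integral_const_mul _ _
        _ ≤ η ^ 2 * (2 * S) ^ 2 := by
            gcongr
            exact M_le ((norm_snd_le x).trans hx) ((norm_snd_le y).trans hy)
        _ = _ := by ring
    have h2 := abs_le_of_sq_le_sq h1 (by positivity)
    rw [abs_of_nonneg (norm_nonneg _)] at h2
    nlinarith

/-- Second order Taylor remainder. -/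
def aF (Φ : Evec n → ℝ) (P : Evec n × Evec n) : ℝ :=
  fderiv ℝ Φ P.1 (P.2 - P.1) - Φ P.2 + Φ P.1

def f0 (Φ : Evec n → ℝ) (P : Evec n × Evec n) : Evec n := aF Φ P • Nf Φ P.1

theorem aF_contDiff (hΦ : IsRegularDomain n Φ δ₀) : ContDiff ℝ 1 (aF Φ) := by
  have h1 : ContDiff ℝ 1 (fderiv ℝ Φ) := hΦ.smooth.fderiv_right (by norm_num)
  have h2 : ContDiff ℝ 1 Φ := hΦ.smooth.of_le (by norm_num)
  have h3 : ContDiff ℝ 1 fun P : Evec n × Evec n => fderiv ℝ Φ P.1 (P.2 - P.1) :=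
    (h1.comp contDiff_fst).clm_apply (contDiff_snd.sub contDiff_fst)
  exact (h3.sub (h2.comp contDiff_snd)).add (h2.comp contDiff_fst)

theorem f0_contDiff (hΦ : IsRegularDomain n Φ δ₀) : ContDiff ℝ 1 (f0 Φ) :=
  (aF_contDiff hΦ).smul ((Nf_contDiff hΦ).comp contDiff_fst)

theorem aF_diag (p : Evec n) : aF Φ (p, p) = 0 := by simp [aF]

theorem aF_fderiv_diag (hΦ : IsRegularDomain n Φ δ₀) (p : Evec n) :
    HasFDerivAt (aF Φ) (0 : Evec n × Evec n →L[ℝ] ℝ) (p, p) := by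
  have h1 : ContDiff ℝ 1 (fderiv ℝ Φ) := hΦ.smooth.fderiv_right (by norm_num)
  have hc0 : DifferentiableAt ℝ (fun P : Evec n × Evec n => fderiv ℝ Φ P.1) (p, p) :=
    ((h1.differentiable one_ne_zero).comp differentiable_fst) (p, p)
  have hc := hc0.hasFDerivAt
  have hu : HasFDerivAt (fun P : Evec n × Evec n => P.2 - P.1)
      (ContinuousLinearMap.snd ℝ (Evec n) (Evec n) - ContinuousLinearMap.fst ℝ (Evec n) (Evec n))
      (p, p) := hasFDerivAt_snd.sub hasFDerivAt_fst
  have e1 : HasFDerivAt (fun P : Evec n × Evec n => Φ P.2)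
      ((fderiv ℝ Φ p).comp (ContinuousLinearMap.snd ℝ (Evec n) (Evec n))) (p, p) :=
    HasFDerivAt.comp (g := Φ) (p, p) (Phi_diff hΦ p).hasFDerivAt hasFDerivAt_snd
  have e2 : HasFDerivAt (fun P : Evec n × Evec n => Φ P.1)
      ((fderiv ℝ Φ p).comp (ContinuousLinearMap.fst ℝ (Evec n) (Evec n))) (p, p) :=
    HasFDerivAt.comp (g := Φ) (p, p) (Phi_diff hΦ p).hasFDerivAt hasFDerivAt_fst
  have h := ((hc.clm_apply hu).sub e1).add e2
  refine h.congr_fderiv ?_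
  ext w <;> simp

theorem f0_diag (p : Evec n) : f0 Φ (p, p) = 0 := by simp [f0, aF_diag]

theorem f0_fderiv_diag (hΦ : IsRegularDomain n Φ δ₀) (p : Evec n) :
    fderiv ℝ (f0 Φ) (p, p) = 0 := by
  have h1 : DifferentiableAt ℝ (fun P : Evec n × Evec n => Nf Φ P.1) (p, p) :=
    (((Nf_contDiff hΦ).comp contDiff_fst).differentiable one_ne_zero) (p, p)
  have := (aF_fderiv_diag hΦ p).smul h1.hasFDerivAt
  have h2 := this.fderiv
  rw [aF_diag] at h2
  simp at h2
  exact h2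

theorem XX_le {x : EE n} (hx : x ∈ XX Φ) {s : ℝ} (hs : s ∈ Icc (0:ℝ) 1) : Φ (ev x s) ≤ 0 :=
  hx.1 s hs

theorem test_field (hG : IsFinslerEnergy n G ℓ α) (hΦ : IsRegularDomain n Φ δ₀) {S η : ℝ}
    (hS : 0 < S) (hη : 0 < η) : ∃ ρ > 0, ∃ m > 0, ∃ L > 0, ∀ x ∈ XX Φ, ∀ y ∈ XX Φ,
      ‖x‖ ≤ S → ‖y‖ ≤ S → (∀ s ∈ Icc (0:ℝ) 1, ‖ev y s - ev x s‖ ≤ ρ) →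
      ∃ ξ : EE n, |dJf G x ξ - dJf G x (y - x)| ≤ η ∧ ‖ξ‖ ≤ L ∧
        (∀ s ∈ Icc (0:ℝ) 1, -m ≤ Φ (ev x s) → ⟪gradient Φ (ev x s), ev ξ s⟫ ≤ -m) ∧
        -η ≤ ⟪gradient Φ (ev x 0), ev ξ 0⟫ ∧ -η ≤ ⟪gradient Φ (ev x 1), ev ξ 1⟫ := by
  have hl := hG.one_le_ell
  -- bounds on the transversal field
  have hNc : ContDiff ℝ 1 (fun P : Evec n × Evec n => Nf Φ P.1) :=
    (Nf_contDiff hΦ).comp contDiff_fst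
  have hKK := (K_compact hΦ).prod (K_compact hΦ)
  obtain ⟨C1, hC1⟩ := hKK.exists_bound_of_continuousOn hNc.continuous.continuousOn
  obtain ⟨C2, hC2⟩ := hKK.exists_bound_of_continuousOn
    (hNc.continuous_fderiv one_ne_zero).continuousOn
  set C := max (max C1 C2) 1 with hC
  have hC0 : 0 < C := by positivity
  set A := ℓ * (S ^ 2 + S) with hA
  have hA0 : 0 < A := by positivity
  set ν := min (η / 2) (η / (2 * A * (2 * (C * (2 * S + 1))))) with hν
  have hν0 : 0 < ν := by positivity
  set η' := min ν (η / (2 * A * (2 * S + 1))) with hη'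
  have hη'0 : 0 < η' := by positivity
  obtain ⟨ρ1, hρ1, k1⟩ := diag_small hΦ (aF_contDiff hΦ).continuous aF_diag hη'0
  obtain ⟨ρ2, hρ2, k2⟩ := diag_small hΦ (f0_contDiff hΦ).continuous f0_diag hη'0
  obtain ⟨ρ3, hρ3, k3⟩ := diag_small hΦ ((f0_contDiff hΦ).continuous_fderiv one_ne_zero)
    (f0_fderiv_diag hΦ) hη'0
  obtain ⟨m1, hm1, k4⟩ := inner_Nf_near hΦ (η := 1 / 8) (by norm_num)
  refine ⟨min ρ1 (min ρ2 ρ3), by positivity, min m1 (ν / 2), by positivity,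
    2 * S + η' * (2 * S + 1) + 2 * ν * (C * (2 * S + 1)), by positivity,
    fun x hx y hy hxS hyS hd => ?_⟩
  obtain ⟨z0, hz0, hz01, hz02⟩ := exists_comp (f0_contDiff hΦ) x y
  obtain ⟨zN, hzN, hzN1, hzN2⟩ := exists_comp hNc x y
  have hρa : ∀ s ∈ Icc (0:ℝ) 1, ‖ev y s - ev x s‖ ≤ ρ1 := fun s hs =>
    (hd s hs).trans (min_le_left _ _)
  have hρb : ∀ s ∈ Icc (0:ℝ) 1, ‖ev y s - ev x s‖ ≤ ρ2 := fun s hs =>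
    (hd s hs).trans ((min_le_right _ _).trans (min_le_left _ _))
  have hρc : ∀ s ∈ Icc (0:ℝ) 1, ‖ev y s - ev x s‖ ≤ ρ3 := fun s hs =>
    (hd s hs).trans ((min_le_right _ _).trans (min_le_right _ _))
  have nz0 : ‖z0‖ ≤ η' * (2 * S + 1) := comp_small hxS hyS hη'0.le hz01 hz02
    (fun s hs => k2 _ _ (XX_le hx hs) (XX_le hy hs) (hρb s hs))
    (fun s hs => k3 _ _ (XX_le hx hs) (XX_le hy hs) (hρc s hs))
  have nzN : ‖zN‖ ≤ C * (2 * S + 1) := comp_small hxS hyS hC0.le hzN1 hzN2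
    (fun s hs => (hC1 (ev x s, ev y s) ⟨XX_le hx hs, XX_le hy hs⟩).trans
      ((le_max_left _ _).trans (le_max_left _ _)))
    (fun s hs => (hC2 (ev x s, ev y s) ⟨XX_le hx hs, XX_le hy hs⟩).trans
      ((le_max_right _ _).trans (le_max_left _ _)))
  set z := z0 + (2 * ν) • zN with hz
  have nz : ‖z‖ ≤ η' * (2 * S + 1) + 2 * ν * (C * (2 * S + 1)) := by
    refine (norm_add_le _ _).trans ?_
    rw [norm_smul, Real.norm_of_nonneg (by positivity)]
    gcongr
  have evξ : ∀ s ∈ Icc (0:ℝ) 1, ⟪gradient Φ (ev x s), ev (y - x - z) s⟫ =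
      Φ (ev y s) - Φ (ev x s) + aF Φ (ev x s, ev y s) *
        (1 - ⟪gradient Φ (ev x s), Nf Φ (ev x s)⟫) -
        2 * ν * ⟪gradient Φ (ev x s), Nf Φ (ev x s)⟫ := by
    intro s hs
    have h1 : ⟪gradient Φ (ev x s), ev y s - ev x s⟫ =
        aF Φ (ev x s, ev y s) + Φ (ev y s) - Φ (ev x s) := by
      rw [inner_grad]; simp only [aF]; ring
    rw [ev_sub, ev_sub, hz, ev_add, ev_smul, hz0 s hs, hzN s hs]
    rw [inner_sub_right, h1, inner_add_right, f0, inner_smul_right, inner_smul_right]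
    ring
  have hend : ∀ s ∈ Icc (0:ℝ) 1, Φ (ev x s) = 0 → Φ (ev y s) = 0 →
      -η ≤ ⟪gradient Φ (ev x s), ev (y - x - z) s⟫ := by
    intro s hs h1 h2
    rw [evξ s hs, inner_Nf_bdry hΦ h1, h1, h2]
    have := min_le_left (η / 2) (η / (2 * A * (2 * (C * (2 * S + 1)))))
    linarith
  refine ⟨y - x - z, ?_, ?_, ?_, hend 0 (by simp) hx.2.1 hy.2.1, hend 1 (by simp) hx.2.2 hy.2.2⟩
  · rw [dJf_sub hG x (y - x) z, sub_sub_cancel_left, abs_neg]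
    refine (dJf_le hG x z).trans ?_
    have hx2 : ‖x.2‖ ≤ S := (norm_snd_le x).trans hxS
    calc ℓ * (‖x.2‖ ^ 2 + ‖x.2‖) * ‖z‖ ≤
        A * (η' * (2 * S + 1) + 2 * ν * (C * (2 * S + 1))) := by rw [hA]; gcongr
      _ ≤ A * (η / (2 * A * (2 * S + 1)) * (2 * S + 1) +
          2 * (η / (2 * A * (2 * (C * (2 * S + 1))))) * (C * (2 * S + 1))) := by
          gcongr
          · exact min_le_right _ _
          · exact min_le_right _ _
      _ = η := by field_simp; ring
  · refine (norm_sub_le _ _).trans ?_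
    have := norm_sub_le y x
    linarith
  · intro s hs hm
    rw [evξ s hs]
    have hp := XX_le hx hs
    have hq := XX_le hy hs
    have h1 := abs_le.1 (k4 _ hp (by linarith [min_le_left m1 (ν / 2)]))
    have h2 := abs_le.1 ((Real.norm_eq_abs _).ge.trans ((k1 _ _ hp hq (hρa s hs)).trans (min_le_left _ _)))
    have h3 := min_le_right m1 (ν / 2)
    set κ := ⟪gradient Φ (ev x s), Nf Φ (ev x s)⟫
    set a := aF Φ (ev x s, ev y s)
    have h4 : a * (1 - κ) ≤ ν * (1 / 8) := by
      have h5 : |a * (1 - κ)| ≤ ν * (1 / 8) := by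
        rw [abs_mul]
        exact mul_le_mul (abs_le.2 h2) (by rw [abs_sub_comm]; exact abs_le.2 h1) (abs_nonneg _) hν0.le
      exact (le_abs_self _).trans h5
    have h6 : ν * (7 / 8) ≤ ν * κ := by gcongr; linarith
    linarith

end FD
end

noncomputable section
open MeasureTheory Set Filter RealInnerProductSpace Topology
namespace FD
variable {n : ℕ} {G : Evec n → Evec n → ℝ} {ℓ α : ℝ} {Φ : Evec n → ℝ} {δ₀ : ℝ}

theorem ev_joint : Continuous fun p : EE n × ℝ => ev p.1 p.2 := by
  rw [continuous_iff_continuousAt]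
  rintro ⟨x, s⟩
  rw [ContinuousAt, tendsto_iff_norm_sub_tendsto_zero]
  refine squeeze_zero (g := fun p : EE n × ℝ => 2 * ‖p.1 - x‖ + ‖ev x p.2 - ev x s‖)
    (fun _ => norm_nonneg _) (fun p => ?_) ?_
  · have : ev p.1 p.2 - ev x s = ev (p.1 - x) p.2 + (ev x p.2 - ev x s) := by rw [ev_sub]; abel
    rw [this]
    exact (norm_add_le _ _).trans (by gcongr; exact norm_ev_le _ _)
  · have hx := ev_continuous x
    have : Continuous fun p : EE n × ℝ => 2 * ‖p.1 - x‖ + ‖ev x p.2 - ev x s‖ := by fun_prop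
    simpa using this.tendsto (x, s)

theorem dJf_cont_left (hG : IsFinslerEnergy n G ℓ α) (ξ : EE n) :
    Continuous fun x : EE n => dJf G x ξ := by
  rw [Metric.continuous_iff]
  intro x ε hε
  obtain ⟨δ, hδ, h⟩ := dJf_unif hG (S := ‖x‖ + 1) (by positivity) (ε := ε / (2 * (‖ξ‖ + 1)))
    (by positivity)
  refine ⟨min δ 1, by positivity, fun y hy => ?_⟩
  rw [dist_eq_norm] at hy
  have h1 := h x y ξ (by linarith) (by
    have := norm_le_norm_add_norm_sub' y x
    linarith [min_le_right δ 1]) (by rw [norm_sub_rev]; exact hy.le.trans (min_le_left _ _))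
  rw [Real.dist_eq]
  refine lt_of_le_of_lt h1 ?_
  rw [div_mul_eq_mul_div, div_lt_iff₀ (by positivity)]
  nlinarith [norm_nonneg ξ]

/-- Openness of the strict descent conditions. -/
theorem good_nhds (hG : IsFinslerEnergy n G ℓ α) (hΦ : IsRegularDomain n Φ δ₀) {x ξ : EE n}
    {A m c0 : ℝ} (hm : 0 < m) (h1 : dJf G x ξ < A)
    (h2 : ∀ s ∈ Icc (0:ℝ) 1, -m ≤ Φ (ev x s) → ⟪gradient Φ (ev x s), ev ξ s⟫ ≤ -m)
    (h3 : -c0 < ⟪gradient Φ (ev x 0), ev ξ 0⟫) (h4 : -c0 < ⟪gradient Φ (ev x 1), ev ξ 1⟫) :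
    ∀ᶠ y in 𝓝 x, dJf G y ξ < A ∧
      (∀ s ∈ Icc (0:ℝ) 1, -(m / 2) ≤ Φ (ev y s) → ⟪gradient Φ (ev y s), ev ξ s⟫ ≤ -(m / 2)) ∧
      -c0 < ⟪gradient Φ (ev y 0), ev ξ 0⟫ ∧ -c0 < ⟪gradient Φ (ev y 1), ev ξ 1⟫ := by
  have hP := Phi_cont hΦ
  have hg := grad_cont hΦ
  have hξ := ev_continuous ξ
  have hj := ev_joint (n := n)
  have e1 : ∀ᶠ y in 𝓝 x, dJf G y ξ < A :=
    (dJf_cont_left hG ξ).continuousAt.eventually_lt continuousAt_const h1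
  have e3 : ∀ s, -c0 < ⟪gradient Φ (ev x s), ev ξ s⟫ →
      ∀ᶠ y in 𝓝 x, -c0 < ⟪gradient Φ (ev y s), ev ξ s⟫ := by
    intro s hs
    have hc : Continuous fun y : EE n => ⟪gradient Φ (ev y s), ev ξ s⟫ :=
      (hg.comp (ev_continuous_left s)).inner continuous_const
    exact continuousAt_const.eventually_lt hc.continuousAt hs
  have e2 : ∀ᶠ y in 𝓝 x, ∀ s ∈ Icc (0:ℝ) 1, Φ (ev y s) < -(m / 2) ∨
      ⟪gradient Φ (ev y s), ev ξ s⟫ < -(m / 2) := by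
    refine isCompact_Icc.eventually_forall_of_forall_eventually fun s hs => ?_
    by_cases hh : -m ≤ Φ (ev x s)
    · have hc : Continuous fun z : EE n × ℝ => ⟪gradient Φ (ev z.1 z.2), ev ξ z.2⟫ :=
        (hg.comp hj).inner (hξ.comp continuous_snd)
      have := hc.continuousAt.eventually_lt (x₀ := (x, s)) (continuousAt_const (y := -(m/2)))
        (by have := h2 s hs hh; change _ < _; linarith)
      exact this.mono fun z hz => Or.inr hz
    · have hc : Continuous fun z : EE n × ℝ => Φ (ev z.1 z.2) := hP.comp hj
      have := hc.continuousAt.eventually_lt (x₀ := (x, s)) (continuousAt_const (y := -(m/2)))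
        (by push Not at hh; change _ < _; linarith)
      exact this.mono fun z hz => Or.inl hz
  filter_upwards [e1, e2, e3 0 h3, e3 1 h4] with y a1 a2 a3 a4
  refine ⟨a1, fun s hs hh => ?_, a3, a4⟩
  rcases a2 s hs with h | h
  · linarith
  · exact h.le

theorem arzela {x : ℕ → EE n} {S : ℝ} (hx : ∀ k, ‖x k‖ ≤ S) :
    ∃ φ : ℕ → ℕ, StrictMono φ ∧ ∀ ρ > 0, ∃ N, ∀ j ≥ N, ∀ k ≥ N, ∀ s ∈ Icc (0:ℝ) 1,
      ‖ev (x (φ j)) s - ev (x (φ k)) s‖ ≤ ρ := by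
  have hS : 0 ≤ S := (norm_nonneg _).trans (hx 0)
  let F : ℕ → BoundedContinuousFunction (Icc (0:ℝ) 1) (Evec n) := fun k =>
    BoundedContinuousFunction.mkOfCompact ⟨fun s => ev (x k) s,
      (ev_continuous (x k)).comp continuous_subtype_val⟩
  have hF : ∀ k s, F k s = ev (x k) s := fun k s => rfl
  have hcomp : IsCompact (closure (range F)) := by
    refine BoundedContinuousFunction.arzela_ascoli (Metric.closedBall (0 : Evec n) (2 * S))
      (isCompact_closedBall _ _) (range F) ?_ ?_
    · rintro f s ⟨k, rfl⟩
      rw [hF, mem_closedBall_zero_iff]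
      exact (norm_ev_le _ _).trans (by linarith [hx k])
    · refine Metric.equicontinuous_of_continuity_modulus (fun r => Real.sqrt r * S) ?_ _ ?_
      · have : Continuous fun r : ℝ => Real.sqrt r * S := by fun_prop
        simpa using this.tendsto 0
      · rintro s t ⟨f, k, rfl⟩
        rw [dist_eq_norm]
        change ‖ev (x k) s - ev (x k) t‖ ≤ _
        refine (norm_ev_sub_le' (x k) t s).trans ?_
        rw [Subtype.dist_eq, Real.dist_eq]
        gcongr
        exact (norm_snd_le _).trans (hx k)
  obtain ⟨f, _, φ, hφ, hlim⟩ := hcomp.tendsto_subseq (fun k => subset_closure (mem_range_self k))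
  refine ⟨φ, hφ, fun ρ hρ => ?_⟩
  have hc := hlim.cauchySeq
  rw [Metric.cauchySeq_iff] at hc
  obtain ⟨N, hN⟩ := hc ρ hρ
  refine ⟨N, fun j hj k hk s hs => ?_⟩
  have h1 := hN j hj k hk
  have h2 := (BoundedContinuousFunction.dist_coe_le_dist (f := F (φ j)) (g := F (φ k)) ⟨s, hs⟩)
  rw [hF, hF, dist_eq_norm] at h2
  exact h2.trans h1.le

theorem XX_bdd (hG : IsFinslerEnergy n G ℓ α) (hΦ : IsRegularDomain n Φ δ₀) (c' : ℝ) :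
    ∃ S > 0, ∀ x ∈ XX Φ, Jf G x ≤ c' → ‖x‖ ≤ S := by
  have hl := hG.one_le_ell
  obtain ⟨B, hB, hb⟩ := K_bdd hΦ
  refine ⟨max B (Real.sqrt (2 * ℓ * c')), by positivity, fun x hx hJ => ?_⟩
  rw [Prod.norm_def]
  refine max_le_max ?_ ?_
  · have := hb _ hx.2.1.le
    rwa [ev_nonpos x le_rfl] at this
  · refine Real.le_sqrt_of_sq_le ((Jf_lower hG x).trans ?_)
    gcongr

/-- Uniform descent directions near the regular level. -/
def Good (G : Evec n → Evec n → ℝ) (Φ : Evec n → ℝ) (c0 m : ℝ) (x ξ : EE n) : Prop :=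
  ‖ξ‖ ≤ 1 / m ∧ dJf G x ξ ≤ -1 ∧
  (∀ s ∈ Icc (0:ℝ) 1, -m ≤ Φ (ev x s) → ⟪gradient Φ (ev x s), ev ξ s⟫ ≤ -m) ∧
  -c0 ≤ ⟪gradient Φ (ev x 0), ev ξ 0⟫ ∧ -c0 ≤ ⟪gradient Φ (ev x 1), ev ξ 1⟫

theorem strict_dir (hG : IsFinslerEnergy n G ℓ α) (hΦ : IsRegularDomain n Φ δ₀) {x ξ : EE n}
    {c0 : ℝ} (hc0 : 0 < c0) (hx : x ∈ XX Φ)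
    (h1 : dJf G x ξ < 0) (h2 : ⟪gradient Φ (ev x 0), ev ξ 0⟫ = 0)
    (h3 : ⟪gradient Φ (ev x 1), ev ξ 1⟫ = 0)
    (h4 : ∀ s ∈ Ioo (0:ℝ) 1, Φ (ev x s) = 0 → ⟪gradient Φ (ev x s), ev ξ s⟫ ≤ 0) :
    ∃ ζ : EE n, ∃ m > 0, dJf G x ζ < -1 ∧
      (∀ s ∈ Icc (0:ℝ) 1, -m ≤ Φ (ev x s) → ⟪gradient Φ (ev x s), ev ζ s⟫ ≤ -m) ∧
      -c0 < ⟪gradient Φ (ev x 0), ev ζ 0⟫ ∧ -c0 < ⟪gradient Φ (ev x 1), ev ζ 1⟫ := by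
  have hNc : ContDiff ℝ 1 (fun P : Evec n × Evec n => Nf Φ P.1) :=
    (Nf_contDiff hΦ).comp contDiff_fst
  obtain ⟨z, hz, -, -⟩ := exists_comp hNc x x
  simp only at hz
  set D := dJf G x ξ with hD
  set κ := min (c0 / 2) (1 / (1 + |dJf G x z|)) with hκ
  have hκ0 : 0 < κ := by positivity
  set ζ := (-3 / D) • ξ - κ • z with hζ
  have hD3 : 0 < -3 / D := div_pos_of_neg_of_neg (by norm_num) h1
  have inn : ∀ s ∈ Icc (0:ℝ) 1, Φ (ev x s) = 0 → ⟪gradient Φ (ev x s), ev ζ s⟫ =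
      (-3 / D) * ⟪gradient Φ (ev x s), ev ξ s⟫ - κ := by
    intro s hs h0
    rw [hζ, ev_sub, ev_smul, ev_smul, hz s hs, inner_sub_right, inner_smul_right, inner_smul_right,
      inner_Nf_bdry hΦ h0, mul_one]
  have i0 := inn 0 (by simp) hx.2.1
  have i1 := inn 1 (by simp) hx.2.2
  rw [h2, mul_zero, zero_sub] at i0
  rw [h3, mul_zero, zero_sub] at i1
  have hneg : ∀ s ∈ Icc (0:ℝ) 1, Φ (ev x s) = 0 → ⟪gradient Φ (ev x s), ev ζ s⟫ ≤ -κ := by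
    intro s hs h0
    rcases hs.1.eq_or_lt with h | h
    · rw [← h]; exact i0.le
    rcases hs.2.eq_or_lt with h' | h'
    · rw [h']; exact i1.le
    rw [inn s hs h0]
    have := mul_nonpos_of_nonneg_of_nonpos hD3.le (h4 s ⟨h, h'⟩ h0)
    linarith
  have hcont : Continuous fun s => max (-Φ (ev x s)) (-⟪gradient Φ (ev x s), ev ζ s⟫) := by
    have hP := Phi_cont hΦ
    have hg := grad_cont hΦ
    exact ((hP.comp (ev_continuous x)).neg).max
      ((hg.comp (ev_continuous x)).inner (ev_continuous ζ)).neg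
  obtain ⟨m, hm, hmb⟩ := (isCompact_Icc (a := (0:ℝ)) (b := 1)).exists_forall_le' (a := 0)
    hcont.continuousOn (fun s hs => by
      rcases (hx.1 s hs).eq_or_lt with h | h
      · exact lt_max_of_lt_right (by linarith [hneg s hs h])
      · exact lt_max_of_lt_left (by linarith))
  refine ⟨ζ, m / 2, by positivity, ?_, fun s hs hms => ?_, ?_, ?_⟩
  · rw [hζ, dJf_sub hG, dJf_smul, dJf_smul]
    have e1 : -3 / D * dJf G x ξ = -3 := by rw [← hD]; exact div_mul_cancel₀ _ h1.ne
    rw [e1]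
    have e2 : |κ * dJf G x z| ≤ 1 := by
      rw [abs_mul, abs_of_pos hκ0]
      calc κ * |dJf G x z| ≤ (1 / (1 + |dJf G x z|)) * (1 + |dJf G x z|) := by
            gcongr
            · exact min_le_right _ _
            · linarith
        _ = 1 := by field_simp
    linarith [(abs_le.1 e2).1]
  · rcases le_max_iff.1 (hmb s hs) with h | h
    · linarith
    · linarith
  · rw [i0]; linarith [min_le_left (c0 / 2) (1 / (1 + |dJf G x z|))]
  · rw [i1]; linarith [min_le_left (c0 / 2) (1 / (1 + |dJf G x z|))]

theorem uniform_good (hG : IsFinslerEnergy n G ℓ α) (hΦ : IsRegularDomain n Φ δ₀) {c c0 : ℝ}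
    (hc0 : 0 < c0)
    (hreg : ∀ x ∈ XX Φ, Jf G x = c → ∃ ξ : EE n, dJf G x ξ < 0 ∧
      ⟪gradient Φ (ev x 0), ev ξ 0⟫ = 0 ∧ ⟪gradient Φ (ev x 1), ev ξ 1⟫ = 0 ∧
      ∀ s ∈ Ioo (0:ℝ) 1, Φ (ev x s) = 0 → ⟪gradient Φ (ev x s), ev ξ s⟫ ≤ 0) :
    ∃ m > 0, ∀ x ∈ XX Φ, |Jf G x - c| < m → ∃ ξ, Good G Φ c0 m x ξ := by
  by_contra hcon
  push Not at hcon
  have hα := hG.alpha_pos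
  choose x hxX hxJ hxG using fun k : ℕ => hcon (1 / ((k:ℝ) + 1)) (by positivity)
  obtain ⟨S, hS, hSb⟩ := XX_bdd hG hΦ (c + 1)
  have hxS : ∀ k, ‖x k‖ ≤ S := fun k => hSb _ (hxX k) (by
    have h1 := (abs_lt.1 (hxJ k)).2
    have h2 : 1 / ((k:ℝ) + 1) ≤ 1 := by
      rw [div_le_one (by positivity)]; linarith [(Nat.cast_nonneg k : (0:ℝ) ≤ k)]
    linarith)
  obtain ⟨φ, hφ, hφc⟩ := arzela hxS
  have htend : Tendsto (fun k : ℕ => 1 / ((φ k : ℝ) + 1)) atTop (𝓝 0) :=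
    (tendsto_one_div_add_atTop_nhds_zero_nat (𝕜 := ℝ)).comp hφ.tendsto_atTop
  have hsmall : ∀ b > 0, ∃ N, ∀ k ≥ N, 1 / ((φ k : ℝ) + 1) ≤ b := by
    intro b hb
    have := (htend.eventually_lt_const hb)
    obtain ⟨N, hN⟩ := eventually_atTop.1 this
    exact ⟨N, fun k hk => (hN k hk).le⟩
  -- one-sided almost criticality
  have hlow : ∀ η > 0, ∃ N, ∀ j ≥ N, ∀ k ≥ N,
      -(2 * η) ≤ dJf G (x (φ k)) (x (φ j) - x (φ k)) := by
    intro η hη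
    obtain ⟨ρ, hρ, m, hm, L, hL, ht⟩ := test_field hG hΦ hS (η := min η (η * c0)) (by positivity)
    obtain ⟨N1, hN1⟩ := hφc ρ hρ
    obtain ⟨N2, hN2⟩ := hsmall (min (η / L) (min m (m / η))) (by positivity)
    refine ⟨max N1 N2, fun j hj k hk => ?_⟩
    by_contra hlt
    push Not at hlt
    obtain ⟨ξ, a1, a2, a3, a4, a5⟩ := ht (x (φ k)) (hxX _) (x (φ j)) (hxX _) (hxS _) (hxS _)
      (hN1 j (le_of_max_le_left hj) k (le_of_max_le_left hk))
    have hk2 := hN2 k (le_of_max_le_right hk)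
    have b1 := hk2.trans (min_le_left _ _)
    have b2 := hk2.trans ((min_le_right _ _).trans (min_le_left _ _))
    have b3 := hk2.trans ((min_le_right _ _).trans (min_le_right _ _))
    have hηi : 0 < η⁻¹ := by positivity
    have hmin : min η (η * c0) ≤ η * c0 := min_le_right _ _
    have hend : ∀ r : ℝ, -(min η (η * c0)) ≤ r → -c0 ≤ η⁻¹ * r := by
      intro r hr
      rw [inv_mul_eq_div, le_div_iff₀ hη]; linarith
    refine hxG (φ k) (η⁻¹ • ξ) ⟨?_, ?_, ?_, ?_, ?_⟩
    · rw [norm_smul, Real.norm_of_nonneg hηi.le, one_div_one_div]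
      rw [div_le_iff₀ (by positivity)] at b1
      rw [inv_mul_le_iff₀ hη]
      refine a2.trans ?_
      rw [div_mul_eq_mul_div, le_div_iff₀ hL] at b1
      linarith
    · rw [dJf_smul, inv_mul_eq_div, div_le_iff₀ hη]
      have := (abs_le.1 (a1.trans (min_le_left _ _))).2
      linarith
    · intro s hs h
      rw [ev_smul, inner_smul_right, inv_mul_eq_div, div_le_iff₀ hη]
      have h5 := a3 s hs (by linarith)
      rw [le_div_iff₀ hη] at b3
      linarith
    · rw [ev_smul, inner_smul_right]; exact hend _ a4
    · rw [ev_smul, inner_smul_right]; exact hend _ a5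
  -- Cauchy property
  have hcau : CauchySeq fun k => x (φ k) := by
    rw [Metric.cauchySeq_iff]
    intro r hr
    have hη : 0 < α * (r / 2) ^ 2 / 9 := by positivity
    obtain ⟨ρ, hρ, hmon⟩ := dJf_mono hG hS.le hη
    obtain ⟨N1, hN1⟩ := hlow _ hη
    obtain ⟨N2, hN2⟩ := hφc (min ρ (r / 2)) (by positivity)
    refine ⟨max N1 N2, fun j hj k hk => ?_⟩
    have c1 := hN1 j (le_of_max_le_left hj) k (le_of_max_le_left hk)
    have c2 := hN1 k (le_of_max_le_left hk) j (le_of_max_le_left hj)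
    have c3 := hN2 j (le_of_max_le_right hj) k (le_of_max_le_right hk)
    have c4 := hmon (x (φ k)) (x (φ j)) (hxS _) (hxS _)
      (fun s hs => (c3 s hs).trans (min_le_left _ _))
    rw [← neg_sub, dJf_neg] at c2
    have c5 : α * ‖(x (φ j)).2 - (x (φ k)).2‖ ^ 2 ≤ α * (r / 2) ^ 2 := by linarith
    have c6 : ‖(x (φ j)).2 - (x (φ k)).2‖ ≤ r / 2 :=
      le_of_sq_le_sq (le_of_mul_le_mul_left c5 hα) (by positivity)
    have c7 := (c3 0 (by simp)).trans (min_le_right _ _)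
    rw [ev_nonpos _ le_rfl, ev_nonpos _ le_rfl] at c7
    rw [dist_eq_norm, Prod.norm_def]
    have : max ‖(x (φ j) - x (φ k)).1‖ ‖(x (φ j) - x (φ k)).2‖ ≤ r / 2 := max_le c7 c6
    linarith
  obtain ⟨y, hy⟩ := cauchySeq_tendsto_of_complete hcau
  have hyX : y ∈ XX Φ := (XX_closed (Phi_cont hΦ)).mem_of_tendsto hy
    (Eventually.of_forall fun k => hxX _)
  have hyJ : Jf G y = c := by
    have h1 := ((Jf_cont hG).tendsto y).comp hy
    have h2 : Tendsto (fun k => Jf G (x (φ k))) atTop (𝓝 c) := by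
      rw [tendsto_iff_norm_sub_tendsto_zero]
      exact squeeze_zero (fun _ => norm_nonneg _) (fun k => (hxJ (φ k)).le) htend
    exact tendsto_nhds_unique h1 h2
  obtain ⟨ξ, k1, k2, k3, k4⟩ := hreg y hyX hyJ
  obtain ⟨ζ, m, hm, g1, g2, g3, g4⟩ := strict_dir hG hΦ hc0 hyX k1 k2 k3 k4
  have hev := hy.eventually (good_nhds hG hΦ hm g1 g2 g3 g4)
  obtain ⟨N, hN⟩ := hsmall (min (m / 2) (1 / (‖ζ‖ + 1))) (by positivity)
  obtain ⟨k, hk, hkN⟩ := (hev.and (eventually_ge_atTop N)).exists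
  have hk2 := hN k hkN
  have b1 := hk2.trans (min_le_left _ _)
  have b2 := hk2.trans (min_le_right _ _)
  refine hxG (φ k) ζ ⟨?_, hk.1.le, fun s hs h => ?_, hk.2.2.1.le, hk.2.2.2.le⟩
  · rw [one_div_one_div]
    rw [div_le_div_iff₀ (by positivity) (by positivity)] at b2
    linarith
  · exact (hk.2.1 s hs (by linarith)).trans (by linarith)

end FD
end

noncomputable section
open MeasureTheory Set Filter RealInnerProductSpace Topology
namespace FD
variable {n : ℕ} {G : Evec n → Evec n → ℝ} {ℓ α : ℝ} {Φ : Evec n → ℝ} {δ₀ : ℝ}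

theorem mp_rev : MeasurePreserving (fun s : ℝ => 1 - s) μ1 μ1 := by
  have h := (Measure.measurePreserving_sub_left (volume : Measure ℝ) 1).restrict_preimage
    (s := Ioc (0:ℝ) 1) measurableSet_Ioc
  have e : (fun s : ℝ => 1 - s) ⁻¹' Ioc (0:ℝ) 1 = Ico 0 1 := by
    ext s; simp only [mem_preimage, mem_Ioc, mem_Ico]; constructor <;> rintro ⟨a, b⟩ <;>
      constructor <;> linarith
  rw [e, Measure.restrict_congr_set Ico_ae_eq_Ioc] at h
  exact h

theorem me_rev : MeasurableEmbedding (fun s : ℝ => 1 - s) :=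
  (MeasurableEquiv.subLeft (1:ℝ)).measurableEmbedding

/-- Backward reparametrization on velocities. -/
def revL (u : L2 n) : L2 n := - Lp.compMeasurePreserving (fun s : ℝ => 1 - s) mp_rev u

theorem revL_ae (u : L2 n) : (fun s => revL u s) =ᵐ[μ1] fun s => - u (1 - s) := by
  unfold revL
  filter_upwards [Lp.coeFn_neg (Lp.compMeasurePreserving (fun s : ℝ => 1 - s) mp_rev u),
    Lp.coeFn_compMeasurePreserving u mp_rev] with s h1 h2
  rw [h1, Pi.neg_apply, h2]; rfl

theorem revL_norm (u : L2 n) : ‖revL u‖ = ‖u‖ := by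
  unfold revL
  rw [norm_neg, Lp.norm_compMeasurePreserving]

/-- Backward reparametrization on the model space. -/
def rev (x : EE n) : EE n := (ev x 1, revL x.2)

theorem ev_rev (x : EE n) (s : ℝ) : ev (rev x) s = ev x (1 - s) := by
  have h1 : ∫ r in Iic s, revL x.2 r ∂μ1 = - ∫ r in Ici (1 - s), x.2 r ∂μ1 := by
    rw [integral_congr_ae (ae_restrict_of_ae (revL_ae x.2)), integral_neg]
    congr 1
    have e : Iic s = (fun s : ℝ => 1 - s) ⁻¹' Ici (1 - s) := by
      ext r; simp
    rw [e]
    exact mp_rev.setIntegral_preimage_emb me_rev (fun r => x.2 r) _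
  have h2 : ∫ r in Iic (1 - s), x.2 r ∂μ1 + ∫ r in Ici (1 - s), x.2 r ∂μ1 = ∫ r, x.2 r ∂μ1 := by
    rw [integral_Ici_eq_integral_Ioi, ← Set.compl_Iic]
    exact integral_add_compl measurableSet_Iic (L2_int _)
  have h3 : ∫ r in Iic 1, x.2 r ∂μ1 = ∫ r, x.2 r ∂μ1 := by
    rw [Measure.restrict_restrict measurableSet_Iic]
    congr 2
    ext r; simp only [mem_inter_iff, mem_Iic, mem_Ioc]; tauto
  unfold ev
  change x.1 + ∫ r in Iic 1, x.2 r ∂μ1 + ∫ r in Iic s, revL x.2 r ∂μ1 = _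
  rw [h1, h3, ← h2]; abel

theorem revL_revL (u : L2 n) : revL (revL u) = u := by
  apply Lp.ext
  have h := mp_rev.quasiMeasurePreserving.ae (revL_ae u)
  filter_upwards [revL_ae (revL u), h] with s h1 h2
  rw [h1]
  rw [h2]; simp

theorem rev_rev (x : EE n) : rev (rev x) = x := by
  refine Prod.ext ?_ (revL_revL _)
  change ev (rev x) 1 = x.1
  rw [ev_rev, sub_self, ev_nonpos x le_rfl]

theorem revL_sub (u v : L2 n) : revL (u - v) = revL u - revL v := by
  unfold revL; rw [map_sub]; abel

theorem rev_sub (x y : EE n) : rev (x - y) = rev x - rev y :=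
  Prod.ext (ev_sub x y 1) (revL_sub _ _)

theorem rev_norm (x : EE n) : ‖rev x‖ ≤ 2 * ‖x‖ := by
  rw [Prod.norm_def]
  refine max_le (norm_ev_le x 1) ?_
  change ‖revL x.2‖ ≤ _
  rw [revL_norm]
  have := norm_snd_le x
  have := norm_nonneg x
  linarith

theorem rev_cont : Continuous (rev : EE n → EE n) := by
  rw [continuous_iff_continuousAt]
  intro x
  rw [ContinuousAt, tendsto_iff_norm_sub_tendsto_zero]
  refine squeeze_zero (g := fun y => 2 * ‖y - x‖) (fun _ => norm_nonneg _) (fun y => ?_) ?_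
  · rw [← rev_sub]; exact rev_norm _
  · have : Continuous fun y : EE n => 2 * ‖y - x‖ := by fun_prop
    simpa using this.tendsto x

theorem rev_XX {x : EE n} (hx : x ∈ XX Φ) : rev x ∈ XX Φ := by
  refine ⟨fun s hs => ?_, ?_, ?_⟩
  · rw [ev_rev]; exact hx.1 _ ⟨by linarith [hs.2], by linarith [hs.1]⟩
  · rw [ev_rev, sub_zero]; exact hx.2.2
  · rw [ev_rev, sub_self]; exact hx.2.1

theorem Jf_rev (hr : ∀ q v : Evec n, G q (-v) = G q v) (x : EE n) : Jf G (rev x) = Jf G x := by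
  unfold Jf
  congr 1
  rw [← mp_rev.integral_comp me_rev (fun s => G (ev x s) (x.2 s))]
  apply integral_congr_ae
  filter_upwards [revL_ae x.2] with s hs
  change G (ev (rev x) s) (revL x.2 s) = _
  rw [hs, ev_rev, hr]

theorem dJf_rev (hr : ∀ q v : Evec n, G q (-v) = G q v) (x ξ : EE n) :
    dJf G (rev x) (rev ξ) = dJf G x ξ := by
  unfold dJf
  congr 1
  rw [← mp_rev.integral_comp me_rev (fun s => dInt G x ξ s)]
  apply integral_congr_ae
  filter_upwards [revL_ae x.2, revL_ae ξ.2] with s hs hs'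
  have e1 : ∀ q v : Evec n, dqCLM G q (-v) = dqCLM G q v := by
    intro q v; unfold dqCLM; simp only [hr]
  have e2 : ∀ q v w : Evec n, dvCLM G q (-v) (-w) = dvCLM G q v w := by
    intro q v w; unfold dvCLM
    have h := (ContinuousLinearEquiv.neg ℝ (M := Evec n)).comp_right_fderiv
      (f := fun w => G q w) (x := v)
    have e : (fun w => G q w) ∘ (ContinuousLinearEquiv.neg ℝ (M := Evec n)) = fun w => G q w := by
      ext w; simp [hr]
    rw [e] at h
    rw [h]; simp
  unfold dInt
  change dqCLM G (ev (rev x) s) (revL x.2 s) (ev (rev ξ) s) +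
    dvCLM G (ev (rev x) s) (revL x.2 s) (revL ξ.2 s) = _
  rw [hs, hs', ev_rev, ev_rev, e1, e2]

theorem toE_rev {x y : H1Curve n 0 1} (h : RevRep x y) : toE y = rev (toE x) := by
  refine Prod.ext ?_ ?_
  · change y.toFun 0 = ev (toE x) 1
    rw [ev_toE x (by simp), h.1, sub_zero]
  · apply Lp.ext
    have h' := mp_rev.quasiMeasurePreserving.ae (toE_ae x)
    filter_upwards [toE_ae y, revL_ae (toE x).2, h'] with s h1 h2 h3
    change _ = revL (toE x).2 s
    rw [h1, h2, h3, h.2]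

/-- The continuous descent field. -/
theorem field (hG : IsFinslerEnergy n G ℓ α) (hΦ : IsRegularDomain n Φ δ₀) {c c0 m : ℝ}
    (hc0 : 0 < c0) (hm : 0 < m)
    (hgood : ∀ x ∈ XX Φ, |Jf G x - c| < m → ∃ ξ, Good G Φ c0 m x ξ) :
    ∃ Ξ : EE n → EE n, ContinuousOn Ξ (XX Φ) ∧ ∀ x ∈ XX Φ, ‖Ξ x‖ ≤ 1 / m ∧
      (|Jf G x - c| ≤ m / 2 → dJf G x (Ξ x) ≤ -(1 / 2) ∧
        (∀ s ∈ Icc (0:ℝ) 1, -(m / 2) ≤ Φ (ev x s) →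
          ⟪gradient Φ (ev x s), ev (Ξ x) s⟫ ≤ -(m / 2)) ∧
        -(2 * c0) ≤ ⟪gradient Φ (ev x 0), ev (Ξ x) 0⟫ ∧
        -(2 * c0) ≤ ⟪gradient Φ (ev x 1), ev (Ξ x) 1⟫) := by
  let T : XX Φ → Set (EE n) := fun x => {ξ | ‖ξ‖ ≤ 1 / m ∧
      (|Jf G x.1 - c| ≤ m / 2 → dJf G x.1 ξ ≤ -(1 / 2) ∧
        (∀ s ∈ Icc (0:ℝ) 1, -(m / 2) ≤ Φ (ev x.1 s) →
          ⟪gradient Φ (ev x.1 s), ev ξ s⟫ ≤ -(m / 2)) ∧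
        -(2 * c0) ≤ ⟪gradient Φ (ev x.1 0), ev ξ 0⟫ ∧
        -(2 * c0) ≤ ⟪gradient Φ (ev x.1 1), ev ξ 1⟫)}
  have hconv : ∀ x, Convex ℝ (T x) := by
    rintro x ξ ⟨a1, a2⟩ ζ ⟨b1, b2⟩ a b ha hb hab
    refine ⟨?_, fun hJ => ?_⟩
    · calc ‖a • ξ + b • ζ‖ ≤ a * ‖ξ‖ + b * ‖ζ‖ := by
            refine (norm_add_le _ _).trans ?_
            rw [norm_smul, norm_smul, Real.norm_of_nonneg ha, Real.norm_of_nonneg hb]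
        _ ≤ a * (1 / m) + b * (1 / m) := by gcongr
        _ = 1 / m := by rw [← add_mul, hab, one_mul]
    · obtain ⟨p1, p2, p3, p4⟩ := a2 hJ
      obtain ⟨q1, q2, q3, q4⟩ := b2 hJ
      have hin : ∀ s, ⟪gradient Φ (ev x.1 s), ev (a • ξ + b • ζ) s⟫ =
          a * ⟪gradient Φ (ev x.1 s), ev ξ s⟫ + b * ⟪gradient Φ (ev x.1 s), ev ζ s⟫ := by
        intro s
        rw [ev_add, ev_smul, ev_smul, inner_add_right, real_inner_smul_right,
          real_inner_smul_right]
      refine ⟨?_, fun s hs hh => ?_, ?_, ?_⟩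
      · rw [dJf_add hG, dJf_smul, dJf_smul]
        have hb' : b = 1 - a := by linarith
        subst hb'; nlinarith
      · rw [hin]
        have := p2 s hs hh
        have := q2 s hs hh
        have hb' : b = 1 - a := by linarith
        subst hb'; nlinarith
      · rw [hin]
        have hb' : b = 1 - a := by linarith
        subst hb'; nlinarith
      · rw [hin]
        have hb' : b = 1 - a := by linarith
        subst hb'; nlinarith
  have hloc : ∀ x : XX Φ, ∃ ξ : EE n, ∀ᶠ y in 𝓝 x, ξ ∈ T y := by
    intro x
    have hJc : Continuous fun y : XX Φ => |Jf G y.1 - c| :=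
      (((Jf_cont hG).comp continuous_subtype_val).sub continuous_const).abs
    by_cases hx : |Jf G x.1 - c| < m
    · obtain ⟨ξ, g1, g2, g3, g4, g5⟩ := hgood x.1 x.2 hx
      refine ⟨ξ, ?_⟩
      have := good_nhds (A := -(1/2)) (c0 := 2 * c0) hG hΦ hm (by linarith) g3
        (by linarith) (by linarith)
      have h2 := continuous_subtype_val.continuousAt (x := x) this
      filter_upwards [h2] with y hy
      exact ⟨g1, fun _ => ⟨hy.1.le, hy.2.1, hy.2.2.1.le, hy.2.2.2.le⟩⟩
    · refine ⟨0, ?_⟩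
      have : ∀ᶠ y in 𝓝 x, m / 2 < |Jf G y.1 - c| :=
        continuousAt_const.eventually_lt hJc.continuousAt (by push Not at hx; linarith)
      filter_upwards [this] with y hy
      exact ⟨by rw [norm_zero]; positivity, fun h => absurd h (not_le.2 hy)⟩
  obtain ⟨g, hg⟩ := exists_continuous_forall_mem_convex_of_local_const hconv hloc
  classical
  refine ⟨fun x => if h : x ∈ XX Φ then g ⟨x, h⟩ else 0, ?_, fun x hx => ?_⟩
  · rw [continuousOn_iff_continuous_domRestrict]
    convert g.continuous using 1
    ext1 x
    simp [x.2]
  · have := hg ⟨x, hx⟩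
    simp only [hx, dif_pos]
    exact this

/-- The symmetrized descent field. -/
theorem field_sym (hG : IsFinslerEnergy n G ℓ α) (hΦ : IsRegularDomain n Φ δ₀) {c c0 m : ℝ}
    (hc0 : 0 < c0) (hm : 0 < m)
    (hgood : ∀ x ∈ XX Φ, |Jf G x - c| < m → ∃ ξ, Good G Φ c0 m x ξ) :
    ∃ Ξ : EE n → EE n, ContinuousOn Ξ (XX Φ) ∧ (∀ x ∈ XX Φ, ‖Ξ x‖ ≤ 2 / m ∧
      (|Jf G x - c| ≤ m / 2 → dJf G x (Ξ x) ≤ -(1 / 2) ∧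
        (∀ s ∈ Icc (0:ℝ) 1, -(m / 2) ≤ Φ (ev x s) →
          ⟪gradient Φ (ev x s), ev (Ξ x) s⟫ ≤ -(m / 2)) ∧
        -(2 * c0) ≤ ⟪gradient Φ (ev x 0), ev (Ξ x) 0⟫ ∧
        -(2 * c0) ≤ ⟪gradient Φ (ev x 1), ev (Ξ x) 1⟫)) ∧
      ((∀ q v : Evec n, G q (-v) = G q v) → ∀ x ∈ XX Φ, ∀ s,
        ev (Ξ (rev x)) s = ev (Ξ x) (1 - s)) := by
  obtain ⟨Ξ, hc, hp⟩ := field hG hΦ hc0 hm hgood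
  by_cases hr : ∀ q v : Evec n, G q (-v) = G q v
  swap
  · exact ⟨Ξ, hc, fun x hx => ⟨(hp x hx).1.trans (by gcongr; norm_num), (hp x hx).2⟩,
      fun h => absurd h hr⟩
  refine ⟨fun x => (1 / 2 : ℝ) • (Ξ x + rev (Ξ (rev x))), ?_, fun x hx => ⟨?_, fun hJ => ?_⟩, ?_⟩
  · refine ContinuousOn.const_smul (hc.add (rev_cont.comp_continuousOn ?_)) (1 / 2 : ℝ)
    exact hc.comp rev_cont.continuousOn fun x hx => rev_XX hx
  · have h1 := (hp x hx).1
    have h2 := (hp _ (rev_XX hx)).1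
    have h3 := rev_norm (Ξ (rev x))
    rw [norm_smul, Real.norm_of_nonneg (by norm_num)]
    have := norm_add_le (Ξ x) (rev (Ξ (rev x)))
    have e : 2 / m = 2 * (1 / m) := by ring
    have e' : 0 < 1 / m := by positivity
    rw [e]; linarith
  · obtain ⟨p1, p2, p3, p4⟩ := (hp x hx).2 hJ
    obtain ⟨q1, q2, q3, q4⟩ := (hp _ (rev_XX hx)).2 (by rwa [Jf_rev hr])
    have hin : ∀ s, ⟪gradient Φ (ev x s), ev ((1 / 2 : ℝ) • (Ξ x + rev (Ξ (rev x)))) s⟫ =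
        1 / 2 * (⟪gradient Φ (ev x s), ev (Ξ x) s⟫ +
          ⟪gradient Φ (ev (rev x) (1 - s)), ev (Ξ (rev x)) (1 - s)⟫) := by
      intro s
      rw [ev_smul, ev_add, real_inner_smul_right, inner_add_right, ev_rev, ev_rev, sub_sub_cancel]
    have hq1 : dJf G x (rev (Ξ (rev x))) ≤ -(1 / 2) := by
      rw [← dJf_rev hr, rev_rev]; exact q1
    refine ⟨?_, fun s hs hh => ?_, ?_, ?_⟩
    · rw [dJf_smul, dJf_add hG]; linarith
    · rw [hin]
      have := p2 s hs hh
      have := q2 (1 - s) ⟨by linarith [hs.2], by linarith [hs.1]⟩ (by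
        rw [ev_rev, sub_sub_cancel]; exact hh)
      linarith
    · rw [hin, sub_zero]; linarith
    · rw [hin, sub_self]; linarith
  · intro _ x hx s
    simp only [ev_smul, ev_add, ev_rev, rev_rev, sub_sub_cancel]
    rw [add_comm]

end FD
end

noncomputable section
open MeasureTheory Set Filter RealInnerProductSpace Topology
namespace FD
variable {n : ℕ} {G : Evec n → Evec n → ℝ} {ℓ α : ℝ} {Φ : Evec n → ℝ} {δ₀ : ℝ}

/-- The speed of the compressed parametrization. -/
def kk (θ : ℝ) : ℝ := (max (1 - 2 * θ) (1 / 2))⁻¹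

theorem kk_pos (θ : ℝ) : 0 < kk θ := inv_pos.2 (lt_max_of_lt_right (by norm_num))

theorem kk_le (θ : ℝ) : kk θ ≤ 2 := by
  have := inv_anti₀ (by norm_num) (le_max_right (1 - 2 * θ) (1 / 2 : ℝ))
  unfold kk; linarith

theorem kk_cont : Continuous kk := by
  unfold kk
  refine Continuous.inv₀ (by fun_prop) fun θ => ?_
  exact (lt_max_of_lt_right (by norm_num)).ne'

theorem kk_mul {θ : ℝ} (h : θ ≤ 1 / 4) : kk θ * (1 - 2 * θ) = 1 := by
  unfold kk; rw [max_eq_left (by linarith)]; exact inv_mul_cancel₀ (by linarith)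

theorem kk_zero : kk 0 = 1 := by have := kk_mul (θ := 0) (by norm_num); simpa using this

theorem aff_integrable {F : Type*} [NormedAddCommGroup F] {f : ℝ → F} (hf : Integrable f)
    {k : ℝ} (hk : 0 < k) (θ : ℝ) : Integrable fun s => f (k * (s - θ)) :=
  (hf.comp_mul_left' hk.ne').comp_sub_right θ

theorem aff_integral {F : Type*} [NormedAddCommGroup F] [NormedSpace ℝ F] (f : ℝ → F)
    {k : ℝ} (hk : 0 < k) (θ : ℝ) : ∫ s, f (k * (s - θ)) = k⁻¹ • ∫ s, f s := by
  rw [integral_sub_right_eq_self (fun s => f (k * s)) θ, Measure.integral_comp_mul_left,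
    abs_of_pos (inv_pos.2 hk)]

theorem aff_ae {p : ℝ → Prop} (h : ∀ᵐ s : ℝ, p s) {k : ℝ} (hk : 0 < k) (θ : ℝ) :
    ∀ᵐ s : ℝ, p (k * (s - θ)) := by
  have h1 : Measure.QuasiMeasurePreserving (fun s : ℝ => k * s) volume volume := by
    refine ⟨by fun_prop, ?_⟩
    rw [Real.map_volume_mul_left hk.ne']
    exact Measure.smul_absolutelyContinuous
  have h2 := (measurePreserving_sub_right (volume : Measure ℝ) θ).quasiMeasurePreserving
  exact (h1.comp h2).ae h

/-- Square integrable functions on the line. -/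
abbrev LR (n : ℕ) := Lp (Evec n) 2 (volume : Measure ℝ)

theorem LR_sq (F : LR n) : Integrable (fun s => ‖F s‖ ^ 2) :=
  (memLp_two_iff_integrable_sq_norm (Lp.memLp F).1).1 (Lp.memLp F)

theorem LR_norm_sq (F : LR n) : ‖F‖ ^ 2 = ∫ s, ‖F s‖ ^ 2 := by
  rw [← real_inner_self_eq_norm_sq, L2.inner_def]
  simp

theorem aff_aesm {F : Type*} [NormedAddCommGroup F] {f : ℝ → F}
    (hf : AEStronglyMeasurable f volume)
    {k : ℝ} (hk : 0 < k) (θ : ℝ) : AEStronglyMeasurable (fun s => f (k * (s - θ))) volume := by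
  obtain ⟨g, hg, hfg⟩ := hf
  exact ⟨fun s => g (k * (s - θ)), hg.comp_measurable (by fun_prop), aff_ae hfg hk θ⟩

theorem dil_memLp (θ : ℝ) {f : ℝ → Evec n} (hf : MemLp f 2 volume) :
    MemLp (fun s => kk θ • f (kk θ * (s - θ))) 2 μ1 := by
  suffices h : MemLp (fun s => f (kk θ * (s - θ))) 2 volume from
    (h.const_smul (kk θ)).restrict _
  have h1 : Integrable (fun s => ‖f s‖ ^ 2) := (memLp_two_iff_integrable_sq_norm hf.1).1 hf
  rw [memLp_two_iff_integrable_sq_norm (aff_aesm hf.1 (kk_pos θ) θ)]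
  exact aff_integrable h1 (kk_pos θ) θ

/-- Compression of velocities. -/
def dil (θ : ℝ) (F : LR n) : L2 n := (dil_memLp θ (Lp.memLp F)).toLp _

theorem dil_ae (θ : ℝ) (F : LR n) :
    (fun s => dil θ F s) =ᵐ[μ1] fun s => kk θ • F (kk θ * (s - θ)) :=
  (dil_memLp θ (Lp.memLp F)).coeFn_toLp

theorem dil_sub (θ : ℝ) (F H : LR n) : dil θ (F - H) = dil θ F - dil θ H := by
  apply Lp.ext
  have h := ae_restrict_of_ae (s := Ioc (0:ℝ) 1) (aff_ae (Lp.coeFn_sub F H) (kk_pos θ) θ)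
  filter_upwards [dil_ae θ (F - H), dil_ae θ F, dil_ae θ H, Lp.coeFn_sub (dil θ F) (dil θ H), h]
    with s h1 h2 h3 h4 h5
  rw [h1, h4, Pi.sub_apply, h2, h3, h5, Pi.sub_apply, smul_sub]

theorem dil_norm (θ : ℝ) (F : LR n) : ‖dil θ F‖ ≤ 2 * ‖F‖ := by
  refine abs_le_of_sq_le_sq' ?_ (by positivity) |>.2
  rw [L2_norm_sq, mul_pow, LR_norm_sq]
  have hk := kk_pos θ
  have h1 : ∫ s, ‖dil θ F s‖ ^ 2 ∂μ1 = ∫ s, (fun r => kk θ ^ 2 * ‖F r‖ ^ 2) (kk θ * (s - θ)) ∂μ1 := by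
    apply integral_congr_ae
    filter_upwards [dil_ae θ F] with s hs
    rw [hs, norm_smul, Real.norm_of_nonneg hk.le, mul_pow]
  rw [h1]
  have hi : Integrable (fun r => kk θ ^ 2 * ‖F r‖ ^ 2) := (LR_sq F).const_mul _
  calc _ ≤ ∫ s, (fun r => kk θ ^ 2 * ‖F r‖ ^ 2) (kk θ * (s - θ)) :=
        setIntegral_le_integral (aff_integrable hi hk θ)
          (Eventually.of_forall fun s => by positivity)
    _ = kk θ * ∫ s, ‖F s‖ ^ 2 := by
        rw [aff_integral (fun r => kk θ ^ 2 * ‖F r‖ ^ 2) hk θ, integral_const_mul, smul_eq_mul]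
        field_simp
    _ ≤ 2 ^ 2 * ∫ s, ‖F s‖ ^ 2 := by
        gcongr
        linarith [kk_le θ]

theorem L2_le_of_bound {u : L2 n} {ε : ℝ} (hε : 0 ≤ ε) (h : ∀ᵐ s ∂μ1, ‖u s‖ ≤ ε) : ‖u‖ ≤ ε := by
  refine abs_le_of_sq_le_sq' ?_ hε |>.2
  rw [L2_norm_sq]
  calc ∫ s, ‖u s‖ ^ 2 ∂μ1 ≤ ∫ _, ε ^ 2 ∂μ1 := by
        apply integral_mono_ae (L2_int_sq u) (integrable_const _)
        filter_upwards [h] with s hs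
        gcongr
    _ = ε ^ 2 := by simp

theorem dil_cont_left (F : LR n) : Continuous fun θ => dil θ F := by
  rw [continuous_iff_continuousAt]
  intro θ₀
  rw [Metric.continuousAt_iff']
  intro ε hε
  obtain ⟨g, hg, hgm⟩ := (Lp.memLp F).exists_boundedContinuous_eLpNorm_sub_le (p := 2) (by simp)
    (ε := ENNReal.ofReal (ε / 16)) (by simp; positivity)
  set H : LR n := hgm.toLp g with hH
  have hHae : (fun s => H s) =ᵐ[volume] g := hgm.coeFn_toLp
  have hFH : ‖F - H‖ ≤ ε / 16 := by
    rw [Lp.norm_def]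
    apply ENNReal.toReal_le_of_le_ofReal (by positivity)
    refine le_trans (le_of_eq ?_) hg
    apply eLpNorm_congr_ae
    filter_upwards [Lp.coeFn_sub F H, hHae] with s h1 h2
    rw [h1, Pi.sub_apply, h2]; rfl
  have hc : Continuous fun z : ℝ × ℝ => kk z.1 • g (kk z.1 * (z.2 - z.1)) := by
    have := kk_cont
    have := g.continuous
    fun_prop
  have hev : ∀ᶠ θ in 𝓝 θ₀, ∀ s ∈ Icc (0:ℝ) 1,
      ‖kk θ • g (kk θ * (s - θ)) - kk θ₀ • g (kk θ₀ * (s - θ₀))‖ < ε / 4 := by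
    refine isCompact_Icc.eventually_forall_of_forall_eventually fun s hs => ?_
    have hc2 : Continuous fun z : ℝ × ℝ =>
        ‖kk z.1 • g (kk z.1 * (z.2 - z.1)) - kk θ₀ • g (kk θ₀ * (z.2 - θ₀))‖ := by
      have := g.continuous
      refine (hc.sub ?_).norm
      fun_prop
    exact hc2.continuousAt.eventually_lt (x₀ := (θ₀, s)) (continuousAt_const (y := ε / 4))
      (by simp; positivity)
  filter_upwards [hev] with θ hθ
  have e1 : ‖dil θ H - dil θ₀ H‖ ≤ ε / 4 := by
    apply L2_le_of_bound (by positivity)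
    have a1 := ae_restrict_of_ae (s := Ioc (0:ℝ) 1) (aff_ae hHae (kk_pos θ) θ)
    have a2 := ae_restrict_of_ae (s := Ioc (0:ℝ) 1) (aff_ae hHae (kk_pos θ₀) θ₀)
    filter_upwards [Lp.coeFn_sub (dil θ H) (dil θ₀ H), dil_ae θ H, dil_ae θ₀ H, a1, a2,
      ae_restrict_mem measurableSet_Ioc] with s h1 h2 h3 h4 h5 h6
    rw [h1, Pi.sub_apply, h2, h3, h4, h5]
    exact (hθ s ⟨h6.1.le, h6.2⟩).le
  have e2 := dil_norm θ (F - H)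
  have e3 := dil_norm θ₀ (F - H)
  rw [dist_eq_norm]
  have e4 : dil θ F - dil θ₀ F = dil θ (F - H) - dil θ₀ (F - H) + (dil θ H - dil θ₀ H) := by
    rw [dil_sub, dil_sub]; abel
  rw [e4]
  have e5 := norm_add_le (dil θ (F - H) - dil θ₀ (F - H)) (dil θ H - dil θ₀ H)
  have e6 := norm_sub_le (dil θ (F - H)) (dil θ₀ (F - H))
  linarith

theorem ext_memLp (u : L2 n) : MemLp ((Ioc (0:ℝ) 1).indicator fun s => u s) 2 volume :=
  (memLp_indicator_iff_restrict measurableSet_Ioc).2 (L2_memLp u)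

/-- Extension by zero. -/
def extL (u : L2 n) : LR n := (ext_memLp u).toLp _

theorem extL_ae (u : L2 n) :
    (fun s => extL u s) =ᵐ[volume] (Ioc (0:ℝ) 1).indicator fun s => u s :=
  (ext_memLp u).coeFn_toLp

theorem extL_norm (u : L2 n) : ‖extL u‖ = ‖u‖ := by
  rw [← sq_eq_sq₀ (norm_nonneg _) (norm_nonneg _), LR_norm_sq, L2_norm_sq,
    ← integral_indicator measurableSet_Ioc]
  apply integral_congr_ae
  filter_upwards [extL_ae u] with s hs
  rw [hs]
  by_cases h : s ∈ Ioc (0:ℝ) 1 <;> simp [h]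

theorem extL_sub (u v : L2 n) : extL (u - v) = extL u - extL v := by
  apply Lp.ext
  have h := (ae_restrict_iff' measurableSet_Ioc).1 (Lp.coeFn_sub u v)
  filter_upwards [extL_ae (u - v), extL_ae u, extL_ae v, Lp.coeFn_sub (extL u) (extL v), h]
    with s h1 h2 h3 h4 h5
  rw [h1, h4, Pi.sub_apply, h2, h3]
  by_cases h : s ∈ Ioc (0:ℝ) 1
  · simp only [indicator_of_mem h]; rw [h5 h]; rfl
  · simp [h]

/-- The compressed curve, constant near the ends. -/
def dilE (θ : ℝ) (y : EE n) : EE n := (y.1, dil θ (extL y.2))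

theorem dilE_cont : Continuous fun z : ℝ × EE n => dilE z.1 z.2 := by
  refine (continuous_snd.fst).prodMk ?_
  rw [continuous_iff_continuousAt]
  rintro ⟨θ₀, y₀⟩
  rw [Metric.continuousAt_iff']
  intro ε hε
  have h1 := Metric.continuousAt_iff'.1 ((dil_cont_left (extL y₀.2)).continuousAt (x := θ₀)) (ε / 2)
    (by positivity)
  have h1' := (continuous_fst (X := ℝ) (Y := EE n)).continuousAt (x := (θ₀, y₀)) h1
  have h2 : ∀ᶠ z : ℝ × EE n in 𝓝 (θ₀, y₀), 2 * ‖z.2.2 - y₀.2‖ < ε / 2 := by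
    have hc : Continuous fun z : ℝ × EE n => 2 * ‖z.2.2 - y₀.2‖ := by fun_prop
    exact hc.continuousAt.eventually_lt (continuousAt_const (y := ε / 2)) (by simp; positivity)
  filter_upwards [h1', h2] with z hz1 hz2
  have hz1 : dist (dil z.1 (extL y₀.2)) (dil θ₀ (extL y₀.2)) < ε / 2 := hz1
  have hz3 : dist (dil z.1 (extL z.2.2)) (dil z.1 (extL y₀.2)) < ε / 2 := by
    rw [dist_eq_norm, ← dil_sub, ← extL_sub]
    refine lt_of_le_of_lt (dil_norm _ _) ?_
    rwa [extL_norm]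
  have := dist_triangle (dil z.1 (extL z.2.2)) (dil z.1 (extL y₀.2)) (dil θ₀ (extL y₀.2))
  change dist (dil z.1 (extL z.2.2)) (dil θ₀ (extL y₀.2)) < ε
  linarith

theorem dil_ext_ae (θ : ℝ) (u : L2 n) : (fun s => dil θ (extL u) s) =ᵐ[μ1]
    fun s => kk θ • (Ioc (0:ℝ) 1).indicator (fun r => u r) (kk θ * (s - θ)) := by
  have a1 := ae_restrict_of_ae (s := Ioc (0:ℝ) 1) (aff_ae (extL_ae u) (kk_pos θ) θ)
  filter_upwards [dil_ae θ (extL u), a1] with s h1 h2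
  rw [h1, h2]

theorem aff_mem {θ : ℝ} (h1 : θ ≤ 1 / 4) (s : ℝ) :
    kk θ * (s - θ) ∈ Ioc (0:ℝ) 1 ↔ s ∈ Ioc θ (1 - θ) := by
  have hk := kk_pos θ
  have hm := kk_mul h1
  simp only [mem_Ioc]
  constructor
  · rintro ⟨a, b⟩
    refine ⟨by_contra fun hh => ?_, by_contra fun hh => ?_⟩
    · nlinarith
    · nlinarith
  · rintro ⟨a, b⟩
    exact ⟨mul_pos hk (by linarith), by nlinarith⟩

/-- Change of variables for functions supported in the unit interval. -/
theorem aff_int01 {F : Type*} [NormedAddCommGroup F] [NormedSpace ℝ F] (f : ℝ → F)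
    {θ : ℝ} (h0 : 0 ≤ θ) (h1 : θ ≤ 1 / 4) :
    ∫ s, (Ioc (0:ℝ) 1).indicator f (kk θ * (s - θ)) ∂μ1 = (kk θ)⁻¹ • ∫ s, f s ∂μ1 := by
  rw [← integral_indicator measurableSet_Ioc]
  have : (Ioc (0:ℝ) 1).indicator (fun s => (Ioc (0:ℝ) 1).indicator f (kk θ * (s - θ))) =
      fun s => (Ioc (0:ℝ) 1).indicator f (kk θ * (s - θ)) := by
    ext s
    by_cases h : s ∈ Ioc (0:ℝ) 1
    · rw [indicator_of_mem h]
    · rw [indicator_of_notMem h, indicator_of_notMem]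
      rw [aff_mem h1]
      intro hh; exact h ⟨by linarith [hh.1], by linarith [hh.2]⟩
  rw [this, aff_integral _ (kk_pos θ), integral_indicator measurableSet_Ioc]

theorem ev_dilE {θ : ℝ} (h0 : 0 ≤ θ) (h1 : θ ≤ 1 / 4) (y : EE n) (s : ℝ) :
    ev (dilE θ y) s = ev y (kk θ * (s - θ)) := by
  unfold ev
  change y.1 + _ = y.1 + _
  congr 1
  change ∫ r in Iic s, dil θ (extL y.2) r ∂μ1 = _
  have hk := kk_pos θ
  rw [← integral_indicator measurableSet_Iic, ← integral_indicator measurableSet_Iic]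
  have e : ∫ r, (Iic s).indicator (fun r => dil θ (extL y.2) r) r ∂μ1 =
      ∫ r, (Ioc (0:ℝ) 1).indicator
        (fun q => kk θ • (Iic (kk θ * (s - θ))).indicator (fun q => y.2 q) q)
        (kk θ * (r - θ)) ∂μ1 := by
    apply integral_congr_ae
    filter_upwards [dil_ext_ae θ y.2] with r hr
    have hiff : kk θ * (r - θ) ∈ Iic (kk θ * (s - θ)) ↔ r ∈ Iic s := by
      simp only [mem_Iic]
      rw [mul_le_mul_iff_right₀ hk]; constructor <;> intro <;> linarith
    by_cases hrs : r ∈ Iic s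
    · rw [indicator_of_mem hrs, hr]
      by_cases hm : kk θ * (r - θ) ∈ Ioc (0:ℝ) 1
      · rw [indicator_of_mem hm, indicator_of_mem hm, indicator_of_mem (hiff.2 hrs)]
      · rw [indicator_of_notMem hm, indicator_of_notMem hm, smul_zero]
    · rw [indicator_of_notMem hrs]
      by_cases hm : kk θ * (r - θ) ∈ Ioc (0:ℝ) 1
      · rw [indicator_of_mem hm, indicator_of_notMem (fun h => hrs (hiff.1 h)), smul_zero]
      · rw [indicator_of_notMem hm]
  rw [e, aff_int01 _ h0 h1, integral_smul, smul_smul, inv_mul_cancel₀ hk.ne', one_smul]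

theorem dilE_zero (y : EE n) : dilE 0 y = y := by
  refine Prod.ext rfl (Lp.ext ?_)
  change (fun s => dil 0 (extL y.2) s) =ᵐ[μ1] fun s => y.2 s
  filter_upwards [dil_ext_ae 0 y.2, ae_restrict_mem measurableSet_Ioc] with s h1 h2
  rw [h1, kk_zero]; simp [h2.1, h2.2]

end FD
end

noncomputable section
open MeasureTheory Set Filter RealInnerProductSpace Topology
namespace FD
variable {n : ℕ} {G : Evec n → Evec n → ℝ} {ℓ α : ℝ} {Φ : Evec n → ℝ} {δ₀ : ℝ}

/-- Indicator of an initial interval times a vector. -/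
def ind0 (θ : ℝ) (e : Evec n) : L2 n :=
  indicatorConstLp 2 (μ := μ1) (measurableSet_Ioc (a := (0:ℝ)) (b := θ)) (measure_ne_top _ _) e

theorem ind0_ae (θ : ℝ) (e : Evec n) :
    (fun s => ind0 θ e s) =ᵐ[μ1] (Ioc (0:ℝ) θ).indicator fun _ => e := indicatorConstLp_coeFn

theorem ind0_sub (θ : ℝ) (e f : Evec n) : ind0 θ (e - f) = ind0 θ e - ind0 θ f := by
  unfold ind0; rw [indicatorConstLp_sub]

theorem mu_Ioc {a b : ℝ} (h0 : 0 ≤ a) (h1 : b ≤ 1) : μ1.real (Ioc a b) = max (b - a) 0 := by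
  rw [Measure.real, Measure.restrict_apply measurableSet_Ioc, inter_eq_left.2
    (Ioc_subset_Ioc h0 h1), Real.volume_Ioc, ENNReal.toReal_ofReal']

theorem ind0_sq (θ : ℝ) (h1 : 0 ≤ θ) (h : θ ≤ 1) (e : Evec n) :
    ‖ind0 θ e‖ ^ 2 = θ * ‖e‖ ^ 2 := by
  rw [L2_norm_sq]
  have : ∫ s, ‖ind0 θ e s‖ ^ 2 ∂μ1 = ∫ s, (Ioc (0:ℝ) θ).indicator (fun _ => ‖e‖ ^ 2) s ∂μ1 := by
    apply integral_congr_ae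
    filter_upwards [ind0_ae θ e] with s hs
    rw [hs]
    by_cases hh : s ∈ Ioc (0:ℝ) θ
    · simp [indicator_of_mem hh]
    · simp [indicator_of_notMem hh]
  rw [this, integral_indicator measurableSet_Ioc]
  simp only [integral_const, smul_eq_mul, measureReal_restrict_apply_univ]
  rw [mu_Ioc le_rfl h, sub_zero, max_eq_left h1]

theorem ind0_le (θ : ℝ) (e : Evec n) : ‖ind0 θ e‖ ≤ ‖e‖ := by
  apply L2_le_of_bound (norm_nonneg _)
  filter_upwards [ind0_ae θ e] with s hs
  rw [hs]; exact norm_indicator_le_norm_self _ _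

theorem ind0_cont_left (e : Evec n) : Continuous fun θ => ind0 θ e := by
  refine continuous_indicatorConstLp_set (by simp) fun θ => ?_
  have hb : ∀ θ', μ1 (symmDiff (Ioc 0 θ') (Ioc 0 θ)) ≤ ENNReal.ofReal |θ - θ'| := by
    intro θ'
    refine (Measure.restrict_apply_le _ _).trans ?_
    have : symmDiff (Ioc 0 θ') (Ioc 0 θ) ⊆ Ioc (min θ' θ) (max θ' θ) := by
      intro s hs
      rcases hs with ⟨⟨a, b⟩, d⟩ | ⟨⟨a, b⟩, d⟩
      · have : θ < s := by by_contra h; exact d ⟨a, not_lt.1 h⟩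
        exact ⟨min_lt_of_right_lt this, le_max_of_le_left b⟩
      · have : θ' < s := by by_contra h; exact d ⟨a, not_lt.1 h⟩
        exact ⟨min_lt_of_left_lt this, le_max_of_le_right b⟩
    refine (measure_mono this).trans ?_
    rw [Real.volume_Ioc, max_sub_min_eq_abs]
  refine tendsto_of_tendsto_of_tendsto_of_le_of_le tendsto_const_nhds ?_ (fun _ => bot_le) hb
  have hc : Continuous fun θ' : ℝ => ENNReal.ofReal |θ - θ'| :=
    ENNReal.continuous_ofReal.comp (by fun_prop)
  simpa using hc.tendsto θ

theorem ind0_cont : Continuous fun z : ℝ × Evec n => ind0 z.1 z.2 := by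
  rw [continuous_iff_continuousAt]
  rintro ⟨θ₀, y₀⟩
  rw [Metric.continuousAt_iff']
  intro ε hε
  have h1 := Metric.continuousAt_iff'.1 ((ind0_cont_left y₀).continuousAt (x := θ₀)) (ε / 2)
    (by positivity)
  have h1' := (continuous_fst (X := ℝ) (Y := Evec n)).continuousAt (x := (θ₀, y₀)) h1
  have h2 : ∀ᶠ z : ℝ × Evec n in 𝓝 (θ₀, y₀), ‖z.2 - y₀‖ < ε / 2 := by
    have hc : Continuous fun z : ℝ × Evec n => ‖z.2 - y₀‖ := by fun_prop
    exact hc.continuousAt.eventually_lt (continuousAt_const (y := ε / 2)) (by simp; positivity)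
  filter_upwards [h1', h2] with z hz1 hz2
  have hz1 : dist (ind0 z.1 y₀) (ind0 θ₀ y₀) < ε / 2 := hz1
  have hz3 : dist (ind0 z.1 z.2) (ind0 z.1 y₀) < ε / 2 := by
    rw [dist_eq_norm, ← ind0_sub]
    exact lt_of_le_of_lt (ind0_le _ _) hz2
  have := dist_triangle (ind0 z.1 z.2) (ind0 z.1 y₀) (ind0 θ₀ y₀)
  change dist (ind0 z.1 z.2) (ind0 θ₀ y₀) < ε
  linarith

/-- A short segment from `e` to the origin. -/
def tail (θ : ℝ) (e : Evec n) : EE n := (e, -(θ⁻¹ • ind0 θ e))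

/-- Profile of the segment. -/
def psi (θ s : ℝ) : ℝ := 1 - max 0 (min s θ) / θ

theorem tail_ae (θ : ℝ) (e : Evec n) :
    (fun s => (tail θ e).2 s) =ᵐ[μ1] fun s => -(θ⁻¹ • (Ioc (0:ℝ) θ).indicator (fun _ => e) s) := by
  filter_upwards [Lp.coeFn_neg (θ⁻¹ • ind0 θ e), Lp.coeFn_smul θ⁻¹ (ind0 θ e), ind0_ae θ e]
    with s h1 h2 h3
  change (-(θ⁻¹ • ind0 θ e) : L2 n) s = _
  rw [h1, Pi.neg_apply, h2, Pi.smul_apply, h3]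

theorem ev_tail {θ : ℝ} (h1 : θ ≤ 1) (e : Evec n) (s : ℝ) :
    ev (tail θ e) s = psi θ s • e := by
  unfold ev
  rw [integral_congr_ae (ae_restrict_of_ae (tail_ae θ e)), integral_neg, integral_smul,
    integral_indicator measurableSet_Ioc, Measure.restrict_restrict measurableSet_Ioc]
  have : Ioc 0 θ ∩ Iic s = Ioc 0 (min s θ) := by
    ext r; simp only [mem_inter_iff, mem_Ioc, mem_Iic, le_min_iff]; tauto
  rw [this]
  simp only [integral_const, measureReal_restrict_apply_univ]
  rw [mu_Ioc le_rfl ((min_le_right _ _).trans h1), sub_zero, smul_smul]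
  unfold psi
  change e + _ = _
  rw [sub_smul, one_smul, div_eq_inv_mul, max_comm]
  abel

theorem psi_zero {θ s : ℝ} (h0 : 0 < θ) (h : θ ≤ s) : psi θ s = 0 := by
  unfold psi; rw [min_eq_right h, max_eq_right h0.le, div_self h0.ne', sub_self]

theorem psi_one {θ s : ℝ} (h : s ≤ 0) : psi θ s = 1 := by
  unfold psi; rw [max_eq_left ((min_le_left _ _).trans h)]; simp

theorem psi_mem {θ : ℝ} (h0 : 0 < θ) (s : ℝ) : psi θ s ∈ Icc (0:ℝ) 1 := by
  unfold psi
  have h1 : 0 ≤ max 0 (min s θ) / θ := by positivity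
  have h2 : max 0 (min s θ) / θ ≤ 1 := by
    rw [div_le_one h0]; exact max_le h0.le (min_le_right _ _)
  exact ⟨by linarith, by linarith⟩

theorem tail_zero (θ : ℝ) : tail θ (0 : Evec n) = 0 := by
  unfold tail
  have : ind0 θ (0 : Evec n) = 0 := by have := ind0_sub θ (0 : Evec n) 0; simpa using this
  rw [this]; simp

theorem tail_norm_sq {θ : ℝ} (h0 : 0 < θ) (h1 : θ ≤ 1) (e : Evec n) :
    ‖tail θ e‖ ^ 2 ≤ ‖e‖ ^ 2 / θ := by
  have h2 : ‖(tail θ e).2‖ ^ 2 = ‖e‖ ^ 2 / θ := by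
    unfold tail
    rw [norm_neg, norm_smul, mul_pow, ind0_sq θ h0.le h1, norm_inv, Real.norm_of_nonneg h0.le]
    field_simp
  rw [Prod.norm_def]
  rcases max_cases ‖(tail θ e).1‖ ‖(tail θ e).2‖ with h | h
  · rw [h.1]; change ‖e‖ ^ 2 ≤ _
    rw [le_div_iff₀ h0]; nlinarith [sq_nonneg ‖e‖]
  · rw [h.1, h2]

theorem tail_cont : ContinuousOn (fun z : ℝ × Evec n => tail z.1 z.2) {z | z.1 ≠ 0} := by
  have h1 : ContinuousOn (fun z : ℝ × Evec n => z.1⁻¹) {z | z.1 ≠ 0} :=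
    continuous_fst.continuousOn.inv₀ fun z hz => hz
  have h2 : ContinuousOn (fun z : ℝ × Evec n => ind0 z.1 z.2) {z | z.1 ≠ 0} :=
    ind0_cont.continuousOn
  have h3 := (h1.smul h2).neg
  exact continuous_snd.continuousOn.prodMk h3

/-- Compress a curve and attach short segments at both ends. -/
def conc (θ : ℝ) (y : EE n) (a b : Evec n) : EE n := dilE θ y + tail θ a + rev (tail θ b)

theorem ev_conc {θ : ℝ} (h0 : 0 ≤ θ) (h1 : θ ≤ 1 / 4) (y : EE n) (a b : Evec n) (s : ℝ) :
    ev (conc θ y a b) s = ev y (kk θ * (s - θ)) + psi θ s • a + psi θ (1 - s) • b := by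
  unfold conc
  rw [ev_add, ev_add, ev_dilE h0 h1, ev_tail (by linarith), ev_rev, ev_tail (by linarith)]

theorem rev_zero : rev (0 : EE n) = 0 := by
  have := rev_sub (0 : EE n) 0; simpa using this

theorem conc_zero (y : EE n) : conc 0 y 0 0 = y := by
  unfold conc; rw [dilE_zero, tail_zero, rev_zero]; simp

theorem conc_ae (θ : ℝ) (y : EE n) (a b : Evec n) : (fun s => (conc θ y a b).2 s) =ᵐ[μ1]
    fun s => kk θ • (Ioc (0:ℝ) 1).indicator (fun r => y.2 r) (kk θ * (s - θ)) +
      -(θ⁻¹ • (Ioc (0:ℝ) θ).indicator (fun _ => a) s) +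
      (θ⁻¹ • (Ioc (0:ℝ) θ).indicator (fun _ => b) (1 - s)) := by
  have h := mp_rev.quasiMeasurePreserving.ae (tail_ae θ b)
  filter_upwards [snd_add (dilE θ y + tail θ a) (rev (tail θ b)), snd_add (dilE θ y) (tail θ a),
    dil_ext_ae θ y.2, tail_ae θ a, revL_ae (tail θ b).2, h] with s h1 h2 h3 h4 h5 h6
  change (dilE θ y + tail θ a + rev (tail θ b)).2 s = _
  rw [h1, h2]
  change dil θ (extL y.2) s + (tail θ a).2 s + revL (tail θ b).2 s = _
  rw [h3, h4, h5, h6, neg_neg]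

theorem conc_cases {θ : ℝ} (h0 : 0 < θ) (h1 : θ ≤ 1 / 4) (y : EE n) (a b : Evec n) :
    ∀ᵐ s ∂μ1, (s ∈ Ioc 0 θ ∧ (conc θ y a b).2 s = -(θ⁻¹ • a)) ∨
      (s ∈ Ioo θ (1 - θ) ∧ (conc θ y a b).2 s = kk θ • y.2 (kk θ * (s - θ)) ∧
        ev (conc θ y a b) s = ev y (kk θ * (s - θ))) ∨
      (s ∈ Ioo (1 - θ) 1 ∧ (conc θ y a b).2 s = θ⁻¹ • b) := by
  have hn : ∀ r : ℝ, ∀ᵐ s ∂μ1, s ≠ r := fun r => ae_restrict_of_ae (Measure.ae_ne volume r)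
  filter_upwards [conc_ae θ y a b, ae_restrict_mem measurableSet_Ioc, hn 1, hn (1 - θ)]
    with s hs hs1 hs2 hs3
  have hs4 := lt_of_le_of_ne hs1.2 hs2
  rcases le_or_gt s θ with h | h
  · left
    refine ⟨⟨hs1.1, h⟩, ?_⟩
    have hm : s ∈ Ioc (0:ℝ) θ := ⟨hs1.1, h⟩
    rw [hs, indicator_of_notMem (s := Ioc (0:ℝ) 1), indicator_of_mem hm,
      indicator_of_notMem (s := Ioc (0:ℝ) θ)]
    · simp
    · intro hh; linarith [hh.2]
    · rw [aff_mem h1]; intro hh; linarith [hh.1]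
  · right
    rcases lt_or_gt_of_ne hs3 with h' | h'
    · left
      refine ⟨⟨h, h'⟩, ?_, ?_⟩
      · rw [hs, indicator_of_mem (s := Ioc (0:ℝ) 1) ((aff_mem h1 s).2 ⟨h, h'.le⟩),
          indicator_of_notMem (s := Ioc (0:ℝ) θ), indicator_of_notMem (s := Ioc (0:ℝ) θ)]
        · simp
        · intro hh; linarith [hh.2]
        · intro hh; linarith [hh.2]
      · rw [ev_conc h0.le h1, psi_zero h0 h.le, psi_zero h0 (by linarith)]; simp
    · right
      refine ⟨⟨h', hs4⟩, ?_⟩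
      rw [hs, indicator_of_notMem (s := Ioc (0:ℝ) 1), indicator_of_notMem (s := Ioc (0:ℝ) θ),
        indicator_of_mem (s := Ioc (0:ℝ) θ)]
      · simp
      · exact ⟨by linarith, by linarith⟩
      · intro hh; linarith [hh.2]
      · rw [aff_mem h1]; intro hh; linarith [hh.2]

theorem conc_energy (hG : IsFinslerEnergy n G ℓ α) {θ : ℝ} (h0 : 0 < θ) (h1 : θ ≤ 1 / 4)
    (y : EE n) (a b : Evec n) :
    kk θ * Jf G y ≤ Jf G (conc θ y a b) ∧
    Jf G (conc θ y a b) ≤ kk θ * Jf G y + 1 / 2 * (ℓ * (‖a‖ ^ 2 + ‖b‖ ^ 2) / θ) := by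
  have hk := kk_pos θ
  have hl := hG.one_le_ell
  set g : ℝ → ℝ := fun r => G (ev y r) (y.2 r) with hg
  have hgi : Integrable g μ1 := int_G hG y
  set P : ℝ → ℝ := fun s => kk θ ^ 2 * (Ioc (0:ℝ) 1).indicator g (kk θ * (s - θ)) with hP
  have hPi : Integrable P μ1 :=
    ((aff_integrable ((integrable_indicator_iff measurableSet_Ioc).2 hgi) hk θ).restrict).const_mul _
  have hPint : ∫ s, P s ∂μ1 = kk θ * ∫ s, g s ∂μ1 := by
    rw [hP, integral_const_mul, aff_int01 g h0.le h1, smul_eq_mul]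
    field_simp
  set Q : ℝ → ℝ := fun s => (Ioc (0:ℝ) θ).indicator (fun _ => ℓ * (θ⁻¹ * ‖a‖) ^ 2) s +
    (Ioc (1 - θ) 1).indicator (fun _ => ℓ * (θ⁻¹ * ‖b‖) ^ 2) s with hQ
  have hi1 : Integrable (fun s => (Ioc (0:ℝ) θ).indicator (fun _ => ℓ * (θ⁻¹ * ‖a‖) ^ 2) s) μ1 :=
    (integrable_const _).indicator measurableSet_Ioc
  have hi2 : Integrable (fun s => (Ioc (1 - θ) 1).indicator (fun _ => ℓ * (θ⁻¹ * ‖b‖) ^ 2) s) μ1 :=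
    (integrable_const _).indicator measurableSet_Ioc
  have hQi : Integrable Q μ1 := hi1.add hi2
  have hQint : ∫ s, Q s ∂μ1 = ℓ * (‖a‖ ^ 2 + ‖b‖ ^ 2) / θ := by
    rw [hQ, integral_add hi1 hi2, integral_indicator measurableSet_Ioc,
      integral_indicator measurableSet_Ioc]
    simp only [integral_const, smul_eq_mul, measureReal_restrict_apply_univ]
    rw [mu_Ioc le_rfl (by linarith), mu_Ioc (by linarith) le_rfl, sub_zero, sub_sub_cancel,
      max_eq_left h0.le]
    field_simp
  have hpt : ∀ᵐ s ∂μ1, P s ≤ G (ev (conc θ y a b) s) ((conc θ y a b).2 s) ∧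
      G (ev (conc θ y a b) s) ((conc θ y a b).2 s) ≤ P s + Q s := by
    filter_upwards [conc_cases h0 h1 y a b] with s hs
    have hGn := G_nonneg hG (ev (conc θ y a b) s) ((conc θ y a b).2 s)
    have hGu := hG.upper (ev (conc θ y a b) s) ((conc θ y a b).2 s)
    have hQ1 : 0 ≤ (Ioc (0:ℝ) θ).indicator (fun _ => ℓ * (θ⁻¹ * ‖a‖) ^ 2) s :=
      indicator_nonneg (fun _ _ => by positivity) _
    have hQ2 : 0 ≤ (Ioc (1 - θ) 1).indicator (fun _ => ℓ * (θ⁻¹ * ‖b‖) ^ 2) s :=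
      indicator_nonneg (fun _ _ => by positivity) _
    have hti : 0 ≤ θ⁻¹ := by positivity
    rcases hs with ⟨hs, e⟩ | ⟨hs, e, e'⟩ | ⟨hs, e⟩
    · have hP0 : P s = 0 := by
        rw [hP]; simp only
        rw [indicator_of_notMem, mul_zero]
        rw [aff_mem h1]; intro hh; linarith [hh.1, hs.2]
      have hQs : ℓ * (θ⁻¹ * ‖a‖) ^ 2 ≤ Q s := by
        rw [hQ]; simp only; rw [indicator_of_mem hs]; linarith
      rw [e, norm_neg, norm_smul, Real.norm_of_nonneg hti] at hGu
      rw [e] at hGn ⊢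
      rw [hP0]; exact ⟨hGn, by linarith⟩
    · have hP0 : P s = G (ev (conc θ y a b) s) ((conc θ y a b).2 s) := by
        rw [hP]; simp only
        rw [indicator_of_mem ((aff_mem h1 s).2 ⟨hs.1, hs.2.le⟩), e, e', hG.homog _ _ _ hk]
      rw [← hP0]; exact ⟨le_rfl, by rw [hQ]; simp only; linarith⟩
    · have hP0 : P s = 0 := by
        rw [hP]; simp only
        rw [indicator_of_notMem, mul_zero]
        rw [aff_mem h1]; intro hh; linarith [hh.2, hs.1]
      have hQs : ℓ * (θ⁻¹ * ‖b‖) ^ 2 ≤ Q s := by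
        have hm : s ∈ Ioc (1 - θ) 1 := ⟨hs.1, hs.2.le⟩
        rw [hQ]; simp only; rw [indicator_of_mem hm]; linarith
      rw [e, norm_smul, Real.norm_of_nonneg hti] at hGu
      rw [e] at hGn ⊢
      rw [hP0]; exact ⟨hGn, by linarith⟩
  have hci := int_G hG (conc θ y a b)
  have m1 := integral_mono_ae hPi hci (hpt.mono fun s hs => hs.1)
  have m2 := integral_mono_ae hci (hPi.add hQi) (hpt.mono fun s hs => hs.2)
  rw [integral_add' hPi hQi, hPint, hQint] at m2
  rw [hPint] at m1
  unfold Jf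
  constructor <;> linarith

theorem conc_mem {θ : ℝ} (h0 : 0 < θ) (h1 : θ ≤ 1 / 4) {y : EE n}
    {a b : Evec n} (hy : ∀ s ∈ Icc (0:ℝ) 1, Φ (ev y s) ≤ 0)
    (ha : Φ (ev y 0 + a) = 0) (hb : Φ (ev y 1 + b) = 0)
    (ha' : ∀ r ∈ Icc (0:ℝ) 1, Φ (ev y 0 + r • a) ≤ 0)
    (hb' : ∀ r ∈ Icc (0:ℝ) 1, Φ (ev y 1 + r • b) ≤ 0) : conc θ y a b ∈ XX Φ := by
  have hk := kk_pos θ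
  have hm := kk_mul h1
  have e0 : ∀ s ≤ θ, ev (conc θ y a b) s = ev y 0 + psi θ s • a := by
    intro s hs
    rw [ev_conc h0.le h1, psi_zero h0 (s := 1 - s) (by linarith),
      ev_nonpos y (s := kk θ * (s - θ)) (by nlinarith), ev_nonpos y le_rfl]; simp
  have e1 : ∀ s, 1 - θ ≤ s → ev (conc θ y a b) s = ev y 1 + psi θ (1 - s) • b := by
    intro s hs
    rw [ev_conc h0.le h1, psi_zero h0 (s := s) (by linarith),
      ev_ge_one y (s := kk θ * (s - θ)) (by nlinarith)]; simp
  refine ⟨fun s hs => ?_, ?_, ?_⟩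
  · rcases le_total s θ with h | h
    · rw [e0 s h]; exact ha' _ (psi_mem h0 s)
    · rcases le_total s (1 - θ) with h' | h'
      · rw [ev_conc h0.le h1, psi_zero h0 h, psi_zero h0 (by linarith)]
        simp only [zero_smul, add_zero]
        exact hy _ ⟨mul_nonneg hk.le (by linarith), by nlinarith⟩
      · rw [e1 s h']; exact hb' _ (psi_mem h0 _)
  · rw [e0 0 h0.le, psi_one le_rfl, one_smul]; exact ha
  · rw [e1 1 (by linarith), psi_one (by simp), one_smul]; exact hb

end FD
end

noncomputable section
open MeasureTheory Set Filter RealInnerProductSpace Topology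
namespace FD
variable {n : ℕ} {G : Evec n → Evec n → ℝ} {ℓ α : ℝ} {Φ : Evec n → ℝ} {δ₀ : ℝ}

theorem kk_le' {θ : ℝ} (h0 : 0 ≤ θ) (h1 : θ ≤ 1 / 4) : kk θ ≤ 1 + 4 * θ := by
  have h2 := kk_mul h1
  have hk := kk_pos θ
  have h3 : 1 ≤ (1 + 4 * θ) * (1 - 2 * θ) := by nlinarith
  have h4 : kk θ * (1 - 2 * θ) ≤ (1 + 4 * θ) * (1 - 2 * θ) := by linarith
  exact le_of_mul_le_mul_right h4 (by linarith)

/-- The deformed curve after time `t`. -/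
def stepE (e : Evec n → Evec n) (Ξ : EE n → EE n) (c1 t : ℝ) (x : EE n) : EE n :=
  conc (c1 * t) (x + t • Ξ x) (e (ev (x + t • Ξ x) 0)) (e (ev (x + t • Ξ x) 1))

theorem flow_data (hG : IsFinslerEnergy n G ℓ α) (hΦ : IsRegularDomain n Φ δ₀) {c : ℝ} (hc : 0 < c)
    (hreg : ∀ x ∈ XX Φ, Jf G x = c → ∃ ξ : EE n, dJf G x ξ < 0 ∧
      ⟪gradient Φ (ev x 0), ev ξ 0⟫ = 0 ∧ ⟪gradient Φ (ev x 1), ev ξ 1⟫ = 0 ∧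
      ∀ s ∈ Ioo (0:ℝ) 1, Φ (ev x s) = 0 → ⟪gradient Φ (ev x s), ev ξ s⟫ ≤ 0) :
    ∃ κ > 0, ∃ e : Evec n → Evec n, ∃ Ξ : EE n → EE n, ∃ σ > 0, ∃ c1 > 0, ∃ D > 0, ∃ ε0 > 0,
      ContinuousOn e {p | Φ p ≤ 0 ∧ -κ ≤ Φ p} ∧ ContinuousOn Ξ (XX Φ) ∧
      ε0 ≤ c / 2 ∧ c1 * σ ≤ 1 / 4 ∧
      (∀ x ∈ XX Φ, |Jf G x - c| ≤ ε0 → ∀ t ∈ Icc 0 σ,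
        (∀ s ∈ Icc (0:ℝ) 1, Φ (ev (x + t • Ξ x) s) ≤ 0) ∧
        (∀ s ∈ ({0, 1} : Set ℝ), -κ ≤ Φ (ev (x + t • Ξ x) s) ∧
          ‖e (ev (x + t • Ξ x) s)‖ ≤ D * t) ∧
        (0 < t → stepE e Ξ c1 t x ∈ XX Φ ∧ Jf G (stepE e Ξ c1 t x) ≤ Jf G x - t / 8 ∧
          0 < Jf G (stepE e Ξ c1 t x))) ∧
      ((∀ q v, G q (-v) = G q v) → ∀ x ∈ XX Φ, ∀ s, ev (Ξ (rev x)) s = ev (Ξ x) (1 - s)) := by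
  have hl := hG.one_le_ell
  obtain ⟨κ, hκ, C, hC, e, hec, he⟩ := bdry_proj hΦ
  set c1 : ℝ := 1 / (32 * (c + 2)) with hc1
  have hc1p : 0 < c1 := by positivity
  have hc1m : c1 * (c + 2) = 1 / 32 := by rw [hc1]; field_simp
  set D : ℝ := min 1 (c1 / (8 * ℓ)) with hD
  have hDp : 0 < D := by positivity
  have hD2 : ℓ * D ^ 2 ≤ c1 / 8 := by
    have h1 : D ≤ 1 := min_le_left _ _
    have h2 : D ≤ c1 / (8 * ℓ) := min_le_right _ _
    have h3 : D ^ 2 ≤ c1 / (8 * ℓ) := by nlinarith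
    calc ℓ * D ^ 2 ≤ ℓ * (c1 / (8 * ℓ)) := by gcongr
      _ = c1 / 8 := by field_simp
  set c0 : ℝ := D / (3 * C) with hc0
  have hc0p : 0 < c0 := by positivity
  have hc0m : C * (3 * c0) = D := by rw [hc0]; field_simp
  obtain ⟨m, hm, hgood⟩ := uniform_good hG hΦ hc0p hreg
  obtain ⟨Ξ, hΞc, hΞ, hΞs⟩ := field_sym hG hΦ hc0p hm hgood
  obtain ⟨S, hS, hSb⟩ := XX_bdd hG hΦ (c + 1)
  obtain ⟨σd, hσd, hdesc⟩ := Jf_descent hG hS.le (L := 2 / m) (by positivity) (ε := 1 / 8)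
    (by norm_num)
  obtain ⟨B, hB, hgb⟩ := grad_bdd hΦ
  set η : ℝ := min (m ^ 2 / 8) (c0 * m / 4) with hη
  have hηp : 0 < η := by positivity
  have hη1 : η ≤ m ^ 2 / 8 := min_le_left _ _
  have hη2 : η ≤ c0 * m / 4 := min_le_right _ _
  obtain ⟨δ, hδ, htay⟩ := taylor hΦ hηp
  set M : ℝ := ℓ * ((S + 1) ^ 2 + (S + 1)) with hM
  have hMp : 0 < M := by positivity
  set σ : ℝ := min σd (min (δ * m / 4) (min (κ / (3 * c0)) (min (m ^ 2 / (8 * (B + η)))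
    (min (m / 2) (min (c * m / (8 * M)) 1))))) with hσ
  have hσp : 0 < σ := by positivity
  have hσ1 : σ ≤ σd := min_le_left _ _
  have hr1 := min_le_right σd (min (δ * m / 4) (min (κ / (3 * c0)) (min (m ^ 2 / (8 * (B + η)))
    (min (m / 2) (min (c * m / (8 * M)) 1)))))
  have hσ2 : σ ≤ δ * m / 4 := hr1.trans (min_le_left _ _)
  have hr2 := hr1.trans (min_le_right _ _)
  have hσ3 : σ ≤ κ / (3 * c0) := hr2.trans (min_le_left _ _)
  have hr3 := hr2.trans (min_le_right _ _)
  have hσ4 : σ ≤ m ^ 2 / (8 * (B + η)) := hr3.trans (min_le_left _ _)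
  have hr4 := hr3.trans (min_le_right _ _)
  have hσ5 : σ ≤ m / 2 := hr4.trans (min_le_left _ _)
  have hr5 := hr4.trans (min_le_right _ _)
  have hσ6 : σ ≤ c * m / (8 * M) := hr5.trans (min_le_left _ _)
  have hσ7 : σ ≤ 1 := hr5.trans (min_le_right _ _)
  rw [le_div_iff₀ (by positivity)] at hσ3 hσ4 hσ6
  have hc1σ : c1 * σ ≤ 1 / 4 := by nlinarith
  set ε0 : ℝ := min (m / 2) (min (c / 2) 1) with hε0
  have hε1 : ε0 ≤ m / 2 := min_le_left _ _
  have hε2 : ε0 ≤ c / 2 := (min_le_right _ _).trans (min_le_left _ _)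
  have hε3 : ε0 ≤ 1 := (min_le_right _ _).trans (min_le_right _ _)
  refine ⟨κ, hκ, e, Ξ, σ, hσp, c1, hc1p, D, hDp, ε0, by positivity, hec, hΞc, hε2, hc1σ, ?_, hΞs⟩
  intro x hx hJ t ht
  obtain ⟨hn, hrest⟩ := hΞ x hx
  obtain ⟨hd, hin, hb0, hb1⟩ := hrest (hJ.trans hε1)
  have hJ' := abs_le.1 hJ
  have ht0 := ht.1
  have hxS := hSb x hx (by linarith)
  set y : EE n := x + t • Ξ x with hy
  have hevy : ∀ s, ev y s = ev x s + t • ev (Ξ x) s := fun s => by rw [hy, ev_add, ev_smul]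
  have hmt : 4 * t / m ≤ 4 * σ / m := by gcongr; exact ht.2
  have hw : ∀ s, ‖t • ev (Ξ x) s‖ ≤ 4 * t / m := by
    intro s
    rw [norm_smul, Real.norm_of_nonneg ht0]
    calc t * ‖ev (Ξ x) s‖ ≤ t * (2 * (2 / m)) := by
          gcongr; exact (norm_ev_le _ _).trans (by gcongr)
      _ = 4 * t / m := by ring
  have hwδ : ∀ s, ‖t • ev (Ξ x) s‖ ≤ δ := by
    intro s
    refine ((hw s).trans hmt).trans ?_
    rw [div_le_iff₀ hm]; linarith
  have hsub : ∀ s ∈ Icc (0:ℝ) 1, Φ (ev y s) ≤ 0 := by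
    intro s hs
    have h1 := htay (ev x s) _ (hx.1 s hs) (hwδ s)
    rw [← hevy] at h1
    have h1' := (abs_le.1 h1).2
    have h2 : η * ‖t • ev (Ξ x) s‖ ≤ η * (4 * t / m) := by gcongr; exact hw s
    have h3 := hx.1 s hs
    rcases le_or_gt (-(m / 2)) (Φ (ev x s)) with h | h
    · have h4 := hin s hs h
      rw [real_inner_smul_right] at h1'
      have h5 : η * (4 * t / m) ≤ t * (m / 2) := by
        calc η * (4 * t / m) ≤ m ^ 2 / 8 * (4 * t / m) := by gcongr
          _ = t * (m / 2) := by field_simp; ring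
      have h6 : t * ⟪gradient Φ (ev x s), ev (Ξ x) s⟫ ≤ t * -(m / 2) := by gcongr
      linarith
    · have h4 : ⟪gradient Φ (ev x s), t • ev (Ξ x) s⟫ ≤ B * (4 * t / m) :=
        (real_inner_le_norm _ _).trans (mul_le_mul (hgb _ h3) (hw s) (norm_nonneg _) hB.le)
      have h5 : (B + η) * (4 * t / m) ≤ m / 2 := by
        calc (B + η) * (4 * t / m) ≤ (B + η) * (4 * σ / m) := by gcongr
          _ = σ * (8 * (B + η)) / (2 * m) := by field_simp; ring
          _ ≤ m ^ 2 / (2 * m) := by gcongr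
          _ = m / 2 := by field_simp
      linarith
  have hend : ∀ s ∈ ({0, 1} : Set ℝ), -(3 * c0 * t) ≤ Φ (ev y s) := by
    intro s hs
    have hb : Φ (ev x s) = 0 ∧ -(2 * c0) ≤ ⟪gradient Φ (ev x s), ev (Ξ x) s⟫ := by
      rcases hs with rfl | rfl
      · exact ⟨hx.2.1, hb0⟩
      · exact ⟨hx.2.2, hb1⟩
    have h1 := htay (ev x s) _ hb.1.le (hwδ s)
    rw [← hevy] at h1
    have h1' := (abs_le.1 h1).1
    rw [real_inner_smul_right, hb.1] at h1'
    have h2 : η * ‖t • ev (Ξ x) s‖ ≤ c0 * t := by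
      calc η * ‖t • ev (Ξ x) s‖ ≤ c0 * m / 4 * (4 * t / m) := by gcongr; exact hw s
        _ = c0 * t := by field_simp
    have h3 : t * -(2 * c0) ≤ t * ⟪gradient Φ (ev x s), ev (Ξ x) s⟫ := by gcongr; exact hb.2
    linarith
  have hs01 : ∀ s ∈ ({0, 1} : Set ℝ), s ∈ Icc (0:ℝ) 1 := by
    rintro s (rfl | rfl) <;> simp
  have hκe : ∀ s ∈ ({0, 1} : Set ℝ), -κ ≤ Φ (ev y s) := by
    intro s hs
    have h1 := hend s hs
    have h2 : t * (3 * c0) ≤ σ * (3 * c0) := by gcongr; exact ht.2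
    linarith
  have hee : ∀ s ∈ ({0, 1} : Set ℝ), ‖e (ev y s)‖ ≤ D * t := by
    intro s hs
    have h1 := (he _ (hsub s (hs01 s hs)) (hκe s hs)).2.1
    have h2 : |Φ (ev y s)| ≤ 3 * c0 * t := by
      rw [abs_of_nonpos (hsub s (hs01 s hs))]; linarith [hend s hs]
    calc ‖e (ev y s)‖ ≤ C * (3 * c0 * t) := h1.trans (by gcongr)
      _ = D * t := by rw [← hc0m]; ring
  refine ⟨hsub, fun s hs => ⟨hκe s hs, hee s hs⟩, fun htp => ?_⟩
  have hθ0 : 0 < c1 * t := by positivity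
  have hθ1 : c1 * t ≤ 1 / 4 := le_trans (by gcongr; exact ht.2) hc1σ
  have m0 : (0:ℝ) ∈ ({0, 1} : Set ℝ) := by simp
  have m1 : (1:ℝ) ∈ ({0, 1} : Set ℝ) := by simp
  have p0 := he _ (hsub 0 (hs01 0 m0)) (hκe 0 m0)
  have p1 := he _ (hsub 1 (hs01 1 m1)) (hκe 1 m1)
  obtain ⟨en1, en2⟩ := conc_energy hG hθ0 hθ1 y (e (ev y 0)) (e (ev y 1))
  have hyJ : Jf G y ≤ Jf G x - 3 / 8 * t := by
    have := hdesc x (Ξ x) t hxS hn ht0 (ht.2.trans hσ1)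
    have h2 : t * dJf G x (Ξ x) ≤ t * -(1 / 2) := by gcongr
    linarith
  have hyx : ‖y - x‖ ≤ 2 * t / m := by
    rw [hy, add_sub_cancel_left, norm_smul, Real.norm_of_nonneg ht0]
    calc t * ‖Ξ x‖ ≤ t * (2 / m) := by gcongr
      _ = 2 * t / m := by ring
  have hyl : c / 4 ≤ Jf G y := by
    have h1 : 2 * t / m ≤ 1 := by
      rw [div_le_one hm]; linarith [ht.2]
    have h2 : ‖y‖ ≤ S + 1 := by
      have := norm_add_le x (y - x)
      rw [add_sub_cancel] at this
      linarith
    have h3 := Jf_lip hG (S := S + 1) x y (by linarith) h2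
    have h4 : M * ‖y - x‖ ≤ c / 4 := by
      calc M * ‖y - x‖ ≤ M * (2 * σ / m) := by
            gcongr; refine hyx.trans ?_; gcongr; exact ht.2
        _ = σ * (8 * M) / (4 * m) := by field_simp; ring
        _ ≤ c * m / (4 * m) := by gcongr
        _ = c / 4 := by field_simp
    have h5 := (abs_le.1 h3).1
    linarith
  refine ⟨conc_mem hθ0 hθ1 hsub p0.1 p1.1 p0.2.2 p1.2.2, ?_, ?_⟩
  · refine en2.trans ?_
    have hk := kk_le' hθ0.le hθ1
    have h1 : kk (c1 * t) * Jf G y ≤ (1 + 4 * (c1 * t)) * Jf G y :=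
      mul_le_mul_of_nonneg_right hk (by linarith)
    have h2 : 4 * (c1 * t) * Jf G y ≤ 4 * (c1 * t) * (c + 2) := by gcongr; linarith
    have h3 : 4 * (c1 * t) * (c + 2) = t / 8 := by
      rw [show 4 * (c1 * t) * (c + 2) = 4 * t * (c1 * (c + 2)) by ring, hc1m]; ring
    have h4 : ‖e (ev y 0)‖ ^ 2 + ‖e (ev y 1)‖ ^ 2 ≤ 2 * (D * t) ^ 2 := by
      have a0 := pow_le_pow_left₀ (norm_nonneg _) (hee 0 m0) 2
      have a1 := pow_le_pow_left₀ (norm_nonneg _) (hee 1 m1) 2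
      linarith
    have h5 : ℓ * (‖e (ev y 0)‖ ^ 2 + ‖e (ev y 1)‖ ^ 2) / (c1 * t) ≤ t / 4 := by
      rw [div_le_iff₀ hθ0]
      calc ℓ * (‖e (ev y 0)‖ ^ 2 + ‖e (ev y 1)‖ ^ 2) ≤ ℓ * (2 * (D * t) ^ 2) := by gcongr
        _ = (ℓ * D ^ 2) * (2 * t ^ 2) := by ring
        _ ≤ c1 / 8 * (2 * t ^ 2) := by gcongr
        _ = t / 4 * (c1 * t) := by ring
    linarith
  · have : 0 < kk (c1 * t) * Jf G y := mul_pos (kk_pos _) (by linarith)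
    exact this.trans_le en1

end FD
end

noncomputable section
open MeasureTheory Set Filter RealInnerProductSpace Topology
namespace FD
variable {n : ℕ} {G : Evec n → Evec n → ℝ} {ℓ α : ℝ} {Φ : Evec n → ℝ} {δ₀ : ℝ}

open Classical in
/-- The deformation on the model space, with time function `T`. -/
def defo (e : Evec n → Evec n) (Ξ : EE n → EE n) (c1 t : ℝ) (x : EE n) : EE n :=
  if t = 0 then x else stepE e Ξ c1 t x

theorem tail_small {θ r : ℝ} (h0 : 0 < θ) (h1 : θ ≤ 1) {a : Evec n} (hr : ‖a‖ ^ 2 ≤ θ * r) :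
    ‖tail θ a‖ ≤ Real.sqrt r := by
  apply Real.le_sqrt_of_sq_le
  refine (tail_norm_sq h0 h1 a).trans ?_
  rw [div_le_iff₀ h0]; linarith

theorem defo_cont {κ σ c1 D : ℝ} (hc1 : 0 < c1) (hc1σ : c1 * σ ≤ 1 / 4)
    {e : Evec n → Evec n} {Ξ : EE n → EE n}
    (hec : ContinuousOn e {p | Φ p ≤ 0 ∧ -κ ≤ Φ p}) (hΞc : ContinuousOn Ξ (XX Φ))
    {T : ℝ × EE n → ℝ} (hT : Continuous T) {A : Set (ℝ × EE n)}
    (hA : ∀ z ∈ A, z.2 ∈ XX Φ ∧ 0 ≤ T z ∧ T z ≤ σ)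
    (hstep : ∀ z ∈ A, 0 < T z → ∀ s ∈ ({0, 1} : Set ℝ),
      Φ (ev (z.2 + T z • Ξ z.2) s) ≤ 0 ∧ -κ ≤ Φ (ev (z.2 + T z • Ξ z.2) s) ∧
      ‖e (ev (z.2 + T z • Ξ z.2) s)‖ ≤ D * T z) :
    ContinuousOn (fun z => defo e Ξ c1 (T z) z.2) A := by
  have m0 : (0:ℝ) ∈ ({0, 1} : Set ℝ) := by simp
  have m1 : (1:ℝ) ∈ ({0, 1} : Set ℝ) := by simp
  set Y : ℝ × EE n → EE n := fun z => z.2 + T z • Ξ z.2 with hY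
  have hYc : ContinuousOn Y A := by
    have h1 : ContinuousOn (fun z : ℝ × EE n => Ξ z.2) A :=
      hΞc.comp continuous_snd.continuousOn fun z hz => (hA z hz).1
    have h2 := hT.continuousOn.smul h1
    exact continuous_snd.continuousOn.add h2
  have hDil : ContinuousOn (fun z => dilE (c1 * T z) (Y z)) A := by
    have h1 : ContinuousOn (fun z => ((c1 * T z, Y z) : ℝ × EE n)) A :=
      (continuous_const.mul hT).continuousOn.prodMk hYc
    exact dilE_cont.comp_continuousOn h1
  intro z₀ hz₀
  rcases (hA z₀ hz₀).2.1.eq_or_lt with h0 | h0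
  · -- the time vanishes
    have hz : defo e Ξ c1 (T z₀) z₀.2 = z₀.2 := by unfold defo; rw [if_pos h0.symm]
    have hd0 : dilE (c1 * T z₀) (Y z₀) = z₀.2 := by
      rw [hY]; simp only [← h0, mul_zero, zero_smul, add_zero]; exact dilE_zero _
    have key : ∀ z ∈ A, ‖defo e Ξ c1 (T z) z.2 - dilE (c1 * T z) (Y z)‖ ≤
        3 * Real.sqrt (D ^ 2 / c1 * T z) := by
      intro z hz
      rcases (hA z hz).2.1.eq_or_lt with h | h
      · have : defo e Ξ c1 (T z) z.2 = dilE (c1 * T z) (Y z) := by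
          unfold defo; rw [if_pos h.symm, hY]; simp only [← h, mul_zero, zero_smul, add_zero]
          exact (dilE_zero _).symm
        rw [this, sub_self, norm_zero]; positivity
      · have hθ : 0 < c1 * T z := by positivity
        have hθ1 : c1 * T z ≤ 1 := by
          have : c1 * T z ≤ c1 * σ := by gcongr; exact (hA z hz).2.2
          linarith
        have hs : ∀ s ∈ ({0, 1} : Set ℝ), ‖tail (c1 * T z) (e (ev (Y z) s))‖ ≤
            Real.sqrt (D ^ 2 / c1 * T z) := by
          intro s hs
          apply tail_small hθ hθ1
          have := pow_le_pow_left₀ (norm_nonneg _) (hstep z hz h s hs).2.2 2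
          refine this.trans (le_of_eq ?_)
          field_simp
        have heq : defo e Ξ c1 (T z) z.2 - dilE (c1 * T z) (Y z) =
            tail (c1 * T z) (e (ev (Y z) 0)) + rev (tail (c1 * T z) (e (ev (Y z) 1))) := by
          unfold defo stepE conc; rw [if_neg h.ne']; abel
        rw [heq]
        have a0 := hs 0 m0
        have a1 := hs 1 m1
        have a2 := rev_norm (tail (c1 * T z) (e (ev (Y z) 1)))
        have a3 := norm_add_le (tail (c1 * T z) (e (ev (Y z) 0)))
          (rev (tail (c1 * T z) (e (ev (Y z) 1))))
        linarith
    have hR : Tendsto (fun z => defo e Ξ c1 (T z) z.2 - dilE (c1 * T z) (Y z)) (𝓝[A] z₀) (𝓝 0) := by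
      rw [tendsto_zero_iff_norm_tendsto_zero]
      refine squeeze_zero' (g := fun z => 3 * Real.sqrt (D ^ 2 / c1 * T z))
        (Eventually.of_forall fun _ => norm_nonneg _) ?_ ?_
      · filter_upwards [self_mem_nhdsWithin] with z hz using key z hz
      · have : Continuous fun z => 3 * Real.sqrt (D ^ 2 / c1 * T z) := by fun_prop
        have h := this.continuousWithinAt (s := A) (x := z₀)
        unfold ContinuousWithinAt at h
        simpa [← h0] using h
    have hd := hDil z₀ hz₀
    unfold ContinuousWithinAt at hd ⊢
    have hsum := hR.add hd
    simp only [zero_add, hd0] at hsum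
    simp only [hz]
    refine hsum.congr fun z => by simp
  · -- the time is positive
    have hB : {z | 0 < T z} ∈ 𝓝 z₀ := (isOpen_lt continuous_const hT).mem_nhds h0
    rw [← continuousWithinAt_inter hB]
    set A' := A ∩ {z | 0 < T z} with hA'
    have hz' : z₀ ∈ A' := ⟨hz₀, h0⟩
    have hYc' : ContinuousOn Y A' := hYc.mono inter_subset_left
    have he : ∀ s ∈ ({0, 1} : Set ℝ), ContinuousOn (fun z => e (ev (Y z) s)) A' := by
      intro s hs
      refine hec.comp ((ev_continuous_left s).comp_continuousOn hYc') fun z hz => ?_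
      have := hstep z hz.1 hz.2 s hs
      exact ⟨this.1, this.2.1⟩
    have ht : ∀ s ∈ ({0, 1} : Set ℝ),
        ContinuousOn (fun z => tail (c1 * T z) (e (ev (Y z) s))) A' := by
      intro s hs
      have h1 : ContinuousOn (fun z => ((c1 * T z, e (ev (Y z) s)) : ℝ × Evec n)) A' :=
        (continuous_const.mul hT).continuousOn.prodMk (he s hs)
      exact tail_cont.comp h1 fun z hz => (mul_pos hc1 hz.2).ne'
    have hall : ContinuousOn (fun z => stepE e Ξ c1 (T z) z.2) A' :=
      ((hDil.mono inter_subset_left).add (ht 0 m0)).add (rev_cont.comp_continuousOn (ht 1 m1))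
    refine (hall.congr fun z hz => ?_) z₀ hz'
    unfold defo; rw [if_neg (ne_of_gt hz.2)]

theorem step_rev {e : Evec n → Evec n} {Ξ : EE n → EE n} {c1 t : ℝ} (h0 : 0 ≤ c1 * t)
    (h1 : c1 * t ≤ 1 / 4) {x : EE n} (hs : ∀ s, ev (Ξ (rev x)) s = ev (Ξ x) (1 - s)) (s : ℝ) :
    ev (stepE e Ξ c1 t (rev x)) s = ev (stepE e Ξ c1 t x) (1 - s) := by
  have hy : ∀ s, ev (rev x + t • Ξ (rev x)) s = ev (x + t • Ξ x) (1 - s) := by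
    intro s; rw [ev_add, ev_smul, ev_add, ev_smul, ev_rev, hs]
  unfold stepE
  rw [ev_conc h0 h1, ev_conc h0 h1, hy, hy, hy, sub_zero, sub_self, sub_sub_cancel]
  have hk := kk_mul h1
  have : 1 - kk (c1 * t) * (s - c1 * t) = kk (c1 * t) * (1 - s - c1 * t) := by linarith
  rw [this]
  abel

end FD
end

noncomputable section
open MeasureTheory Set Filter RealInnerProductSpace Topology
namespace FD
variable {n : ℕ} {G : Evec n → Evec n → ℝ} {ℓ α : ℝ} {Φ : Evec n → ℝ} {δ₀ : ℝ}

theorem const_energy (hG : IsFinslerEnergy n G ℓ α) {x : H1Curve n 0 1} (h : IsConstCurve x) :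
    Jf G (toE x) = 0 := by
  have hi : IntervalIntegrable x.deriv volume 0 1 := by
    rw [intervalIntegrable_iff_integrableOn_Icc_of_le zero_le_one]; exact x.deriv_integrable
  have hae := hi.ae_hasDerivAt_integral
  have hd : ∀ᵐ s ∂μ1, x.deriv s = 0 := by
    have hn : ∀ᵐ s ∂μ1, s ≠ 1 := ae_restrict_of_ae (Measure.ae_ne volume 1)
    filter_upwards [ae_restrict_of_ae hae, ae_restrict_mem measurableSet_Ioc, hn] with s hs hs1 hs2
    have hs' : s ∈ Ioo (0:ℝ) 1 := ⟨hs1.1, lt_of_le_of_ne hs1.2 hs2⟩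
    have h1 := hs (by rw [uIcc_of_le zero_le_one]; exact ⟨hs1.1.le, hs1.2⟩) 0 (by simp)
    have h2 : HasDerivAt (fun r => ∫ y in (0:ℝ)..r, x.deriv y) 0 s := by
      refine (hasDerivAt_const s (0 : Evec n)).congr_of_eventuallyEq ?_
      filter_upwards [isOpen_Ioo.mem_nhds hs'] with r hr
      have hr' : r ∈ Icc (0:ℝ) 1 := ⟨hr.1.le, hr.2.le⟩
      have h3 := x.eq_add_integral r hr'
      rw [h r hr'] at h3
      exact left_eq_add.1 h3
    exact h1.unique h2
  unfold Jf
  have : ∫ s, G (ev (toE x) s) ((toE x).2 s) ∂μ1 = ∫ s, (0:ℝ) ∂μ1 := by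
    apply integral_congr_ae
    filter_upwards [toE_ae x, hd] with s h1 h2
    rw [h1, h2, G_zero hG]
  rw [this]; simp

/-- Cut-off in the energy. -/
def cut (c ε0 j : ℝ) : ℝ := max 0 (min 1 ((j - (c - ε0)) / (ε0 / 2)))

theorem cut_cont (c ε0 : ℝ) : Continuous (cut c ε0) := by unfold cut; fun_prop

theorem cut_mem (c ε0 j : ℝ) : cut c ε0 j ∈ Icc (0:ℝ) 1 :=
  ⟨le_max_left _ _, max_le zero_le_one (min_le_left _ _)⟩

theorem cut_zero {c ε0 j : ℝ} (h : 0 < ε0) (hj : j ≤ c - ε0) : cut c ε0 j = 0 := by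
  unfold cut
  apply max_eq_left
  exact (min_le_right _ _).trans (div_nonpos_of_nonpos_of_nonneg (by linarith) (by linarith))

theorem cut_one {c ε0 j : ℝ} (h : 0 < ε0) (hj : c - ε0 / 2 ≤ j) : cut c ε0 j = 1 := by
  unfold cut
  rw [min_eq_left, max_eq_right zero_le_one]
  rw [le_div_iff₀ (by linarith)]; linarith

end FD

end

/-- First deformation lemma: if `c > 0` is a `V⁻`-regular value for `J` on `Mf`, there exist
`ε > 0` and an admissible homotopy `h : [0,1] × J^{c+ε} → J^{c+ε}` with
`h(1,J^{c+ε}) ⊂ J^{c−ε}`. -/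
theorem stmt_16 {n : ℕ} (G : Evec n → Evec n → ℝ) (ℓ α : ℝ)
    (hG : IsFinslerEnergy n G ℓ α)
    (Φ : Evec n → ℝ) (δ₀ : ℝ) (hΦ : IsRegularDomain n Φ δ₀)
    (c : ℝ) (hc : 0 < c)
    (hreg : ∀ x : H1Curve n 0 1, IsVCritical G Φ x → energy G x ≠ c) :
    ∃ ε > (0:ℝ), ∃ h : ℝ → H1Curve n 0 1 → H1Curve n 0 1,
      -- h maps [0,1] × J^{c+ε} into J^{c+ε}
      (∀ τ ∈ Icc (0:ℝ) 1, ∀ x ∈ sublevel G Φ (c + ε), h τ x ∈ sublevel G Φ (c + ε)) ∧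
      -- h(0,·) = id
      (∀ x ∈ sublevel G Φ (c + ε), h 0 x = x) ∧
      -- continuity of h with respect to dist_*
      (∀ τ ∈ Icc (0:ℝ) 1, ∀ x ∈ sublevel G Φ (c + ε), ∀ ε' > (0:ℝ), ∃ η > (0:ℝ),
        ∀ τ' ∈ Icc (0:ℝ) 1, ∀ x' ∈ sublevel G Φ (c + ε),
          |τ' - τ| < η → starDist x x' < η → starDist (h τ x) (h τ' x') < ε') ∧
      -- constant curves are preserved
      (∀ τ ∈ Icc (0:ℝ) 1, ∀ x ∈ sublevel G Φ (c + ε),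
        IsConstCurve x → IsConstCurve (h τ x)) ∧
      -- non-constant curves stay non-constant
      (∀ τ ∈ Icc (0:ℝ) 1, ∀ x ∈ sublevel G Φ (c + ε),
        ¬ IsConstCurve x → ¬ IsConstCurve (h τ x)) ∧
      -- equivariance in the reversible case
      ((∀ q v : Evec n, G q (-v) = G q v) →
        ∀ x ∈ sublevel G Φ (c + ε), ∀ y : H1Curve n 0 1, RevRep x y →
          y ∈ sublevel G Φ (c + ε) ∧
          ∀ τ ∈ Icc (0:ℝ) 1, ∀ s : ℝ, (h τ y).toFun s = (h τ x).toFun (1 - s)) ∧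
      -- the deformation lowers the sublevel
      (∀ x ∈ sublevel G Φ (c + ε), h 1 x ∈ sublevel G Φ (c - ε)) := by
  open FD in
  have hreg' : ∀ x ∈ XX Φ, Jf G x = c → ∃ ξ : EE n, dJf G x ξ < 0 ∧
      ⟪gradient Φ (ev x 0), ev ξ 0⟫ = 0 ∧ ⟪gradient Φ (ev x 1), ev ξ 1⟫ = 0 ∧
      ∀ s ∈ Ioo (0:ℝ) 1, Φ (ev x s) = 0 → ⟪gradient Φ (ev x s), ev ξ s⟫ ≤ 0 := by
    intro x hx hJ
    by_contra hcon
    push Not at hcon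
    refine hreg (ofE x) ⟨(memMf_iff Φ _).2 (by rw [toE_ofE]; exact hx), fun ξ hξ => ?_⟩
      (by rw [energy_eq, toE_ofE, hJ])
    rw [dJ_eq, toE_ofE]
    by_contra hneg
    push Not at hneg
    have e0 := ev_toE ξ (s := 0) (by simp)
    have e1 := ev_toE ξ (s := 1) (by simp)
    obtain ⟨s, hs, h1, h2⟩ := hcon (toE ξ) hneg (by rw [e0]; exact hξ.1) (by rw [e1]; exact hξ.2.1)
    rw [ev_toE ξ ⟨hs.1.le, hs.2.le⟩] at h2
    exact absurd (hξ.2.2 s hs h1) (not_le.2 h2)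
  obtain ⟨κ, hκ, e, Ξ, σ, hσ, c1, hc1, D, hD, ε0, hε0, hec, hΞc, hεc, hc1σ, hstep, hsym⟩ :=
    FD.flow_data hG hΦ hc hreg'
  set T : ℝ × FD.EE n → ℝ := fun z => z.1 * (σ * FD.cut c ε0 (FD.Jf G z.2)) with hT
  have hTc : Continuous T :=
    continuous_fst.mul (continuous_const.mul
      ((FD.cut_cont c ε0).comp ((FD.Jf_cont hG).comp continuous_snd)))
  set ε : ℝ := min (ε0 / 2) (σ / 16) with hε
  have hεp : 0 < ε := by positivity
  have hε1 : ε ≤ ε0 / 2 := min_le_left _ _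
  have hε2 : ε ≤ σ / 16 := min_le_right _ _
  have hT01 : ∀ τ ∈ Icc (0:ℝ) 1, ∀ x, 0 ≤ T (τ, x) ∧ T (τ, x) ≤ σ := by
    intro τ hτ x
    have hm := FD.cut_mem c ε0 (FD.Jf G x)
    have h1 := mul_nonneg hσ.le hm.1
    refine ⟨mul_nonneg hτ.1 h1, ?_⟩
    calc τ * (σ * FD.cut c ε0 (FD.Jf G x)) ≤ 1 * (σ * 1) := by
          gcongr
          · exact hτ.2
          · exact hm.2
      _ = σ := by ring
  have hTband : ∀ τ x, FD.Jf G x ≤ c + ε → T (τ, x) ≠ 0 → |FD.Jf G x - c| ≤ ε0 := by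
    intro τ x hx h
    rw [abs_le]
    refine ⟨?_, by linarith⟩
    by_contra hlt
    apply h
    change τ * (σ * FD.cut c ε0 (FD.Jf G x)) = 0
    rw [FD.cut_zero hε0 (by linarith)]; simp
  set H : ℝ → FD.EE n → FD.EE n := fun τ x => FD.defo e Ξ c1 (T (τ, x)) x with hH
  have hH0 : ∀ τ x, T (τ, x) = 0 → H τ x = x := by
    intro τ x h
    change FD.defo e Ξ c1 (T (τ, x)) x = x
    unfold FD.defo; rw [if_pos h]
  have hH1 : ∀ τ x, T (τ, x) ≠ 0 → H τ x = FD.stepE e Ξ c1 (T (τ, x)) x := by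
    intro τ x h
    change FD.defo e Ξ c1 (T (τ, x)) x = _
    unfold FD.defo; rw [if_neg h]
  -- main properties on the model space
  have hmain : ∀ τ ∈ Icc (0:ℝ) 1, ∀ x ∈ FD.XX Φ, FD.Jf G x ≤ c + ε →
      H τ x ∈ FD.XX Φ ∧ FD.Jf G (H τ x) ≤ FD.Jf G x - T (τ, x) / 8 ∧
      (T (τ, x) ≠ 0 → 0 < FD.Jf G (H τ x)) := by
    intro τ hτ x hx hJ
    by_cases h : T (τ, x) = 0
    · rw [hH0 τ x h, h]
      exact ⟨hx, by simp, fun h' => absurd rfl h'⟩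
    · have hb := hTband τ x hJ h
      have hpos : 0 < T (τ, x) := lt_of_le_of_ne (hT01 τ hτ x).1 (Ne.symm h)
      have := (hstep x hx hb _ (hT01 τ hτ x)).2.2 hpos
      rw [hH1 τ x h]
      exact ⟨this.1, this.2.1, fun _ => this.2.2⟩
  classical
  set h : ℝ → H1Curve n 0 1 → H1Curve n 0 1 := fun τ x =>
    if T (τ, FD.toE x) = 0 then x else FD.ofE (H τ (FD.toE x)) with hh
  have hh0 : ∀ τ x, T (τ, FD.toE x) = 0 → h τ x = x := fun τ x h => if_pos h
  have hh1 : ∀ τ x, T (τ, FD.toE x) ≠ 0 → h τ x = FD.ofE (H τ (FD.toE x)) :=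
    fun τ x h => if_neg h
  have hhE : ∀ τ x, FD.toE (h τ x) = H τ (FD.toE x) := by
    intro τ x
    by_cases h : T (τ, FD.toE x) = 0
    · rw [hh0 τ x h, hH0 _ _ h]
    · rw [hh1 τ x h, FD.toE_ofE]
  have hsub : ∀ c' (x : H1Curve n 0 1), x ∈ sublevel G Φ c' ↔
      FD.toE x ∈ FD.XX Φ ∧ FD.Jf G (FD.toE x) ≤ c' := by
    intro c' x
    rw [← FD.memMf_iff, ← FD.energy_eq]; exact Iff.rfl
  have hconst : ∀ τ x, IsConstCurve x → h τ x = x := by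
    intro τ x hx
    apply hh0
    change τ * (σ * FD.cut c ε0 (FD.Jf G (FD.toE x))) = 0
    rw [FD.const_energy hG hx, FD.cut_zero hε0 (by linarith)]; simp
  refine ⟨ε, hεp, h, ?_, ?_, ?_, ?_, ?_, ?_, ?_⟩
  · intro τ hτ x hx
    rw [hsub] at hx ⊢
    rw [hhE]
    obtain ⟨h1, h2, -⟩ := hmain τ hτ _ hx.1 hx.2
    exact ⟨h1, by linarith [(hT01 τ hτ (FD.toE x)).1, hx.2]⟩
  · intro x _
    apply hh0
    change 0 * (σ * FD.cut c ε0 (FD.Jf G (FD.toE x))) = 0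
    simp
  · -- continuity
    set A : Set (ℝ × FD.EE n) := {z | z.1 ∈ Icc (0:ℝ) 1 ∧ z.2 ∈ FD.XX Φ ∧ FD.Jf G z.2 ≤ c + ε} with hA
    have hcont : ContinuousOn (fun z : ℝ × FD.EE n => FD.defo e Ξ c1 (T z) z.2) A := by
      refine FD.defo_cont (κ := κ) (σ := σ) (D := D) hc1 hc1σ hec hΞc hTc
        (fun z hz => ⟨hz.2.1, hT01 z.1 hz.1 z.2⟩) fun z hz hpos s hs => ?_
      have hb := hTband z.1 z.2 hz.2.2 hpos.ne'
      obtain ⟨g1, g2, -⟩ := hstep z.2 hz.2.1 hb (T z) (hT01 z.1 hz.1 z.2)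
      have hs01 : s ∈ Icc (0:ℝ) 1 := by rcases hs with rfl | rfl <;> simp
      exact ⟨g1 s hs01, g2 s hs⟩
    intro τ hτ x hx ε' hε'
    rw [hsub] at hx
    obtain ⟨η, hη, hd⟩ := Metric.continuousOn_iff.1 hcont (τ, FD.toE x) ⟨hτ, hx⟩ (ε' / 3)
      (by positivity)
    refine ⟨η, hη, fun τ' hτ' x' hx' h1 h2 => ?_⟩
    rw [hsub] at hx'
    have h3 := hd (τ', FD.toE x') ⟨hτ', hx'⟩ (by
      rw [Prod.dist_eq, max_lt_iff, Real.dist_eq, dist_comm, dist_eq_norm]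
      exact ⟨h1, (FD.norm_toE_sub_le x x').trans_lt h2⟩)
    have h4 := FD.starDist_le (h τ x) (h τ' x')
    rw [hhE, hhE] at h4
    rw [dist_comm, dist_eq_norm] at h3
    have h5 : ‖H τ (FD.toE x) - H τ' (FD.toE x')‖ < ε' / 3 := h3
    linarith
  · intro τ _ x _ hx
    rw [hconst τ x hx]; exact hx
  · intro τ hτ x hx hnc hcst
    by_cases hz : T (τ, FD.toE x) = 0
    · rw [hh0 τ x hz] at hcst; exact hnc hcst
    · rw [hsub] at hx
      have h1 := (hmain τ hτ _ hx.1 hx.2).2.2 hz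
      have h2 := FD.const_energy hG hcst
      rw [hhE] at h2
      linarith
  · intro hr x hx y hxy
    rw [hsub] at hx
    have hy := FD.toE_rev hxy
    refine ⟨?_, fun τ hτ s => ?_⟩
    · rw [hsub, hy, FD.Jf_rev hr]; exact ⟨FD.rev_XX hx.1, hx.2⟩
    · have hTe : T (τ, FD.toE y) = T (τ, FD.toE x) := by
        change τ * (σ * FD.cut c ε0 (FD.Jf G (FD.toE y))) = τ * (σ * FD.cut c ε0 (FD.Jf G (FD.toE x)))
        rw [hy, FD.Jf_rev hr]
      by_cases hz : T (τ, FD.toE x) = 0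
      · rw [hh0 τ x hz, hh0 τ y (hTe.trans hz)]; exact hxy.1 s
      · rw [hh1 τ x hz, hh1 τ y (by rw [hTe]; exact hz)]
        change FD.ev (H τ (FD.toE y)) s = FD.ev (H τ (FD.toE x)) (1 - s)
        rw [hH1 τ _ hz, hH1 τ _ (by rw [hTe]; exact hz), hTe, hy]
        have hb := hT01 τ hτ (FD.toE x)
        refine FD.step_rev (mul_nonneg hc1.le hb.1) ?_ (hsym hr _ hx.1) s
        exact le_trans (mul_le_mul_of_nonneg_left hb.2 hc1.le) hc1σ
  · intro x hx
    rw [hsub] at hx ⊢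
    rw [hhE]
    have h1m : (1:ℝ) ∈ Icc (0:ℝ) 1 := by simp
    obtain ⟨h1, h2, -⟩ := hmain 1 h1m _ hx.1 hx.2
    refine ⟨h1, ?_⟩
    rcases le_total (FD.Jf G (FD.toE x)) (c - ε0 / 2) with hle | hle
    · linarith [(hT01 1 h1m (FD.toE x)).1]
    · have hTσ : T (1, FD.toE x) = σ := by
        change 1 * (σ * FD.cut c ε0 (FD.Jf G (FD.toE x))) = σ
        rw [FD.cut_one hε0 hle]; ring
      rw [hTσ] at h2
      linarith [hx.2]

end
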